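/- Let G be a minimal brick on 2n vertices. Then G has at most 5n − 7 edges, unless G is the prism or the wheel on four, six, or eight vertices. -/

import Mathlib

open SimpleGraph

/-- A graph has a perfect matching. -/
def HasPerfectMatching {V : Type*} (G : SimpleGraph V) : Prop :=
  ∃ M : G.Subgraph, M.IsPerfectMatching

/-- `G` is 3-connected: at least 4 vertices, and deleting any at most 2
vertices leaves a connected graph. -/
def IsThreeConnected {V : Type*} [Fintype V] (G : SimpleGraph V) : Prop :=
  4 ≤ Fintype.card V ∧ ∀ S : Set V, S.ncard ≤ 2 → (G.induce Sᶜ).Connected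

/-- A brick: a 3-connected graph such that deleting any two distinct vertices
leaves a graph with a perfect matching. -/
def IsBrick {V : Type*} [Fintype V] (G : SimpleGraph V) : Prop :=
  IsThreeConnected G ∧
    ∀ u v : V, u ≠ v → HasPerfectMatching (G.induce ({u, v} : Set V)ᶜ)

/-- A minimal brick: a brick such that deleting any edge destroys brickness. -/
def IsMinimalBrick {V : Type*} [Fintype V] (G : SimpleGraph V) : Prop :=
  IsBrick G ∧ ∀ e ∈ G.edgeSet, ¬ IsBrick (G.deleteEdges {e})

/-- The prism: two disjoint triangles joined by a perfect matching. -/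
def prism : SimpleGraph (Fin 2 × Fin 3) :=
  SimpleGraph.fromRel (fun a b => (a.1 = b.1 ∧ a.2 ≠ b.2) ∨ (a.1 ≠ b.1 ∧ a.2 = b.2))

/-- The wheel with rim a cycle on m vertices plus a hub adjacent to all rim
vertices; it has m + 1 vertices. -/
def wheel (m : ℕ) : SimpleGraph (Option (Fin m)) :=
  SimpleGraph.fromRel (fun a b =>
    a = none ∨ ∃ i j : Fin m, a = some i ∧ b = some j ∧ (i.val + 1) % m = j.val)

set_option linter.all false
set_option linter.unusedSectionVars false
set_option linter.unusedSimpArgs false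
set_option linter.unusedVariables false

section Basics
variable {V : Type*} [DecidableEq V]

def IsPM (H : SimpleGraph V) (Y : Finset V) (f : V → V) : Prop :=
  ∀ z ∈ Y, f z ∈ Y ∧ f (f z) = z ∧ H.Adj z (f z)
def HasPM (H : SimpleGraph V) (Y : Finset V) : Prop := ∃ f, IsPM H Y f

theorem IsPM.mono' {H H' : SimpleGraph V} {Y : Finset V} {f : V → V} (h : IsPM H Y f)
    (hh : ∀ x ∈ Y, ∀ y ∈ Y, H.Adj x y → H'.Adj x y) : IsPM H' Y f := fun z hz =>
  ⟨(h z hz).1, (h z hz).2.1, hh _ hz _ (h z hz).1 (h z hz).2.2⟩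
theorem HasPM.mono' {H H' : SimpleGraph V} {Y : Finset V} (h : HasPM H Y)
    (hh : ∀ x ∈ Y, ∀ y ∈ Y, H.Adj x y → H'.Adj x y) : HasPM H' Y :=
  let ⟨f, hf⟩ := h; ⟨f, hf.mono' hh⟩
theorem HasPM.mono {H H' : SimpleGraph V} {Y : Finset V} (h : HasPM H Y) (hh : H ≤ H') :
    HasPM H' Y := h.mono' fun _ _ _ _ h => hh h
theorem IsPM.mono {H H' : SimpleGraph V} {Y : Finset V} {f} (h : IsPM H Y f) (hh : H ≤ H') :
    IsPM H' Y f := h.mono' fun _ _ _ _ h => hh h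

theorem IsPM.ne {H : SimpleGraph V} {Y : Finset V} {f} (h : IsPM H Y f) {z} (hz : z ∈ Y) :
    f z ≠ z := fun e => (h z hz).2.2.ne e.symm
theorem IsPM.inj {H : SimpleGraph V} {Y : Finset V} {f} (h : IsPM H Y f) {z w} (hz : z ∈ Y)
    (hw : w ∈ Y) (e : f z = f w) : z = w := by
  rw [← (h z hz).2.1, e, (h w hw).2.1]

theorem HasPM.empty (H : SimpleGraph V) : HasPM H ∅ := ⟨id, fun z hz => by simp at hz⟩

theorem HasPM.union {H : SimpleGraph V} {A B : Finset V} (hA : HasPM H A) (hB : HasPM H B)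
    (hd : Disjoint A B) : HasPM H (A ∪ B) := by
  obtain ⟨f, hf⟩ := hA
  obtain ⟨g, hg⟩ := hB
  refine ⟨fun z => if z ∈ A then f z else g z, fun z hz => ?_⟩
  by_cases h : z ∈ A
  · have := hf z h
    simp [h, this]
  · have hz' : z ∈ B := by simpa [h] using hz
    have h1 := hg z hz'
    have : g z ∉ A := fun h' => Finset.disjoint_left.1 hd h' h1.1
    simp [h, this, h1]

theorem HasPM.pair {H : SimpleGraph V} {x y : V} (h : H.Adj x y) : HasPM H {x, y} := by
  refine ⟨fun z => if z = x then y else x, fun z hz => ?_⟩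
  have hne := h.ne
  have := h.symm
  simp at hz
  rcases hz with rfl | rfl
  · simp [h, hne.symm]
  · simp [h, hne.symm, this]

theorem HasPM.add_pair {H : SimpleGraph V} {A : Finset V} {x y : V} (hA : HasPM H A)
    (h : H.Adj x y) (hx : x ∉ A) (hy : y ∉ A) : HasPM H (A ∪ {x, y}) :=
  hA.union (HasPM.pair h) (by simp [hx, hy])

theorem HasPM.biUnion {ι : Type*} [DecidableEq ι] {H : SimpleGraph V} (s : Finset ι)
    (F : ι → Finset V) (h : ∀ i ∈ s, HasPM H (F i))
    (hd : ∀ i ∈ s, ∀ j ∈ s, i ≠ j → Disjoint (F i) (F j)) : HasPM H (s.biUnion F) := by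
  induction s using Finset.induction_on with
  | empty => simpa using HasPM.empty H
  | insert a s ha ih =>
    rw [Finset.biUnion_insert]
    refine (h a (by simp)).union (ih (fun i hi => h i (by simp [hi]))
      (fun i hi j hj => hd i (by simp [hi]) j (by simp [hj]))) ?_
    rw [Finset.disjoint_biUnion_right]
    intro i hi
    exact hd a (by simp) i (by simp [hi]) (by rintro rfl; exact ha hi)

theorem IsPM.sub {H : SimpleGraph V} {Y Z : Finset V} {f} (h : IsPM H Y f) (hZ : Z ⊆ Y)
    (hc : ∀ z ∈ Z, f z ∈ Z) : IsPM H Z f := fun z hz =>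
  ⟨hc z hz, (h z (hZ hz)).2⟩

theorem IsPM.sdiff {H : SimpleGraph V} {Y Z : Finset V} {f} (h : IsPM H Y f)
    (hZ : ∀ z ∈ Z, z ∈ Y) (hc : ∀ z ∈ Z, f z ∈ Z) : IsPM H (Y \ Z) f :=
  h.sub Finset.sdiff_subset (by
    intro z hz
    simp at hz ⊢
    refine ⟨(h z hz.1).1, fun h' => hz.2 ?_⟩
    have := hc _ h'
    rwa [(h z hz.1).2.1] at this)

theorem IsPM.sdiff_edge {H : SimpleGraph V} {Y : Finset V} {f} (h : IsPM H Y f) {x} (hx : x ∈ Y) :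
    IsPM H (Y \ {x, f x}) f := by
  apply h.sdiff
  · simp [hx, (h x hx).1]
  · simp [(h x hx).2.1]

theorem HasPM.exists_edge {H : SimpleGraph V} {Y : Finset V} {x y : V} (h : HasPM H (Y \ {x, y}))
    (hx : x ∈ Y) (hy : y ∈ Y) (ha : H.Adj x y) : ∃ f, IsPM H Y f ∧ f x = y ∧ f y = x := by
  obtain ⟨f, hf⟩ := h
  have hne := ha.ne
  have ha' := ha.symm
  refine ⟨fun z => if z = x then y else if z = y then x else f z, fun z hz => ?_, by simp,
    by simp [hne.symm]⟩
  by_cases h1 : z = x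
  · subst h1; simp [hne.symm, hy, ha]
  · by_cases h2 : z = y
    · subst h2; simp [h1, hx, ha']
    · have := hf z (by simp [hz, h1, h2])
      simp at this
      simp [h1, h2, this]

theorem IsPM.even {H : SimpleGraph V} {Y : Finset V} {f} (h : IsPM H Y f) : Even Y.card := by
  have := Finset.sum_involution (s := Y) (f := fun _ => (1 : ZMod 2)) (fun z _ => f z)
    (fun a ha => by decide) (fun a ha _ => h.ne ha) (fun a ha => (h a ha).1) (fun a ha => (h a ha).2.1)
  simp at this
  exact (ZMod.natCast_eq_zero_iff_even).1 this

theorem HasPM.even {H : SimpleGraph V} {Y : Finset V} (h : HasPM H Y) : Even Y.card :=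
  let ⟨_, hf⟩ := h; hf.even
end Basics

section TutteSec
variable {V : Type*} [DecidableEq V]

theorem hasPM_iff (G : SimpleGraph V) (s : Set V) (Y : Finset V) (hs : ∀ z, z ∈ s ↔ z ∈ Y) :
    (∃ M : (G.induce s).Subgraph, M.IsPerfectMatching) ↔ HasPM G Y := by
  constructor
  · rintro ⟨M, hM⟩
    rw [Subgraph.isPerfectMatching_iff] at hM
    choose g hg hg2 using hM
    classical
    refine ⟨fun z => if h : z ∈ s then (g ⟨z, h⟩ : V) else z, fun z hz => ?_⟩
    have hz' := (hs z).2 hz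
    simp only [hz', dif_pos, Subtype.coe_prop]
    refine ⟨(hs _).1 (g ⟨z, hz'⟩).2, ?_, ?_⟩
    · have := hg2 (g ⟨z, hz'⟩) ⟨z, hz'⟩ (hg ⟨z, hz'⟩).symm
      rw [← this]
    · have := (hg ⟨z, hz'⟩).adj_sub
      simpa using this
  · rintro ⟨f, hf⟩
    refine ⟨{ verts := Set.univ, Adj := fun a b => f a = b, adj_sub := ?_, edge_vert := by simp, symm := ?_ }, ?_⟩
    · intro a b h
      have := hf a ((hs _).1 a.2)
      simp [← h, this.2.2]
    · refine ⟨fun a b h => ?_⟩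
      have := hf a ((hs _).1 a.2)
      rw [← h, this.2.1]
    · rw [Subgraph.isPerfectMatching_iff]
      intro v
      have := hf v ((hs _).1 v.2)
      refine ⟨⟨f v, (hs _).2 this.1⟩, rfl, fun y hy => Subtype.ext (Eq.symm (show f v = y from hy))⟩

/-- odd closed family -/
structure OddFam (H : SimpleGraph V) (Y T : Finset V) (C : Finset (Finset V)) : Prop where
  sub : ∀ K ∈ C, K ⊆ Y \ T
  odd : ∀ K ∈ C, Odd K.card
  closed : ∀ K ∈ C, ∀ x ∈ K, ∀ y ∈ Y \ T, H.Adj x y → y ∈ K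
  disj : ∀ K ∈ C, ∀ L ∈ C, K ≠ L → Disjoint K L

theorem tutte0 (H : SimpleGraph V) (Y : Finset V) (h : ¬ HasPM H Y) :
    ∃ T C, T ⊆ Y ∧ OddFam H Y T C ∧ T.card < C.card := by
  classical
  rw [← hasPM_iff H (↑Y) Y (by simp), SimpleGraph.tutte] at h
  push Not at h
  obtain ⟨u, hu⟩ := h
  unfold IsTutteViolator at hu
  set D := ((⊤ : (H.induce (Y : Set V)).Subgraph).deleteVerts u) with hD
  let F : D.coe.ConnectedComponent → Finset V := fun c =>
    Y.filter fun z => ∃ h : z ∈ (Y : Set V), ∃ h' : (⟨z, h⟩ : (Y : Set V)) ∈ D.verts, D.coe.connectedComponentMk ⟨⟨z, h⟩, h'⟩ = c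
  have memF : ∀ c z, z ∈ F c ↔ ∃ h : z ∈ (Y : Set V), ∃ h' : (⟨z, h⟩ : (Y : Set V)) ∈ D.verts, D.coe.connectedComponentMk ⟨⟨z, h⟩, h'⟩ = c := by
    intro c z
    simp only [F, Finset.mem_filter]
    constructor
    · exact fun h => h.2
    · exact fun h => ⟨by obtain ⟨h, _⟩ := h; simpa using h, h⟩
  have hinj : Function.Injective F := by
    intro c d hcd
    induction c using ConnectedComponent.ind with
    | _ v =>
      have : (v.1.1) ∈ F (D.coe.connectedComponentMk v) := (memF _ _).2 ⟨v.1.2, v.2, rfl⟩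
      rw [hcd, memF] at this
      obtain ⟨_, _, h⟩ := this
      exact h
  have hdis : ∀ c d, c ≠ d → Disjoint (F c) (F d) := by
    intro c d hcd
    rw [Finset.disjoint_left]
    intro z hz hz'
    rw [memF] at hz hz'
    obtain ⟨_, _, h1⟩ := hz
    obtain ⟨_, _, h2⟩ := hz'
    exact hcd (h1.symm.trans h2)
  have hfin : D.coe.oddComponents.Finite := Set.toFinite _
  have hcard : ∀ c, (F c).card = c.supp.ncard := by
    intro c
    have : (F c : Set V) = (fun v : D.verts => (v.1 : V)) '' c.supp := by
      ext z
      simp only [Finset.mem_coe, memF, Set.mem_image]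
      constructor
      · rintro ⟨h, h', e⟩
        exact ⟨⟨⟨z, h⟩, h'⟩, e, rfl⟩
      · rintro ⟨v, hv, rfl⟩
        exact ⟨v.1.2, v.2, hv⟩
    rw [← Set.ncard_coe_finset, this, Set.ncard_image_of_injective]
    intro a b hab
    exact Subtype.ext (Subtype.ext hab)
  refine ⟨(Set.toFinite u).toFinset.map (Function.Embedding.subtype _), hfin.toFinset.image F, ?_, ⟨?_, ?_, ?_, ?_⟩, ?_⟩
  · intro z hz
    simp at hz
    exact hz.1
  · intro K hK z hz
    simp only [Finset.mem_image] at hK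
    obtain ⟨c, hc, rfl⟩ := hK
    rw [memF] at hz
    obtain ⟨h, h', _⟩ := hz
    simp [hD] at h' h ⊢
    exact ⟨h, fun _ => h'⟩
  · intro K hK
    simp only [Finset.mem_image] at hK
    obtain ⟨c, hc, rfl⟩ := hK
    rw [hcard]
    simpa using hc
  · intro K hK x hx y hy hxy
    simp only [Finset.mem_image] at hK
    obtain ⟨c, hc, rfl⟩ := hK
    rw [memF] at hx ⊢
    obtain ⟨h, h', e⟩ := hx
    simp at hy
    have hy1 : y ∈ (Y : Set V) := by simpa using hy.1
    have hy2 : (⟨y, hy1⟩ : (Y : Set V)) ∈ D.verts := by simp [hD]; exact hy.2 hy.1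
    refine ⟨hy1, hy2, ?_⟩
    rw [← e]
    apply ConnectedComponent.sound
    apply SimpleGraph.Adj.reachable
    have h1 := h'
    simp [hD] at h1
    have h2 := hy.2 hy.1
    simp [hD, hxy.symm, h1, h2, hy.1]
  · intro K hK L hL hKL
    simp only [Finset.mem_image] at hK hL
    obtain ⟨c, hc, rfl⟩ := hK
    obtain ⟨d, hd, rfl⟩ := hL
    exact hdis _ _ fun e => hKL (by rw [e])
  · rw [Finset.card_map, Finset.card_image_of_injective _ hinj, ← Set.ncard_eq_toFinset_card, ← Set.ncard_eq_toFinset_card]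
    exact hu

theorem OddFam.parity {H : SimpleGraph V} {Y T : Finset V} {C : Finset (Finset V)} (h : OddFam H Y T C) :
    (C.biUnion id).card % 2 = C.card % 2 := by
  rw [Finset.card_biUnion (t := id) (fun K hK L hL => h.disj K hK L hL), Finset.card_eq_sum_ones,
    Finset.sum_nat_mod, Finset.sum_nat_mod (f := fun _ => 1)]
  congr 1
  apply Finset.sum_congr rfl
  intro K hK
  simpa [Nat.odd_iff] using h.odd K hK

theorem tutte1 (H : SimpleGraph V) (Y : Finset V) (hY : Even Y.card) (h : ¬ HasPM H Y) :
    ∃ T C, T ⊆ Y ∧ OddFam H Y T C ∧ T.card + 2 ≤ C.card := by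
  obtain ⟨T, C, hT, hC, hlt⟩ := tutte0 H Y h
  by_cases hc : T.card + 2 ≤ C.card
  · exact ⟨T, C, hT, hC, hc⟩
  have hsub : C.biUnion id ⊆ Y \ T := by
    intro z hz
    simp only [Finset.mem_biUnion] at hz
    obtain ⟨K, hK, hz⟩ := hz
    exact hC.sub K hK hz
  set R := (Y \ T) \ C.biUnion id with hR
  have hpar := hC.parity
  have hcR : R.card + (C.biUnion id).card + T.card = Y.card := by
    rw [hR, Finset.card_sdiff_add_card_eq_card hsub, Finset.card_sdiff_add_card_eq_card hT]
  have hodd : Odd R.card := by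
    rw [Nat.odd_iff]; rw [Nat.even_iff] at hY; omega
  have hRdis : ∀ K ∈ C, Disjoint R K := by
    intro K hK
    rw [Finset.disjoint_left]
    intro z hz hz'
    rw [hR, Finset.mem_sdiff] at hz
    exact hz.2 (Finset.mem_biUnion.2 ⟨K, hK, hz'⟩)
  have hRn : R ∉ C := by
    intro hRC
    have := hRdis R hRC
    rw [disjoint_self] at this
    rw [this] at hodd
    simp at hodd
  refine ⟨T, insert R C, hT, ⟨?_, ?_, ?_, ?_⟩, ?_⟩
  · intro K hK
    rcases Finset.mem_insert.1 hK with rfl | hK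
    · exact Finset.sdiff_subset
    · exact hC.sub K hK
  · intro K hK
    rcases Finset.mem_insert.1 hK with rfl | hK
    · exact hodd
    · exact hC.odd K hK
  · intro K hK x hx y hy hxy
    rcases Finset.mem_insert.1 hK with rfl | hK
    · rw [hR, Finset.mem_sdiff]
      refine ⟨hy, fun hy' => ?_⟩
      obtain ⟨L, hL, hyL⟩ := Finset.mem_biUnion.1 hy'
      have := hC.closed L hL y hyL x (Finset.mem_sdiff.1 hx).1 hxy.symm
      exact Finset.disjoint_left.1 (hRdis L hL) hx this
    · exact hC.closed K hK x hx y hy hxy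
  · intro K hK L hL hne
    rcases Finset.mem_insert.1 hK with rfl | hK <;> rcases Finset.mem_insert.1 hL with rfl | hL
    · exact absurd rfl hne
    · exact hRdis L hL
    · exact (hRdis K hK).symm
    · exact hC.disj K hK L hL hne
  · rw [Finset.card_insert_of_notMem hRn]; omega
end TutteSec

section Barrier
variable {V : Type*} [DecidableEq V]

theorem OddFam.ex {H : SimpleGraph V} {Y T : Finset V} {C : Finset (Finset V)} (h : OddFam H Y T C)
    {f} (hf : IsPM H Y f) {K} (hK : K ∈ C) : ∃ z ∈ K, f z ∈ T := by
  by_contra hcon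
  push Not at hcon
  have : IsPM H K f := hf.sub (fun z hz => (Finset.mem_sdiff.1 (h.sub K hK hz)).1) (fun z hz => by
    have h1 := hf z (Finset.mem_sdiff.1 (h.sub K hK hz)).1
    exact h.closed K hK z hz _ (Finset.mem_sdiff.2 ⟨h1.1, hcon z hz⟩) h1.2.2)
  exact (Nat.not_even_iff_odd.2 (h.odd K hK)) this.even

theorem OddFam.mem_Y {H : SimpleGraph V} {Y T : Finset V} {C : Finset (Finset V)} (h : OddFam H Y T C)
    {K z} (hK : K ∈ C) (hz : z ∈ K) : z ∈ Y := (Finset.mem_sdiff.1 (h.sub K hK hz)).1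
theorem OddFam.not_T {H : SimpleGraph V} {Y T : Finset V} {C : Finset (Finset V)} (h : OddFam H Y T C)
    {K z} (hK : K ∈ C) (hz : z ∈ K) : z ∉ T := (Finset.mem_sdiff.1 (h.sub K hK hz)).2
theorem OddFam.eq {H : SimpleGraph V} {Y T : Finset V} {C : Finset (Finset V)} (h : OddFam H Y T C)
    {K L z} (hK : K ∈ C) (hL : L ∈ C) (hz : z ∈ K) (hz' : z ∈ L) : K = L := by
  by_contra hne
  exact Finset.disjoint_left.1 (h.disj K hK L hL hne) hz hz'

theorem OddFam.cnt {H : SimpleGraph V} {Y T : Finset V} {C : Finset (Finset V)} (h : OddFam H Y T C)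
    {f} (hf : IsPM H Y f) : C.card ≤ T.card ∧ (T.card ≤ C.card →
      (∀ K ∈ C, ∀ z ∈ K, ∀ z' ∈ K, f z ∈ T → f z' ∈ T → z = z') ∧ ∀ t ∈ T, ∃ K ∈ C, f t ∈ K) := by
  choose z hz hzT using fun K : C => h.ex hf K.2
  have hinj : Function.Injective fun K : C => f (z K) := by
    intro K L e
    have : z K = z L := hf.inj (h.mem_Y K.2 (hz K)) (h.mem_Y L.2 (hz L)) e
    exact Subtype.ext (h.eq K.2 L.2 (hz K) (this ▸ hz L))
  have hsub : (Finset.univ.image fun K : C => f (z K)) ⊆ T := by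
    intro t ht
    simp only [Finset.mem_image] at ht
    obtain ⟨K, _, rfl⟩ := ht
    exact hzT K
  have hcard : (Finset.univ.image fun K : C => f (z K)).card = C.card := by
    rw [Finset.card_image_of_injective _ hinj]; simp
  refine ⟨hcard ▸ Finset.card_le_card hsub, fun hle => ?_⟩
  have heq := Finset.eq_of_subset_of_card_le hsub (by rw [hcard]; exact hle)
  have key : ∀ t ∈ T, ∃ K : C, f (z K) = t := by
    intro t ht
    rw [← heq] at ht
    simpa using ht
  have k2 : ∀ K (hK : K ∈ C), ∀ w ∈ K, f w ∈ T → w = z ⟨K, hK⟩ := by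
    intro K hK w hw hT
    obtain ⟨L, hL⟩ := key _ hT
    have : z L = w := hf.inj (h.mem_Y L.2 (hz L)) (h.mem_Y hK hw) hL
    have e : L.1 = K := h.eq L.2 hK (hz L) (this ▸ hw)
    have e' : L = ⟨K, hK⟩ := Subtype.ext e
    rw [← this, e']
  refine ⟨fun K hK w hw w' hw' h1 h2 => (k2 K hK w hw h1).trans (k2 K hK w' hw' h2).symm, fun t ht => ?_⟩
  obtain ⟨L, hL⟩ := key t ht
  exact ⟨L, L.2, by rw [← hL, (hf _ (h.mem_Y L.2 (hz L))).2.1]; exact hz L⟩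

structure Elem (H : SimpleGraph V) (U : Finset V) : Prop where
  sub : ∀ x y, H.Adj x y → x ∈ U
  pm : HasPM H U
  cut : ∀ X ⊆ U, X.Nonempty → X ≠ U → ∃ x ∈ X, ∃ y ∈ U \ X, H.Adj x y ∧ HasPM H (U \ {x, y})

structure Bar (H : SimpleGraph V) (U S : Finset V) (C : Finset (Finset V)) : Prop where
  sub : S ⊆ U
  ne : S.Nonempty
  fam : OddFam H U S C
  card : S.card ≤ C.card

variable {H : SimpleGraph V} {U S : Finset V} {C : Finset (Finset V)}

theorem Bar.cover (hE : Elem H U) (hB : Bar H U S C) {z} (hz : z ∈ U) : z ∈ S ∨ ∃ K ∈ C, z ∈ K := by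
  by_contra hcon
  push Not at hcon
  obtain ⟨s, hs⟩ := hB.ne
  obtain ⟨x, hx, y, hy, hxy, hpm⟩ := hE.cut ((U \ S) \ C.biUnion id)
    (fun w hw => (Finset.mem_sdiff.1 (Finset.mem_sdiff.1 hw).1).1) ⟨z, by simp; exact ⟨⟨hz, hcon.1⟩, hcon.2⟩⟩
    (fun e => by
      have := hB.sub hs
      rw [← e] at this
      simp at this
      exact this.1.2 hs)
  simp at hx hy
  obtain ⟨f, hf, h1, h2⟩ := hpm.exists_edge hx.1.1 hy.1 hxy
  have hc := (hB.fam.cnt hf).2 hB.card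
  by_cases hyS : y ∈ S
  · obtain ⟨K, hK, hfK⟩ := hc.2 y hyS
    rw [h2] at hfK
    exact hx.2 K hK hfK
  · obtain ⟨K, hK, hyK⟩ := hy.2 hy.1 hyS
    exact hx.2 K hK (hB.fam.closed K hK y hyK x (by simp [hx.1]) hxy.symm)

open Classical in
theorem Bar.hall (hE : Elem H U) (hB : Bar H U S C) {A : Finset V} (hA : A ⊆ S) (hne : A.Nonempty)
    (hneS : A ≠ S) : A.card + 1 ≤ (C.filter fun K => ∃ a ∈ A, ∃ z ∈ K, H.Adj a z).card := by
  set D := C.filter fun K => ∃ a ∈ A, ∃ z ∈ K, H.Adj a z with hD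
  -- partner map
  have part : ∀ f, IsPM H U f → ∃ g : A → Finset V, (∀ a, g a ∈ D ∧ f a ∈ g a) ∧ Function.Injective g := by
    intro f hf
    have hc := (hB.fam.cnt hf).2 hB.card
    choose g hg1 hg2 using fun a : A => hc.2 a (hA a.2)
    refine ⟨g, fun a => ⟨?_, hg2 a⟩, fun a b hab => ?_⟩
    · rw [hD, Finset.mem_filter]
      exact ⟨hg1 a, a, a.2, f a, hg2 a, (hf a (hB.sub (hA a.2))).2.2⟩
    · have ha := hf a (hB.sub (hA a.2))
      have hb := hf b (hB.sub (hA b.2))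
      have := hc.1 (g a) (hg1 a) (f a) (hg2 a) (f b) (hab ▸ hg2 b) (by rw [ha.2.1]; exact hA a.2)
        (by rw [hb.2.1]; exact hA b.2)
      exact Subtype.ext (hf.inj (hB.sub (hA a.2)) (hB.sub (hA b.2)) this)
  by_contra hlt
  have himg : ∀ g : A → Finset V, (∀ a, g a ∈ D) → Function.Injective g → ∀ K ∈ D, ∃ a, g a = K := by
    intro g hg hi K hK
    have hs : Finset.univ.image g ⊆ D := by
      intro L hL
      simp only [Finset.mem_image] at hL
      obtain ⟨a, _, rfl⟩ := hL
      exact hg a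
    have : Finset.univ.image g = D := Finset.eq_of_subset_of_card_le hs (by
      rw [Finset.card_image_of_injective _ hi]; simp; omega)
    rw [← this] at hK
    simpa using hK
  obtain ⟨a0, ha0⟩ := hne
  obtain ⟨s0, hs0, hs0A⟩ : ∃ s ∈ S, s ∉ A := by
    by_contra hc
    push Not at hc
    exact hneS (Finset.Subset.antisymm hA hc)
  have hDC : ∀ K ∈ D, K ∈ C := fun K hK => (Finset.mem_filter.1 hK).1
  obtain ⟨x, hx, y, hy, hxy, hpm⟩ := hE.cut (A ∪ D.biUnion id) (by
      intro z hz
      simp only [Finset.mem_union, Finset.mem_biUnion] at hz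
      rcases hz with hz | ⟨K, hK, hz⟩
      · exact hB.sub (hA hz)
      · exact hB.fam.mem_Y (hDC K hK) hz) ⟨a0, by simp [ha0]⟩ (by
      intro e
      have := hB.sub hs0
      rw [← e] at this
      simp only [Finset.mem_union, Finset.mem_biUnion] at this
      rcases this with h | ⟨K, hK, h⟩
      · exact hs0A h
      · exact hB.fam.not_T (hDC K hK) h hs0)
  have hyU := (Finset.mem_sdiff.1 hy).1
  have hyA : y ∉ A := fun h => (Finset.mem_sdiff.1 hy).2 (by simp [h])
  have hyD : ∀ K ∈ D, y ∉ K := fun K hK h => (Finset.mem_sdiff.1 hy).2 (by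
    simp only [Finset.mem_union, Finset.mem_biUnion]; exact Or.inr ⟨K, hK, h⟩)
  have hxU := hE.sub _ _ hxy
  obtain ⟨f, hf, h1, h2⟩ := hpm.exists_edge hxU hyU hxy
  have hc := (hB.fam.cnt hf).2 hB.card
  simp only [Finset.mem_union, Finset.mem_biUnion] at hx
  rcases hx with hx | ⟨K, hK, hx⟩
  · obtain ⟨L, hL, h⟩ := hc.2 x (hA hx)
    rw [h1] at h
    exact hyD L (by rw [hD, Finset.mem_filter]; exact ⟨hL, x, hx, y, h, hxy⟩) h
  · have hyS : y ∈ S := by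
      by_contra hyS
      exact hyD K hK (hB.fam.closed K (hDC K hK) x hx y (by simp [hyU, hyS]) hxy)
    obtain ⟨g, hg, hgi⟩ := part f hf
    obtain ⟨a, rfl⟩ := himg g (fun a => (hg a).1) hgi K hK
    have ha := hf a (hB.sub (hA a.2))
    have := hc.1 _ (hDC _ hK) x hx (f a) (hg a).2 (by rw [h1]; exact hyS) (by rw [ha.2.1]; exact hA a.2)
    rw [this, ha.2.1] at h1
    exact hyA (h1 ▸ a.2)

theorem Bar.cardeq (hE : Elem H U) (hB : Bar H U S C) : C.card = S.card := by
  obtain ⟨f, hf⟩ := hE.pm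
  exact le_antisymm (hB.fam.cnt hf).1 hB.card

theorem Bar.sep (hE : Elem H U) (hB : Bar H U S C) (hfc : ∀ K ∈ C, ∀ t ∈ K, HasPM H (K.erase t))
    {s t} (hs : s ∈ S) (ht : t ∈ U) (htS : t ∉ S) : HasPM H (U \ {s, t}) := by
  classical
  obtain ⟨K0, hK0, htK⟩ := (hB.cover hE ht).resolve_left htS
  obtain ⟨g, hgi, hg⟩ := (Finset.all_card_le_biUnion_card_iff_exists_injective
    (fun a : S.erase s => (C.filter fun K => ∃ z ∈ K, H.Adj a z).erase K0)).1 (by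
    intro A
    by_cases hA : A.Nonempty
    swap
    · rw [Finset.not_nonempty_iff_eq_empty] at hA; simp [hA]
    have h1 := hB.hall hE (A := A.map (Function.Embedding.subtype _)) (by
      intro z hz
      simp at hz
      exact hz.1.2) (by simpa using hA) (by
      intro e
      rw [← e] at hs
      simp at hs)
    have h2 : (A.biUnion fun a : S.erase s => (C.filter fun K => ∃ z ∈ K, H.Adj a z).erase K0) =
      (C.filter fun K => ∃ a ∈ A.map (Function.Embedding.subtype _), ∃ z ∈ K, H.Adj a z).erase K0 := by
      ext K
      simp only [Finset.mem_biUnion, Finset.mem_erase, Finset.mem_filter, Finset.mem_map, Function.Embedding.coe_subtype]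
      constructor
      · rintro ⟨a, ha, h1, h2, h3⟩
        exact ⟨h1, h2, a, ⟨a, ha, rfl⟩, h3⟩
      · rintro ⟨h1, h2, _, ⟨a, ha, rfl⟩, h3⟩
        exact ⟨a, ha, h1, h2, h3⟩
    rw [h2]
    have h3 := Finset.pred_card_le_card_erase (s := C.filter fun K => ∃ a ∈ A.map (Function.Embedding.subtype _), ∃ z ∈ K, H.Adj a z) (a := K0)
    rw [Finset.card_map] at h1
    omega)
  have hg' : ∀ a, g a ≠ K0 ∧ g a ∈ C ∧ ∃ z ∈ g a, H.Adj a z := by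
    intro a
    have := hg a
    simp only [Finset.mem_erase, Finset.mem_filter] at this
    exact this
  choose hg1 hg2 z hz hadj using hg'
  have himg : Finset.univ.image g = C.erase K0 := by
    apply Finset.eq_of_subset_of_card_le
    · intro L hL
      simp only [Finset.mem_image] at hL
      obtain ⟨a, _, rfl⟩ := hL
      simp [hg1, hg2]
    · rw [Finset.card_image_of_injective _ hgi, Finset.card_erase_of_mem hK0, hB.cardeq hE]
      simp [Finset.card_erase_of_mem hs]
  have haS : ∀ a : S.erase s, (a : V) ∈ S := fun a => Finset.mem_of_mem_erase a.2
  have hU : U \ {s, t} = (Finset.univ : Finset (S.erase s)).biUnion (fun a => (g a).erase (z a) ∪ {(a : V), z a}) ∪ K0.erase t := by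
    ext w
    simp only [Finset.mem_sdiff, Finset.mem_insert, Finset.mem_singleton, Finset.mem_union, Finset.mem_biUnion, Finset.mem_univ, true_and, Finset.mem_erase, not_or]
    constructor
    · rintro ⟨hw, hws, hwt⟩
      rcases hB.cover hE hw with h | ⟨K, hK, h⟩
      · left
        exact ⟨⟨w, by simp [hws, h]⟩, by simp⟩
      · by_cases hKK : K = K0
        · subst hKK; right; exact ⟨hwt, h⟩
        · left
          have : K ∈ C.erase K0 := by simp [hKK, hK]
          rw [← himg] at this
          simp only [Finset.mem_image, Finset.mem_univ, true_and] at this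
          obtain ⟨a, rfl⟩ := this
          refine ⟨a, ?_⟩
          by_cases e : w = z a
          · simp [e]
          · simp [e, h]
    · rintro (⟨a, (⟨_, h⟩ | rfl | rfl)⟩ | ⟨h1, h2⟩)
      · refine ⟨hB.fam.mem_Y (hg2 a) h, ?_, ?_⟩
        · rintro rfl; exact hB.fam.not_T (hg2 a) h hs
        · rintro rfl; exact hg1 a (hB.fam.eq (hg2 a) hK0 h htK)
      · exact ⟨hB.sub (haS a), (Finset.mem_erase.1 a.2).1, fun e => htS (e ▸ haS a)⟩
      · have h := hz a
        refine ⟨hB.fam.mem_Y (hg2 a) h, ?_, ?_⟩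
        · intro e; rw [e] at h; exact hB.fam.not_T (hg2 a) h hs
        · intro e; rw [e] at h; exact hg1 a (hB.fam.eq (hg2 a) hK0 h htK)
      · exact ⟨hB.fam.mem_Y hK0 h2, fun e => hB.fam.not_T hK0 h2 (e ▸ hs), h1⟩
  rw [hU]
  have hmem : ∀ a w, w ∈ (g a).erase (z a) ∪ {(a : V), z a} → w = a ∨ w ∈ g a := by
    intro a w hw
    simp only [Finset.mem_union, Finset.mem_erase, Finset.mem_insert, Finset.mem_singleton] at hw
    rcases hw with h | h | h
    · exact Or.inr h.2
    · exact Or.inl h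
    · exact Or.inr (h ▸ hz a)
  refine (HasPM.biUnion _ _ (fun a _ => ?_) (fun a _ b _ hab => ?_)).union (hfc K0 hK0 t htK) ?_
  · exact (hfc _ (hg2 a) _ (hz a)).add_pair (hadj a)
      (fun h => hB.fam.not_T (hg2 a) (Finset.mem_of_mem_erase h) (haS a)) (by simp)
  · rw [Finset.disjoint_left]
    intro w hw hw'
    rcases hmem a w hw with rfl | h1 <;> rcases hmem b _ hw' with h2 | h2
    · exact hab (Subtype.ext h2)
    · exact hB.fam.not_T (hg2 b) h2 (haS a)
    · subst h2; exact hB.fam.not_T (hg2 a) h1 (haS b)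
    · exact hab (hgi (hB.fam.eq (hg2 a) (hg2 b) h1 h2))
  · rw [Finset.disjoint_left]
    intro w hw hw'
    simp only [Finset.mem_biUnion, Finset.mem_univ, true_and] at hw
    obtain ⟨a, hw⟩ := hw
    have hw' := Finset.mem_of_mem_erase hw'
    rcases hmem a w hw with rfl | h1
    · exact hB.fam.not_T hK0 hw' (haS a)
    · exact hg1 a (hB.fam.eq (hg2 a) hK0 h1 hw')

theorem Bar.grow (hB : Bar H U S C) {K t} (hK : K ∈ C) (ht : t ∈ K) (h : ¬ HasPM H (K.erase t)) :
    ∃ S' C', Bar H U S' C' ∧ S ⊆ S' ∧ S.card < S'.card := by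
  have hev : Even (K.erase t).card := by
    rw [Finset.card_erase_of_mem ht]
    have := hB.fam.odd K hK
    rw [Nat.odd_iff] at this; rw [Nat.even_iff]; omega
  obtain ⟨T, D, hT, hD, hc⟩ := tutte1 H (K.erase t) hev h
  have hTK : ∀ z ∈ T, z ∈ K := fun z hz => Finset.mem_of_mem_erase (hT hz)
  have hDK : ∀ L ∈ D, ∀ z ∈ L, z ∈ K ∧ z ≠ t ∧ z ∉ T := fun L hL z hz => by
    have := hD.sub L hL hz
    simp at this
    exact ⟨this.1.2, this.1.1, this.2⟩
  have hdisS : Disjoint S (insert t T) := by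
    rw [Finset.disjoint_left]
    intro z hz hz'
    have : z ∈ K := by
      rcases Finset.mem_insert.1 hz' with rfl | h
      · exact ht
      · exact hTK z h
    exact hB.fam.not_T hK this hz
  have hcard : (S ∪ insert t T).card = S.card + (T.card + 1) := by
    rw [Finset.card_union_of_disjoint hdisS, Finset.card_insert_of_notMem]
    intro h
    have := hT h
    simp at this
  have hDne : ∀ L ∈ D, L.Nonempty := fun L hL => by
    rw [← Finset.card_pos]; exact (hD.odd L hL).pos
  have hcases : ∀ L ∈ C.erase K ∪ D, (L ∈ C ∧ L ≠ K) ∨ L ∈ D := by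
    intro L hL; simp at hL; tauto
  refine ⟨S ∪ insert t T, C.erase K ∪ D, ⟨?_, hB.ne.mono Finset.subset_union_left, ⟨?_, ?_, ?_, ?_⟩, ?_⟩, Finset.subset_union_left, by omega⟩
  · intro z hz
    simp at hz
    rcases hz with rfl | h | h
    · exact hB.fam.mem_Y hK ht
    · exact hB.sub h
    · exact hB.fam.mem_Y hK (hTK z h)
  · intro L hL z hz
    simp
    rcases hcases L hL with ⟨h1, h2⟩ | h1
    · have hzK : z ∉ K := fun h => h2 (hB.fam.eq h1 hK hz h)
      exact ⟨hB.fam.mem_Y h1 hz, fun e => hzK (e ▸ ht), hB.fam.not_T h1 hz, fun h => hzK (hTK _ h)⟩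
    · obtain ⟨h2, h3, h4⟩ := hDK L h1 z hz
      exact ⟨hB.fam.mem_Y hK h2, h3, hB.fam.not_T hK h2, h4⟩
  · intro L hL
    rcases hcases L hL with ⟨h1, h2⟩ | h1
    · exact hB.fam.odd L h1
    · exact hD.odd L h1
  · intro L hL x hx y hy hxy
    simp at hy
    rcases hcases L hL with ⟨h1, h2⟩ | h1
    · exact hB.fam.closed L h1 x hx y (by simp [hy]) hxy
    · have hxK := (hDK L h1 x hx).1
      have := hB.fam.closed K hK x hxK y (by simp [hy]) hxy
      exact hD.closed L h1 x hx y (by simp [hy, this]) hxy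
  · intro L hL M hM hne
    have aux : ∀ L ∈ C, L ≠ K → ∀ M ∈ D, Disjoint L M := by
      intro L hL hLK M hM
      rw [Finset.disjoint_left]
      intro z hz hz'
      exact hLK (hB.fam.eq hL hK hz (hDK M hM z hz').1)
    rcases hcases L hL with ⟨h1, h2⟩ | h1 <;> rcases hcases M hM with ⟨h3, h4⟩ | h3
    · exact hB.fam.disj L h1 M h3 hne
    · exact aux L h1 h2 M h3
    · exact (aux M h3 h4 L h1).symm
    · exact hD.disj L h1 M h3 hne
  · have hdis : Disjoint (C.erase K) D := by
      rw [Finset.disjoint_left]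
      intro L hL hL'
      simp at hL
      obtain ⟨z, hz⟩ := hDne L hL'
      exact hL.1 (hB.fam.eq hL.2 hK hz (hDK L hL' z hz).1)
    rw [hcard, Finset.card_union_of_disjoint hdis, Finset.card_erase_of_mem hK]
    have := hB.card
    have : 0 < C.card := Finset.card_pos.2 ⟨K, hK⟩
    omega

theorem barrier (hE : Elem H U) {u} (hu : u ∈ U) :
    ∃ S C, u ∈ S ∧ Bar H U S C ∧ ∀ K ∈ C, ∀ t ∈ K, HasPM H (K.erase t) := by
  classical
  have hstart : Bar H U {u} {U.erase u} := by
    refine ⟨by simpa using hu, by simp, ⟨?_, ?_, ?_, ?_⟩, by simp⟩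
    · intro K hK z hz
      simp at hK; subst hK
      simp at hz ⊢; tauto
    · intro K hK
      simp at hK; subst hK
      rw [Finset.card_erase_of_mem hu]
      have h1 := hE.pm.even
      have : 0 < U.card := Finset.card_pos.2 ⟨u, hu⟩
      rw [Nat.even_iff] at h1; rw [Nat.odd_iff]; omega
    · intro K hK x hx y hy _
      simp at hK; subst hK
      simp at hy ⊢; tauto
    · intro K hK L hL hne
      simp at hK hL
      exact absurd (hK.trans hL.symm) hne
  obtain ⟨S, hS, hmax⟩ := Finset.exists_max_image (U.powerset.filter fun S => u ∈ S ∧ ∃ C, Bar H U S C) Finset.card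
    ⟨{u}, by simp [hu]; exact ⟨_, hstart⟩⟩
  simp only [Finset.mem_filter, Finset.mem_powerset] at hS hmax
  obtain ⟨hSU, huS, C, hB⟩ := hS
  refine ⟨S, C, huS, hB, fun K hK t ht => ?_⟩
  by_contra hcon
  obtain ⟨S', C', hB', hss, hlt⟩ := hB.grow hK ht hcon
  have := hmax S' ⟨hB'.sub, hss huS, C', hB'⟩
  omega
end Barrier

section Sat
variable {V : Type*} [Fintype V] [DecidableEq V]

noncomputable def ec (H : SimpleGraph V) : ℕ := H.edgeSet.ncard

theorem ec_mono {H H' : SimpleGraph V} (h : H ≤ H') : ec H ≤ ec H' :=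
  Set.ncard_le_ncard (edgeSet_subset_edgeSet.2 h) (Set.toFinite _)
theorem ec_lt {H H' : SimpleGraph V} (h : H < H') : ec H < ec H' :=
  Set.ncard_lt_ncard (edgeSet_ssubset_edgeSet.2 h) (Set.toFinite _)
theorem ec_sup (H H' : SimpleGraph V) : ec (H ⊔ H') ≤ ec H + ec H' := by
  unfold ec; rw [edgeSet_sup]; exact Set.ncard_union_le _ _
theorem ec_edge (x y : V) : ec (edge x y) ≤ 1 := by
  unfold ec
  by_cases h : x = y
  · subst h; simp
  · rw [edge_edgeSet_of_ne h]; simp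
theorem ec_add (H : SimpleGraph V) (x y : V) : ec (H ⊔ edge x y) ≤ ec H + 1 :=
  (ec_sup _ _).trans (Nat.add_le_add_left (ec_edge x y) _)

theorem adj_add {H : SimpleGraph V} {x y a b : V} (hxy : x ≠ y) :
    (H ⊔ edge x y).Adj a b ↔ H.Adj a b ∨ (a = x ∧ b = y) ∨ (a = y ∧ b = x) := by
  rw [sup_adj, edge_adj]
  constructor
  · rintro (h | h)
    · exact Or.inl h
    · right; tauto
  · rintro (h | h)
    · exact Or.inl h
    · right
      refine ⟨by tauto, ?_⟩
      rcases h with ⟨rfl, rfl⟩ | ⟨rfl, rfl⟩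
      · exact hxy
      · exact hxy.symm

def Cl (H : SimpleGraph V) (U Q : Finset V) : Prop :=
  Q ⊆ U ∧ ∀ u ∈ Q, ∀ v ∈ Q, u ≠ v → HasPM H (U \ {u, v})

theorem Cl.mono {H H' : SimpleGraph V} {U Q : Finset V} (h : Cl H U Q) (hh : H ≤ H') : Cl H' U Q :=
  ⟨h.1, fun u hu v hv hne => (h.2 u hu v hv hne).mono hh⟩

theorem Elem.mono {H H' : SimpleGraph V} {U : Finset V} (h : Elem H U) (hh : H ≤ H')
    (hs : ∀ x y, H'.Adj x y → x ∈ U) : Elem H' U :=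
  ⟨hs, h.pm.mono hh, fun X hX hne hnU => by
    obtain ⟨x, hx, y, hy, h1, h2⟩ := h.cut X hX hne hnU
    exact ⟨x, hx, y, hy, hh h1, h2.mono hh⟩⟩

theorem Elem.add {H : SimpleGraph V} {U : Finset V} (h : Elem H U) {x y} (hx : x ∈ U) (hy : y ∈ U) :
    Elem (H ⊔ edge x y) U :=
  h.mono le_sup_left fun a b hab => by
    rw [sup_adj, edge_adj] at hab
    rcases hab with hab | ⟨⟨rfl, rfl⟩ | ⟨rfl, rfl⟩, _⟩
    · exact h.sub _ _ hab
    · exact hx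
    · exact hy

set_option maxHeartbeats 800000 in
theorem keyK {H G : SimpleGraph V} {U Q : Finset V} (hE : Elem H U) (hQ : Cl H U Q)
    {u v : V} (hu : u ∈ U) (hv : v ∈ U) (hn : ¬ HasPM H (U \ {u, v})) (hG : HasPM G (U \ {u, v})) :
    ∃ x ∈ U, ∃ y ∈ U, x ≠ y ∧ ¬ H.Adj x y ∧ G.Adj x y ∧ ∃ Q', Cl (H ⊔ edge x y) U Q' ∧ Q.card + 1 ≤ Q'.card := by
  classical
  obtain ⟨S, C, huS, hB, hfc⟩ := barrier hE hu
  have hvS : v ∈ S := by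
    by_contra h
    exact hn (hB.sep hE hfc huS hv h)
  have huv : u ≠ v := by
    rintro rfl
    have h1 := hG.even
    have h2 := hE.pm.even
    simp only [Finset.pair_eq_singleton, Finset.sdiff_singleton_eq_erase, Finset.card_erase_of_mem hu] at h1
    have : 0 < U.card := Finset.card_pos.2 ⟨u, hu⟩
    rw [Nat.even_iff] at h1 h2; omega
  have hcon : ∃ K ∈ C, ∃ L ∈ C, K ≠ L ∧ ∃ x ∈ K, ∃ y ∈ L, G.Adj x y := by
    by_contra hcon
    push Not at hcon
    have hfam : OddFam G (U \ {u, v}) (S \ {u, v}) C := by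
      refine ⟨?_, hB.fam.odd, ?_, hB.fam.disj⟩
      · intro K hK z hz
        have h1 := hB.fam.mem_Y hK hz
        have h2 := hB.fam.not_T hK hz
        simp [h1, h2]
        exact ⟨fun e => h2 (e ▸ huS), fun e => h2 (e ▸ hvS)⟩
      · intro K hK x hx y hy hxy
        simp at hy
        obtain ⟨hy1, hy2⟩ := hy
        have hyS : y ∉ S := fun h => by
          have := hy2 h
          tauto
        obtain ⟨L, hL, hyL⟩ := (hB.cover hE hy1.1).resolve_left hyS
        by_cases e : K = L
        · exact e ▸ hyL
        · exact absurd hxy (hcon K hK L hL e x hx y hyL)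
    obtain ⟨f, hf⟩ := hG
    have h1 := (hfam.cnt hf).1
    have h2 := hB.card
    have h3 : (S \ {u, v}).card < S.card := by
      apply Finset.card_lt_card
      refine ⟨Finset.sdiff_subset, fun h => ?_⟩
      have := h huS
      simp at this
    omega
  obtain ⟨K, hK, L, hL, hKL, x, hx, y, hy, hxy⟩ := hcon
  have hxU := hB.fam.mem_Y hK hx
  have hyU := hB.fam.mem_Y hL hy
  have hyK : y ∉ K := fun h => hKL (hB.fam.eq hK hL h hy)
  have hxL : x ∉ L := fun h => hKL (hB.fam.eq hK hL hx h)
  have hnadj : ¬ H.Adj x y := fun h => hyK (hB.fam.closed K hK x hx y (by simp [hyU, hB.fam.not_T hL hy]) h)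
  refine ⟨x, hxU, y, hyU, fun e => hyK (e ▸ hx), hnadj, hxy, ?_⟩
  obtain ⟨f, hf⟩ := hE.pm
  have hc := (hB.fam.cnt hf).2 hB.card
  obtain ⟨z1, hz1, hb1⟩ := hB.fam.ex hf hK
  obtain ⟨z2, hz2, hb2⟩ := hB.fam.ex hf hL
  set b1 := f z1 with hb1e
  set b2 := f z2 with hb2e
  have hz1U := hB.fam.mem_Y hK hz1
  have hz2U := hB.fam.mem_Y hL hz2
  have hfb1 : f b1 = z1 := (hf z1 hz1U).2.1
  have hfb2 : f b2 = z2 := (hf z2 hz2U).2.1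
  have hb12 : b1 ≠ b2 := by
    intro e
    have : z1 = z2 := by rw [← hfb1, e, hfb2]
    exact hKL (hB.fam.eq hK hL hz1 (this ▸ hz2))
  -- K ∪ {b1} closed under f
  have clos : ∀ K ∈ C, ∀ z1 ∈ K, f z1 ∈ S → ∀ w ∈ insert (f z1) K, f w ∈ insert (f z1) K := by
    intro K hK z1 hz1 hb1 w hw
    rcases Finset.mem_insert.1 hw with rfl | hw
    · rw [(hf z1 (hB.fam.mem_Y hK hz1)).2.1]; simp [hz1]
    · have h1 := hf w (hB.fam.mem_Y hK hw)
      by_cases hwS : f w ∈ S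
      · rw [hc.1 K hK w hw z1 hz1 hwS hb1]; simp
      · exact Finset.mem_insert_of_mem (hB.fam.closed K hK w hw _ (by simp [h1.1, hwS]) h1.2.2)
  set H' := H ⊔ edge x y with hH'
  have hle : H ≤ H' := le_sup_left
  have hxy' : H'.Adj x y := by
    rw [hH', adj_add (fun e : x = y => hyK (e ▸ hx))]; right; left; exact ⟨rfl, rfl⟩
  have hpm : HasPM H' (U \ {b1, b2}) := by
    have e : U \ {b1, b2} = (U \ (insert b1 K ∪ insert b2 L)) ∪ (K.erase x ∪ L.erase y ∪ {x, y}) := by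
      ext w
      have hKU := fun h => hB.fam.mem_Y (z := w) hK h
      have hLU := fun h => hB.fam.mem_Y (z := w) hL h
      have h1 : w ∈ K → w ≠ b1 ∧ w ≠ b2 := fun h => ⟨fun e => hB.fam.not_T hK h (e ▸ hb1), fun e => hB.fam.not_T hK h (e ▸ hb2)⟩
      have h2 : w ∈ L → w ≠ b1 ∧ w ≠ b2 := fun h => ⟨fun e => hB.fam.not_T hL h (e ▸ hb1), fun e => hB.fam.not_T hL h (e ▸ hb2)⟩
      simp only [Finset.mem_sdiff, Finset.mem_insert, Finset.mem_singleton, Finset.mem_union, Finset.mem_erase]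
      by_cases ex : w = x
      · subst ex; simp [hxU, h1 hx]
      · by_cases ey : w = y
        · subst ey; simp [hyU, h2 hy]
        · by_cases hwK : w ∈ K
          · have := h1 hwK; have := hKU hwK; simp [hwK, h1 hwK, this, ex]
          · by_cases hwL : w ∈ L
            · have := h2 hwL; have := hLU hwL; simp [hwL, h2 hwL, this, ey]
            · simp [ex, ey, hwK, hwL]
    rw [e]
    have hrest : IsPM H (U \ (insert b1 K ∪ insert b2 L)) f := by
      apply hf.sdiff
      · intro w hw
        simp only [Finset.mem_union, Finset.mem_insert] at hw
        rcases hw with (rfl | h) | (rfl | h)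
        · exact hB.sub hb1
        · exact hB.fam.mem_Y hK h
        · exact hB.sub hb2
        · exact hB.fam.mem_Y hL h
      · intro w hw
        rcases Finset.mem_union.1 hw with h | h
        · exact Finset.mem_union_left _ (clos K hK z1 hz1 hb1 w h)
        · exact Finset.mem_union_right _ (clos L hL z2 hz2 hb2 w h)
    refine HasPM.union ⟨f, hrest.mono hle⟩ ?_ ?_
    · refine HasPM.add_pair (HasPM.union ((hfc K hK x hx).mono hle) ((hfc L hL y hy).mono hle) ?_) hxy' ?_ ?_
      · exact Finset.disjoint_of_subset_left (Finset.erase_subset _ _)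
          (Finset.disjoint_of_subset_right (Finset.erase_subset _ _) (hB.fam.disj K hK L hL hKL))
      · simp [hxL]
      · simp [hyK]
    · rw [Finset.disjoint_left]
      intro w hw hw'
      simp only [Finset.mem_sdiff, Finset.mem_insert, Finset.mem_singleton, Finset.mem_union, Finset.mem_erase] at hw hw'
      rcases hw' with (h | h) | (rfl | rfl) <;> tauto
  refine ⟨(Q \ S) ∪ {b1, b2}, ⟨?_, ?_⟩, ?_⟩
  · intro w hw
    simp at hw
    rcases hw with rfl | rfl | h
    · exact hB.sub hb1
    · exact hB.sub hb2
    · exact hQ.1 h.1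
  · have hsep : ∀ q ∈ Q, q ∉ S → ∀ b ∈ S, HasPM H' (U \ {b, q}) := fun q hq hqS b hb =>
      (hB.sep hE hfc hb (hQ.1 hq) hqS).mono hle
    have hS' : ∀ w ∈ (Q \ S) ∪ {b1, b2}, (w ∈ Q ∧ w ∉ S) ∨ w = b1 ∨ w = b2 := by
      intro w hw; simp at hw; tauto
    intro p hp q hq hpq
    rcases hS' p hp with ⟨h1, h2⟩ | h1 <;> rcases hS' q hq with ⟨h3, h4⟩ | h3
    · exact (hQ.2 p h1 q h3 hpq).mono hle
    · rw [Finset.pair_comm]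
      rcases h3 with rfl | rfl
      · exact hsep p h1 h2 _ hb1
      · exact hsep p h1 h2 _ hb2
    · rcases h1 with rfl | rfl
      · exact hsep q h3 h4 _ hb1
      · exact hsep q h3 h4 _ hb2
    · rcases h1 with rfl | rfl <;> rcases h3 with rfl | rfl
      · exact absurd rfl hpq
      · exact hpm
      · rw [Finset.pair_comm]; exact hpm
      · exact absurd rfl hpq
  · have hd : Disjoint (Q \ S) {b1, b2} := by simp [hb1, hb2]
    rw [Finset.card_union_of_disjoint hd, Finset.card_pair hb12]
    have : (Q ∩ S).card ≤ 1 := by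
      rw [Finset.card_le_one]
      intro a ha b hb
      by_contra hab
      simp at ha hb
      obtain ⟨g, hg⟩ := hQ.2 a ha.1 b hb.1 hab
      have hfam : OddFam H (U \ {a, b}) (S \ {a, b}) C := by
        refine ⟨?_, hB.fam.odd, ?_, hB.fam.disj⟩
        · intro K hK z hz
          have h1 := hB.fam.mem_Y hK hz
          have h2 := hB.fam.not_T hK hz
          simp [h1, h2]
          exact ⟨fun e => h2 (e ▸ ha.2), fun e => h2 (e ▸ hb.2)⟩
        · intro K hK x hx y hy hxy
          simp at hy
          exact hB.fam.closed K hK x hx y (by simp [hy.1]; intro h; have := hy.2 h; tauto) hxy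
      have h1 := (hfam.cnt hg).1
      have h2 := hB.card
      have h3 : (S \ {a, b}).card < S.card := by
        apply Finset.card_lt_card
        refine ⟨Finset.sdiff_subset, fun h => ?_⟩
        have := h ha.2
        simp at this
      omega
    have := Finset.card_sdiff_add_card_inter Q S
    omega

theorem saturate {G : SimpleGraph V} {U : Finset V} : ∀ (k : ℕ) {H : SimpleGraph V} {Q : Finset V},
    ec G ≤ ec H + k → H ≤ G → Elem H U → Cl H U Q → ∃ H2 Q2, H ≤ H2 ∧ H2 ≤ G ∧ Elem H2 U ∧ Cl H2 U Q2 ∧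
      ec H2 + Q.card ≤ ec H + Q2.card ∧ ∀ u ∈ U, ∀ v ∈ U, HasPM G (U \ {u, v}) → HasPM H2 (U \ {u, v}) := by
  intro k
  induction k with
  | zero =>
    intro H Q hk hle hE hQ
    have : H = G := by
      by_contra hne
      have := ec_lt (lt_of_le_of_ne hle hne)
      omega
    subst this
    exact ⟨H, Q, le_rfl, le_rfl, hE, hQ, le_rfl, fun u _ v _ h => h⟩
  | succ k ih =>
    intro H Q hk hle hE hQ
    by_cases hall : ∀ u ∈ U, ∀ v ∈ U, HasPM G (U \ {u, v}) → HasPM H (U \ {u, v})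
    · exact ⟨H, Q, le_rfl, hle, hE, hQ, le_rfl, hall⟩
    push Not at hall
    obtain ⟨u, hu, v, hv, hG, hH⟩ := hall
    obtain ⟨x, hx, y, hy, hne, hna, hadj, Q', hQ', hc⟩ := keyK hE hQ hu hv hH hG
    have hlt : H < H ⊔ edge x y := by
      refine lt_of_le_of_ne le_sup_left fun e => hna ?_
      rw [e, adj_add hne]; right; left; exact ⟨rfl, rfl⟩
    have h1 := ec_lt hlt
    have h2 := ec_add H x y
    obtain ⟨H2, Q2, h3, h4, h5, h6, h7, h8⟩ := ih (by omega) (by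
      refine sup_le hle ?_
      rw [edge_le_iff]; exact Or.inr hadj) (hE.add hx hy) hQ'
    exact ⟨H2, Q2, le_sup_left.trans h3, h4, h5, h6, by omega, h8⟩
end Sat

section Lift
variable {V : Type*} [Fintype V] [DecidableEq V]

def lift (H : SimpleGraph V) (x y v1 v2 : V) : SimpleGraph V :=
  H.deleteEdges {s(x, y)} ⊔ edge x v1 ⊔ edge v1 v2 ⊔ edge v2 y

variable {H : SimpleGraph V} {U : Finset V} {x y v1 v2 : V}

theorem ec_lift (h : H.Adj x y) : ec (lift H x y v1 v2) ≤ ec H + 2 := by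
  unfold lift
  have h1 := ec_add (H.deleteEdges {s(x, y)} ⊔ edge x v1 ⊔ edge v1 v2) v2 y
  have h2 := ec_add (H.deleteEdges {s(x, y)} ⊔ edge x v1) v1 v2
  have h3 := ec_add (H.deleteEdges {s(x, y)}) x v1
  have h4 : ec (H.deleteEdges {s(x, y)}) + 1 ≤ ec H := by
    apply ec_lt
    refine lt_of_le_of_ne (deleteEdges_le _) fun e => ?_
    rw [← e] at h
    simp at h
  omega

theorem lift_adj_of (h : H.Adj x y) {a b} (hab : H.Adj a b) (hne : ¬ ((a = x ∧ b = y) ∨ (a = y ∧ b = x))) :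
    (lift H x y v1 v2).Adj a b := by
  unfold lift
  simp only [sup_adj, deleteEdges_adj]
  left; left; left
  refine ⟨hab, ?_⟩
  simpa using hne

theorem lift_adj_iff (h1 : x ≠ v1) (h2 : v1 ≠ v2) (h3 : v2 ≠ y) {a b} : (lift H x y v1 v2).Adj a b ↔
    (H.Adj a b ∧ ¬ ((a = x ∧ b = y) ∨ (a = y ∧ b = x))) ∨ ((a = x ∧ b = v1) ∨ (a = v1 ∧ b = x)) ∨
    ((a = v1 ∧ b = v2) ∨ (a = v2 ∧ b = v1)) ∨ ((a = v2 ∧ b = y) ∨ (a = y ∧ b = v2)) := by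
  unfold lift
  rw [adj_add h3, adj_add h2, adj_add h1, deleteEdges_adj]
  simp only [Set.mem_singleton_iff, Sym2.eq, Sym2.rel_iff', Prod.mk.injEq, Prod.swap_prod_mk]
  simp only [or_assoc]

theorem lift_pm (h1 : x ∈ U) (hy : y ∈ U) (h2 : v1 ∉ U) (h3 : v2 ∉ U) (h12 : v1 ≠ v2)
    {A : Finset V} (hA : A ⊆ U) (hpm : HasPM H A) (ha : H.Adj x y) :
    HasPM (lift H x y v1 v2) (A ∪ {v1, v2}) := by
  have e1 : x ≠ v1 := fun e => h2 (e ▸ h1)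
  have e1' : x ≠ v2 := fun e => h3 (e ▸ h1)
  have e3 : v2 ≠ y := fun e => h3 (e ▸ hy)
  have e4 : v1 ≠ y := fun e => h2 (e ▸ hy)
  have hv1 : v1 ∉ A := fun h => h2 (hA h)
  have hv2 : v2 ∉ A := fun h => h3 (hA h)
  have hxv : (lift H x y v1 v2).Adj x v1 := (lift_adj_iff e1 h12 e3).2 (by simp)
  have hvv : (lift H x y v1 v2).Adj v1 v2 := (lift_adj_iff e1 h12 e3).2 (by simp)
  have hvy : (lift H x y v1 v2).Adj v2 y := (lift_adj_iff e1 h12 e3).2 (by simp)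
  obtain ⟨f, hf⟩ := hpm
  by_cases hc : x ∈ A ∧ f x = y
  · obtain ⟨hxA, hxy⟩ := hc
    have hyA : y ∈ A := hxy ▸ (hf x hxA).1
    have hp : IsPM H (A \ {x, y}) f := by rw [← hxy]; exact hf.sdiff_edge hxA
    have hp' : IsPM (lift H x y v1 v2) (A \ {x, y}) f := hp.mono' fun a ha' b hb hab =>
      lift_adj_of ha hab (by simp at ha'; tauto)
    have := (HasPM.add_pair ⟨f, hp'⟩ hxv (by simp) (by simp [hv1])).add_pair hvy
      (by simp [hv2, e1'.symm, h12.symm]) (by simp [ha.ne.symm, e4.symm])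
    convert this using 1
    ext w
    simp only [Finset.mem_union, Finset.mem_sdiff, Finset.mem_insert, Finset.mem_singleton]
    by_cases hwx : w = x
    · subst hwx; simp [hxA]
    · by_cases hwy : w = y
      · subst hwy; simp [hyA]
      · simp [hwx, hwy]; tauto
  · refine HasPM.add_pair ⟨f, fun z hz => ⟨(hf z hz).1, (hf z hz).2.1, lift_adj_of ha (hf z hz).2.2 ?_⟩⟩ hvv hv1 hv2
    rintro (⟨rfl, h⟩ | ⟨rfl, h⟩)
    · exact hc ⟨hz, h⟩
    · have := hf z hz
      rw [h] at this
      exact hc ⟨this.1, this.2.1⟩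

structure LiftOut (H : SimpleGraph V) (U : Finset V) (x y v1 v2 : V) : Prop where
  elem : Elem (lift H x y v1 v2) (U ∪ {v1, v2})
  a1 : (lift H x y v1 v2).Adj x v1
  a2 : (lift H x y v1 v2).Adj v1 v2
  a3 : (lift H x y v1 v2).Adj v2 y
  p1 : HasPM (lift H x y v1 v2) ((U ∪ {v1, v2}) \ {x, v1})
  p3 : HasPM (lift H x y v1 v2) ((U ∪ {v1, v2}) \ {v2, y})
  pp : ∀ a ∈ U, ∀ b ∈ U, HasPM H (U \ {a, b}) → HasPM (lift H x y v1 v2) ((U ∪ {v1, v2}) \ {a, b})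

theorem lift_out (hE : Elem H U) (hU : 4 ≤ U.card) (h2 : v1 ∉ U) (h3 : v2 ∉ U) (h12 : v1 ≠ v2)
    (ha : H.Adj x y) (hal : HasPM H (U \ {x, y})) : LiftOut H U x y v1 v2 := by
  have h1 := hE.sub _ _ ha
  have hy := hE.sub _ _ ha.symm
  have e1 : x ≠ v1 := fun e => h2 (e ▸ h1)
  have e1' : x ≠ v2 := fun e => h3 (e ▸ h1)
  have e3 : v2 ≠ y := fun e => h3 (e ▸ hy)
  have e4 : v1 ≠ y := fun e => h2 (e ▸ hy)
  have hxv : (lift H x y v1 v2).Adj x v1 := (lift_adj_iff e1 h12 e3).2 (by simp)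
  have hvv : (lift H x y v1 v2).Adj v1 v2 := (lift_adj_iff e1 h12 e3).2 (by simp)
  have hvy : (lift H x y v1 v2).Adj v2 y := (lift_adj_iff e1 h12 e3).2 (by simp)
  have hal' : HasPM (lift H x y v1 v2) (U \ {x, y}) := hal.mono' fun a ha' b hb hab =>
      lift_adj_of ha hab (by simp at ha'; tauto)
  have p1 : HasPM (lift H x y v1 v2) ((U ∪ {v1, v2}) \ {x, v1}) := by
    have := hal'.add_pair hvy (by simp [h3]) (by simp)
    convert this using 1
    ext w
    simp only [Finset.mem_union, Finset.mem_sdiff, Finset.mem_insert, Finset.mem_singleton]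
    by_cases hw1 : w = v1
    · subst hw1; simp [h2, e4, h12]
    by_cases hw2 : w = v2
    · subst hw2; simp [e1'.symm, h12.symm]
    by_cases hw3 : w = y
    · subst hw3; simp [hy, ha.ne.symm, e4.symm]
    simp [hw1, hw2, hw3]
  have p3 : HasPM (lift H x y v1 v2) ((U ∪ {v1, v2}) \ {v2, y}) := by
    have := hal'.add_pair hxv (by simp) (by simp [h2])
    convert this using 1
    ext w
    simp only [Finset.mem_union, Finset.mem_sdiff, Finset.mem_insert, Finset.mem_singleton]
    by_cases hw1 : w = v1
    · subst hw1; simp [h2, e4, h12]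
    by_cases hw2 : w = v2
    · subst hw2; simp [h3, e1'.symm, h12.symm]
    by_cases hw3 : w = x
    · subst hw3; simp [h1, ha.ne, e1']
    simp [hw1, hw2, hw3]
  have pp : ∀ a ∈ U, ∀ b ∈ U, HasPM H (U \ {a, b}) → HasPM (lift H x y v1 v2) ((U ∪ {v1, v2}) \ {a, b}) := by
    intro a haU b hbU h
    have := lift_pm h1 hy h2 h3 h12 Finset.sdiff_subset h ha
    convert this using 1
    ext w
    simp only [Finset.mem_union, Finset.mem_sdiff, Finset.mem_insert, Finset.mem_singleton]
    by_cases hw1 : w = v1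
    · subst hw1; simp; exact ⟨fun e => h2 (e ▸ haU), fun e => h2 (e ▸ hbU)⟩
    by_cases hw2 : w = v2
    · subst hw2; simp; exact ⟨fun e => h3 (e ▸ haU), fun e => h3 (e ▸ hbU)⟩
    simp [hw1, hw2]
  have p2 : HasPM (lift H x y v1 v2) U := by
    obtain ⟨a, haa, b, hb, hab, hpm⟩ := hE.cut {x, y} (by
      intro z hz; simp at hz; rcases hz with rfl | rfl <;> assumption) ⟨x, by simp⟩ (by
      intro e; rw [← e] at hU; have := Finset.card_le_two (a := x) (b := y); omega)
    have haU := hE.sub _ _ hab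
    simp at hb
    obtain ⟨f, hf, f1, f2⟩ := hpm.exists_edge haU hb.1 hab
    have hc : f x ≠ y := by
      intro e
      simp at haa
      rcases haa with rfl | rfl
      · rw [f1] at e; exact hb.2.2 e
      · have := (hf x h1).2.1
        rw [e, f1] at this
        exact hb.2.1 this
    refine ⟨f, fun z hz => ⟨(hf z hz).1, (hf z hz).2.1, lift_adj_of ha (hf z hz).2.2 ?_⟩⟩
    rintro (⟨rfl, h⟩ | ⟨rfl, h⟩)
    · exact hc h
    · have := hf z hz
      rw [h] at this
      exact hc this.2.1
  have p2' : HasPM (lift H x y v1 v2) ((U ∪ {v1, v2}) \ {v1, v2}) := by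
    convert p2 using 1
    ext w
    simp only [Finset.mem_union, Finset.mem_sdiff, Finset.mem_insert, Finset.mem_singleton]
    by_cases hw1 : w = v1
    · subst hw1; simp [h2]
    by_cases hw2 : w = v2
    · subst hw2; simp [h3]
    simp [hw1, hw2]
  refine ⟨⟨?_, ?_, ?_⟩, hxv, hvv, hvy, p1, p3, pp⟩
  · intro a b hab
    rw [lift_adj_iff e1 h12 e3] at hab
    simp only [Finset.mem_union, Finset.mem_insert, Finset.mem_singleton]
    rcases hab with h | (h | h) | (h | h) | (h | h)
    · exact Or.inl (hE.sub _ _ h.1)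
    all_goals simp [h.1, h1, hy]
  · exact lift_pm h1 hy h2 h3 h12 (le_refl _) hE.pm ha
  · intro X hX hne hnU
    have cross : ∀ a b, a ∈ U ∪ {v1, v2} → b ∈ U ∪ {v1, v2} → (lift H x y v1 v2).Adj a b → HasPM (lift H x y v1 v2) ((U ∪ {v1, v2}) \ {a, b}) →
        ¬ (a ∈ X ↔ b ∈ X) → ∃ x_1 ∈ X, ∃ y_1 ∈ (U ∪ {v1, v2}) \ X,
        (lift H x y v1 v2).Adj x_1 y_1 ∧ HasPM (lift H x y v1 v2) ((U ∪ {v1, v2}) \ {x_1, y_1}) := by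
      intro a b hau hbu hab hpm hx
      by_cases haX : a ∈ X
      · exact ⟨a, haX, b, Finset.mem_sdiff.2 ⟨hbu, by tauto⟩, hab, hpm⟩
      · exact ⟨b, by tauto, a, Finset.mem_sdiff.2 ⟨hau, haX⟩, hab.symm, by rwa [Finset.pair_comm b a]⟩
    by_cases c1 : x ∈ X ↔ v1 ∈ X
    swap
    · exact cross x v1 (by simp [h1]) (by simp) hxv p1 c1
    by_cases c2 : v1 ∈ X ↔ v2 ∈ X
    swap
    · exact cross v1 v2 (by simp) (by simp) hvv p2' c2
    by_cases c3 : v2 ∈ X ↔ y ∈ X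
    swap
    · exact cross v2 y (by simp) (by simp [hy]) hvy p3 c3
    obtain ⟨a, haX, b, hb, hab, hpm⟩ := hE.cut (X ∩ U) Finset.inter_subset_right (by
      by_contra hcon
      rw [Finset.not_nonempty_iff_eq_empty] at hcon
      have hxX : x ∉ X := fun h => by
        have : x ∈ X ∩ U := by simp [h, h1]
        rw [hcon] at this; simp at this
      obtain ⟨z, hz⟩ := hne
      have := hX hz
      simp only [Finset.mem_union, Finset.mem_insert, Finset.mem_singleton] at this
      rcases this with h | rfl | rfl
      · have : z ∈ X ∩ U := by simp [hz, h]
        rw [hcon] at this; simp at this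
      · tauto
      · tauto) (by
      intro e
      have hxX : x ∈ X := by
        rw [← e] at h1; simp at h1; exact h1.1
      apply hnU
      apply Finset.Subset.antisymm hX
      intro z hz
      simp only [Finset.mem_union, Finset.mem_insert, Finset.mem_singleton] at hz
      rcases hz with h | rfl | rfl
      · rw [← e] at h; simp at h; exact h.1
      · tauto
      · tauto)
    simp at haX hb
    have hbX : b ∉ X := by tauto
    refine cross a b (by simp [haX]) (by simp [hb]) (lift_adj_of ha hab ?_) (pp a haX.2 b hb.1 hpm) (by tauto)
    rintro (⟨rfl, rfl⟩ | ⟨rfl, rfl⟩) <;> tauto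
end Lift

section A2sec
variable {V : Type*} [Fintype V] [DecidableEq V]

structure A2Out (G : SimpleGraph V) (Y U : Finset V) (H : SimpleGraph V) (Q : Finset V) (N M0 : V → V) (T : Finset V)
    (U3 : Finset V) (H3 : SimpleGraph V) (Q3 : Finset V) : Prop where
  sub : U ⊆ U3
  subY : U3 ⊆ Y
  le : H3 ≤ G
  elem : Elem H3 U3
  cl : Cl H3 U3 Q3
  Ncl : ∀ z ∈ U3, N z ∈ U3
  Mcl : ∀ z ∈ U3, z ∉ U → M0 z ∈ U3
  edges : ∀ z ∈ U3, (z ∉ U ∨ N z ∉ U ∨ z ∈ T ∨ H.Adj z (N z)) → H3.Adj z (N z) ∧ HasPM H3 (U3 \ {z, N z})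
  bd : 2 * U.card + 2 * Q.card + 2 * ec H3 ≤ 2 * U3.card + 2 * Q3.card + 2 * ec H + 2 * T.card + (U.filter fun z => N z ∉ U).card

theorem addT {G H : SimpleGraph V} {U : Finset V} {N : V → V} (hle : H ≤ G) (hE : Elem H U)
    (hN : ∀ z ∈ U, N z ∈ U ∧ G.Adj z (N z)) (T : Finset V) (hT : T ⊆ U) :
    ∃ H3, H ≤ H3 ∧ H3 ≤ G ∧ Elem H3 U ∧ ec H3 ≤ ec H + T.card ∧ ∀ z ∈ T, H3.Adj z (N z) := by
  induction T using Finset.induction_on with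
  | empty => exact ⟨H, le_rfl, hle, hE, by simp, by simp⟩
  | insert a T ha ih =>
    obtain ⟨H3, h1, h2, h3, h4, h5⟩ := ih (fun z hz => hT (Finset.mem_insert_of_mem hz))
    have haU := hT (Finset.mem_insert_self a T)
    have hadj := (hN a haU).2
    refine ⟨H3 ⊔ edge a (N a), h1.trans le_sup_left, sup_le h2 (by rw [edge_le_iff]; exact Or.inr hadj), h3.add haU (hN a haU).1, ?_, ?_⟩
    · have := ec_add H3 a (N a)
      rw [Finset.card_insert_of_notMem ha]; omega
    · intro z hz
      rw [adj_add hadj.ne]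
      rcases Finset.mem_insert.1 hz with rfl | hz
      · right; left; exact ⟨rfl, rfl⟩
      · exact Or.inl (h5 z hz)

theorem A2 (k : ℕ) : ∀ (G : SimpleGraph V) (Y U : Finset V) (H : SimpleGraph V) (Q : Finset V) (N M0 : V → V) (T : Finset V),
    (Y \ U).card = k → U ⊆ Y → IsPM G Y N → IsPM G (Y \ U) M0 → H ≤ G → Elem H U → Cl H U Q → 4 ≤ U.card →
    T ⊆ U → (∀ z ∈ T, N z ∈ U) → ∃ U3 H3 Q3, A2Out G Y U H Q N M0 T U3 H3 Q3 := by
  induction k using Nat.strong_induction_on with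
  | _ k ih =>
  intro G Y U H Q N M0 T hk hUY hN hM hle hE hQ h4 hT hTN
  by_cases hcl : ∀ z ∈ U, N z ∈ U
  · obtain ⟨H2, Q2, a1, a2, a3, a4, a5, a6⟩ := saturate (ec G) (by omega) hle hE hQ
    obtain ⟨H3, b1, b2, b3, b4, b5⟩ := addT a2 a3 (fun z hz => ⟨hcl z hz, (hN z (hUY hz)).2.2⟩) T hT
    refine ⟨U, H3, Q2, le_rfl, hUY, b2, b3, a4.mono b1, hcl, fun z h1 h2 => absurd h1 h2, ?_, ?_⟩
    · intro z hz h
      have hN' : IsPM G U N := hN.sub hUY hcl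
      refine ⟨?_, (a6 z hz _ (hcl z hz) ⟨N, hN'.sdiff_edge hz⟩).mono b1⟩
      rcases h with h | h | h | h
      · exact absurd hz h
      · exact absurd (hcl z hz) h
      · exact b5 z h
      · exact b1 (a1 h)
    · omega
  push Not at hcl
  obtain ⟨x, hx, hv1⟩ := hcl
  have hxY := hUY hx
  obtain ⟨v1, hv1e⟩ : ∃ v1, v1 = N x := ⟨_, rfl⟩
  rw [← hv1e] at hv1
  have hv1Y : v1 ∈ Y := hv1e ▸ (hN x hxY).1
  have hNv1 : N v1 = x := hv1e ▸ (hN x hxY).2.1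
  have hMv1 := hM v1 (by simp [hv1Y, hv1])
  obtain ⟨v2, hv2e⟩ : ∃ v2, v2 = M0 v1 := ⟨_, rfl⟩
  rw [← hv2e] at hMv1
  have hv2Y : v2 ∈ Y := (Finset.mem_sdiff.1 hMv1.1).1
  have hv2 : v2 ∉ U := (Finset.mem_sdiff.1 hMv1.1).2
  have hv12 : v1 ≠ v2 := hMv1.2.2.ne
  have hNv2 := hN v2 hv2Y
  obtain ⟨y, hye⟩ : ∃ y, y = N v2 := ⟨_, rfl⟩
  rw [← hye] at hNv2
  obtain ⟨hyY, hNy, hv2y⟩ := hNv2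
  have hxv1 : G.Adj x v1 := hv1e ▸ (hN x hxY).2.2
  have exy : x ≠ y := by
    rintro rfl
    rw [← hv1e] at hNy; exact hv12 hNy
  have eyv1 : y ≠ v1 := by
    rintro rfl
    rw [hNv1] at hNy; exact hv2 (hNy ▸ hx)
  have eyv2 : y ≠ v2 := hv2y.ne.symm
  have exv1 : x ≠ v1 := hxv1.ne
  have exv2 : x ≠ v2 := fun e => hv2 (e ▸ hx)
  set N' : V → V := fun z => if z = x then y else if z = y then x else N z with hN'def
  have hN'x : N' x = y := by simp [hN'def]
  have hN'y : N' y = x := by simp [hN'def, exy.symm]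
  have hN'o : ∀ z, z ≠ x → z ≠ y → N' z = N z := fun z h1 h2 => by simp [hN'def, h1, h2]
  set G' := G ⊔ edge x y with hG'
  set Y' := Y \ {v1, v2} with hY'
  have hN'pm : IsPM G' Y' N' := by
    intro z hz
    simp [hY'] at hz
    by_cases h1 : z = x
    · subst h1; rw [hN'x, hN'y]; refine ⟨by simp [hY', hyY, eyv1, eyv2], rfl, ?_⟩
      rw [hG', adj_add exy]; simp
    by_cases h2 : z = y
    · subst h2; rw [hN'y, hN'x]; refine ⟨by simp [hY', hxY, exv1, exv2], rfl, ?_⟩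
      rw [hG', adj_add exy]; simp
    have h3 := hN z hz.1
    have i1 : N z ≠ x := fun e => hz.2.1 (by rw [← h3.2.1, e, ← hv1e])
    have i2 : N z ≠ y := fun e => hz.2.2 (by rw [← h3.2.1, e, hNy])
    have i3 : N z ≠ v1 := fun e => h1 (by rw [← h3.2.1, e, hNv1])
    have i4 : N z ≠ v2 := fun e => h2 (by rw [← h3.2.1, e, hye])
    rw [hN'o z h1 h2, hN'o _ i1 i2]
    exact ⟨by simp [hY', h3.1, i3, i4], h3.2.1, le_sup_left (a := G) h3.2.2⟩
  have hUY' : U ⊆ Y' := by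
    intro z hz
    simp [hY', hUY hz]
    exact ⟨fun e => hv1 (e ▸ hz), fun e => hv2 (e ▸ hz)⟩
  have hYU' : Y' \ U = (Y \ U) \ {v1, M0 v1} := by
    rw [← hv2e, hY']; ext z; simp; tauto
  have hM' : IsPM G' (Y' \ U) M0 := by
    rw [hYU']
    exact (hM.sdiff_edge (by simp [hv1Y, hv1])).mono le_sup_left
  have hcardlt : (Y' \ U).card < k := by
    rw [← hk]
    apply Finset.card_lt_card
    rw [hYU']
    refine ⟨Finset.sdiff_subset, fun h => ?_⟩
    have := h (show v1 ∈ Y \ U by simp [hv1Y, hv1])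
    simp at this
  have hxT : x ∉ T := fun h => hv1 (hv1e ▸ hTN x h)
  have hyT : y ∉ T := fun h => hv2 (hNy ▸ hTN y h)
  obtain ⟨T', hT'U, hT'N, hTT', hxT', hbd⟩ : ∃ T' ⊆ U, (∀ z ∈ T', N' z ∈ U) ∧ T ⊆ T' ∧ (y ∈ U → x ∈ T') ∧
      2 * T'.card + (U.filter fun z => N' z ∉ U).card ≤ 2 * T.card + (U.filter fun z => N z ∉ U).card := by
    have hTo : ∀ z ∈ T, N' z ∈ U := fun z hz => by
      rw [hN'o z (fun e => hxT (e ▸ hz)) (fun e => hyT (e ▸ hz))]; exact hTN z hz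
    by_cases hyU : y ∈ U
    · refine ⟨insert x T, ?_, ?_, Finset.subset_insert _ _, fun _ => Finset.mem_insert_self _ _, ?_⟩
      · intro z hz
        rcases Finset.mem_insert.1 hz with rfl | hz
        · exact hx
        · exact hT hz
      · intro z hz
        rcases Finset.mem_insert.1 hz with rfl | hz
        · rw [hN'x]; exact hyU
        · exact hTo z hz
      · have : (U.filter fun z => N z ∉ U) = insert x (insert y (U.filter fun z => N' z ∉ U)) := by
          ext z
          simp only [Finset.mem_filter, Finset.mem_insert]
          by_cases h1 : z = x
          · subst h1; simp [hx, ← hv1e, hv1]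
          by_cases h2 : z = y
          · subst h2; simp [hyU, hNy, hv2]
          simp [h1, h2, hN'o z h1 h2]
        rw [this, Finset.card_insert_of_notMem hxT, Finset.card_insert_of_notMem (by simp [hN'x, hyU, exy]), Finset.card_insert_of_notMem (by simp [hN'y, hx])]
        omega
    · refine ⟨T, hT, hTo, le_rfl, fun h => absurd h hyU, ?_⟩
      have : (U.filter fun z => N z ∉ U) = (U.filter fun z => N' z ∉ U) := by
        apply Finset.filter_congr
        intro z hz
        by_cases h1 : z = x
        · subst h1; simp [hN'x, ← hv1e, hv1, hyU]
        have h2 : z ≠ y := fun e => hyU (e ▸ hz)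
        rw [hN'o z h1 h2]
      rw [this]
  obtain ⟨U3, H3, Q3, o⟩ := ih _ hcardlt G' Y' U H Q N' M0 T' rfl hUY' hN'pm hM' (hle.trans le_sup_left) hE hQ h4 hT'U hT'N
  have hxU3 := o.sub hx
  have hyU3 : y ∈ U3 := hN'x ▸ o.Ncl x hxU3
  have hxyE := o.edges x hxU3 (by
    rw [hN'x]
    by_cases hyU : y ∈ U
    · exact Or.inr (Or.inr (Or.inl (hxT' hyU)))
    · exact Or.inr (Or.inl hyU))
  rw [hN'x] at hxyE
  have hv1U3 : v1 ∉ U3 := fun h => by have := o.subY h; simp [hY'] at this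
  have hv2U3 : v2 ∉ U3 := fun h => by have := o.subY h; simp [hY'] at this
  have L := lift_out o.elem (h4.trans (Finset.card_le_card o.sub)) hv1U3 hv2U3 hv12 hxyE.1 hxyE.2
  have hdisj : Disjoint U3 {v1, v2} := by simp [hv1U3, hv2U3]
  have hcards : (U3 ∪ {v1, v2}).card = U3.card + 2 := by
    rw [Finset.card_union_of_disjoint hdisj, Finset.card_pair hv12]
  refine ⟨U3 ∪ {v1, v2}, lift H3 x y v1 v2, Q3, ?_, ?_, ?_, L.elem, ⟨?_, ?_⟩, ?_, ?_, ?_, ?_⟩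
  · exact o.sub.trans Finset.subset_union_left
  · intro z hz
    simp at hz
    rcases hz with rfl | rfl | h
    · exact hv1Y
    · exact hv2Y
    · exact (Finset.mem_sdiff.1 (o.subY h)).1
  · intro a b hab
    rw [lift_adj_iff exv1 hv12 eyv2.symm] at hab
    rcases hab with h | (⟨rfl, rfl⟩ | ⟨rfl, rfl⟩) | (⟨rfl, rfl⟩ | ⟨rfl, rfl⟩) | (⟨rfl, rfl⟩ | ⟨rfl, rfl⟩)
    · have := o.le h.1
      rw [hG', adj_add exy] at this
      tauto
    · exact hxv1
    · exact hxv1.symm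
    · exact hMv1.2.2
    · exact hMv1.2.2.symm
    · exact hv2y
    · exact hv2y.symm
  · exact o.cl.1.trans Finset.subset_union_left
  · intro a ha b hb hab
    exact L.pp a (o.cl.1 ha) b (o.cl.1 hb) (o.cl.2 a ha b hb hab)
  · intro z hz
    simp at hz
    by_cases h1 : z = x
    · subst h1; simp [← hv1e]
    by_cases h2 : z = y
    · subst h2; simp [hNy]
    rcases hz with rfl | rfl | h
    · simp [hNv1, hxU3]
    · simp [← hye, hyU3]
    · have := o.Ncl z h
      rw [hN'o z h1 h2] at this
      simp [this]
  · intro z hz hzU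
    simp at hz
    rcases hz with rfl | rfl | h
    · simp [← hv2e]
    · simp [hMv1.2.1]
    · simp [o.Mcl z h hzU]
  · intro z hz hcond
    simp at hz
    by_cases h1 : z = x
    · subst h1; rw [← hv1e]; exact ⟨L.a1, L.p1⟩
    by_cases h2 : z = y
    · subst h2; rw [hNy]; exact ⟨L.a3.symm, by rw [Finset.pair_comm z v2]; exact L.p3⟩
    rcases hz with rfl | rfl | h
    · rw [hNv1]; exact ⟨L.a1.symm, by rw [Finset.pair_comm z x]; exact L.p1⟩
    · rw [← hye]; exact ⟨L.a3, L.p3⟩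
    · have h3 := o.edges z h (by
        rw [hN'o z h1 h2]
        rcases hcond with h | h | h | h
        · exact Or.inl h
        · exact Or.inr (Or.inl h)
        · exact Or.inr (Or.inr (Or.inl (hTT' h)))
        · exact Or.inr (Or.inr (Or.inr h)))
      have h4 := o.Ncl z h
      rw [hN'o z h1 h2] at h3 h4
      exact ⟨lift_adj_of hxyE.1 h3.1 (by tauto), L.pp z h _ h4 h3.2⟩
  · have h1 := o.bd
    have h2 := ec_lift (v1 := v1) (v2 := v2) hxyE.1
    omega
end A2sec

section Chain
variable {V : Type*} [Fintype V] [DecidableEq V]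

structure Conf (G : SimpleGraph V) (W U : Finset V) (H : SimpleGraph V) (Q : Finset V) (M0 : V → V) : Prop where
  sub : U ⊆ W
  four : 4 ≤ U.card
  out : IsPM G (W \ U) M0
  le : H ≤ G
  elem : Elem H U
  cl : Cl H U Q

def Good (G : SimpleGraph V) (W : Finset V) (s : ℕ) : Prop :=
  ∃ U H Q M0, Conf G W U H Q M0 ∧ 2 * s + 8 + 2 * ec H ≤ 3 * U.card + 2 * Q.card

theorem A2Out.conf {G : SimpleGraph V} {W U : Finset V} {H : SimpleGraph V} {Q : Finset V} {N M0 : V → V} {T : Finset V}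
    {U3 : Finset V} {H3 : SimpleGraph V} {Q3 : Finset V} (o : A2Out G W U H Q N M0 T U3 H3 Q3) (c : Conf G W U H Q M0) :
    Conf G W U3 H3 Q3 M0 := by
  refine ⟨o.subY, c.four.trans (Finset.card_le_card o.sub), ?_, o.le, o.elem, o.cl⟩
  have := c.out.sdiff (Z := U3 \ U) (fun z hz => by
      simp at hz ⊢; exact ⟨o.subY hz.1, hz.2⟩) (fun z hz => by
      simp at hz ⊢
      refine ⟨o.Mcl z hz.1 hz.2, ?_⟩
      have := (c.out z (by simp [o.subY hz.1, hz.2])).1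
      simp at this; exact this.2)
  convert this using 1
  ext z
  have := @o.sub z
  simp; tauto

theorem step0 {G : SimpleGraph V} {W U : Finset V} {H : SimpleGraph V} {Q : Finset V} {N M0 : V → V}
    (c : Conf G W U H Q M0) (hN : IsPM G W N) : ∃ U3 H3 Q3, A2Out G W U H Q N M0 ∅ U3 H3 Q3 ∧ Conf G W U3 H3 Q3 M0 ∧
      3 * U.card + 2 * Q.card + 2 * ec H3 ≤ 3 * U3.card + 2 * Q3.card + 2 * ec H ∧
      ∀ w ∈ U3, w ∉ U → N w ∉ U → 3 * U.card + 2 * Q.card + 2 * ec H3 + 2 ≤ 3 * U3.card + 2 * Q3.card + 2 * ec H := by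
  obtain ⟨U3, H3, Q3, o⟩ := A2 _ G W U H Q N M0 ∅ rfl c.sub hN c.out c.le c.elem c.cl c.four (by simp) (by simp)
  have hb := o.bd
  have himg : (U.filter fun z => N z ∉ U).card = ((U.filter fun z => N z ∉ U).image N).card := by
    rw [Finset.card_image_of_injOn]
    intro a ha b hb e
    simp at ha hb
    exact hN.inj (c.sub ha.1) (c.sub hb.1) e
  have hsub : (U.filter fun z => N z ∉ U).image N ⊆ U3 \ U := by
    intro w hw
    simp at hw
    obtain ⟨a, ⟨ha, hna⟩, rfl⟩ := hw
    simp [hna, o.Ncl a (o.sub ha)]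
  have hc := Finset.card_sdiff_add_card_eq_card o.sub
  have hle := Finset.card_le_card hsub
  simp at hb
  refine ⟨U3, H3, Q3, o, o.conf c, by omega, fun w hw hwU hNw => ?_⟩
  have hlt : ((U.filter fun z => N z ∉ U).image N).card < (U3 \ U).card := by
    apply Finset.card_lt_card
    refine ⟨hsub, fun h => ?_⟩
    have := h (show w ∈ U3 \ U by simp [hw, hwU])
    simp at this
    obtain ⟨a, ⟨ha, hna⟩, rfl⟩ := this
    rw [(hN a (c.sub ha)).2.1] at hNw
    exact hNw ha
  have e1 := c.elem.pm.even
  have e2 := o.elem.pm.even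
  rw [Nat.even_iff] at e1 e2
  omega

structure Bic (G : SimpleGraph V) (W : Finset V) : Prop where
  sub : ∀ x y, G.Adj x y → x ∈ W
  bic : ∀ u ∈ W, ∀ v ∈ W, u ≠ v → HasPM G (W \ {u, v})
  conn : ∀ X ⊆ W, X.Nonempty → X ≠ W → ∃ x ∈ X, ∃ y ∈ W \ X, G.Adj x y

theorem Bic.exN {G : SimpleGraph V} {W : Finset V} (h : Bic G W) {x y} (hxy : G.Adj x y) :
    ∃ N, IsPM G W N ∧ N x = y ∧ N y = x :=
  (h.bic x (h.sub _ _ hxy) y (h.sub _ _ hxy.symm) hxy.ne).exists_edge (h.sub _ _ hxy) (h.sub _ _ hxy.symm) hxy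

theorem Bic.leave {G : SimpleGraph V} {W U : Finset V} {H : SimpleGraph V} {Q : Finset V} {M0 : V → V} (h : Bic G W)
    (c : Conf G W U H Q M0) (hne : U ≠ W) : ∃ x ∈ U, ∃ v ∈ W, v ∉ U ∧ G.Adj x v := by
  obtain ⟨x, hx, y, hy, hxy⟩ := h.conn U c.sub (by rw [← Finset.card_pos]; have := c.four; omega) hne
  simp at hy
  exact ⟨x, hx, y, hy.1, hy.2, hxy⟩

theorem chain {G : SimpleGraph V} {W : Finset V} {s : ℕ} (hG : Bic G W) (k : ℕ) :
    ∀ U H Q M0, (W \ U).card = k → Conf G W U H Q M0 → 2 * s + 8 + 2 * ec H ≤ 3 * U.card + 2 * Q.card →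
    ∃ B, B ≤ G ∧ Elem B W ∧ (∀ u ∈ W, ∀ v ∈ W, u ≠ v → HasPM B (W \ {u, v})) ∧ 2 * ec B + 2 * s + 8 ≤ 5 * W.card := by
  induction k using Nat.strong_induction_on with
  | _ k ih =>
  intro U H Q M0 hk c hb
  by_cases hUW : U = W
  · subst hUW
    obtain ⟨H2, Q2, a1, a2, a3, a4, a5, a6⟩ := saturate (ec G) (by omega) c.le c.elem c.cl
    refine ⟨H2, a2, a3, fun u hu v hv hne => a6 u hu v hv (hG.bic u hu v hv hne), ?_⟩
    have := Finset.card_le_card a4.1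
    omega
  · obtain ⟨x, hx, v, hvW, hv, hxv⟩ := hG.leave c hUW
    obtain ⟨N, hN, hNx, -⟩ := hG.exN hxv
    obtain ⟨U3, H3, Q3, o, c3, hb3, -⟩ := step0 c hN
    refine ih _ ?_ U3 H3 Q3 M0 rfl c3 (by omega)
    rw [← hk]
    apply Finset.card_lt_card
    refine ⟨Finset.sdiff_subset_sdiff le_rfl o.sub, fun h => ?_⟩
    have h1 := h (show v ∈ W \ U by simp [hvW, hv])
    have h2 := o.Ncl x (o.sub hx)
    rw [hNx] at h2
    simp [h2] at h1

theorem Good.chain {G : SimpleGraph V} {W : Finset V} {s : ℕ} (hG : Bic G W) (h : Good G W s) :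
    ∃ B, B ≤ G ∧ Elem B W ∧ (∀ u ∈ W, ∀ v ∈ W, u ≠ v → HasPM B (W \ {u, v})) ∧ 2 * ec B + 2 * s + 8 ≤ 5 * W.card := by
  obtain ⟨U, H, Q, M0, c, hb⟩ := h
  exact _root_.chain hG _ U H Q M0 rfl c hb

theorem good_alpha {G : SimpleGraph V} {W U : Finset V} {H : SimpleGraph V} {Q : Finset V} {N M0 : V → V} {s : ℕ}
    (c : Conf G W U H Q M0) (hb : 2 * s + 8 + 2 * ec H ≤ 3 * U.card + 2 * Q.card) (hN : IsPM G W N)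
    {x} (hx : x ∈ U) (h1 : N x ∉ U) (h2 : N (M0 (N x)) ∉ U) : Good G W (s + 1) := by
  obtain ⟨U3, H3, Q3, o, c3, hb3, hg⟩ := step0 c hN
  have a1 := o.Ncl x (o.sub hx)
  have a2 := o.Mcl _ a1 h1
  have a3 := (c.out (N x) (by simp [h1, c.sub hx, (hN x (c.sub hx)).1])).1
  simp at a3
  have := hg _ a2 a3.2 h2
  exact ⟨U3, H3, Q3, M0, c3, by omega⟩

theorem good_XP {G : SimpleGraph V} {W U : Finset V} {H : SimpleGraph V} {Q : Finset V} {M0 : V → V} {s : ℕ}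
    (hG : Bic G W) (c : Conf G W U H Q M0) (hb : 2 * s + 8 + 2 * ec H ≤ 3 * U.card + 2 * Q.card)
    {x y v1 v2 w : V} (hx : x ∈ U) (hy : y ∈ U) (hxy : HasPM H (U \ {x, y})) (hne : x ≠ y)
    (hv1 : v1 ∉ U) (hv2 : M0 v1 = v2) (a1 : G.Adj x v1) (a2 : G.Adj v2 y) (a3 : G.Adj v1 w) (hw : w ∉ U) (hw2 : w ≠ v2) :
    Good G W (s + 1) := by
  obtain ⟨N, hN, hNv, hNw⟩ := hG.exN a3
  have hv1W := hG.sub _ _ a3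
  have hwW := hG.sub _ _ a3.symm
  have hMv := c.out v1 (by simp [hv1W, hv1])
  rw [hv2] at hMv
  have hv2W := (Finset.mem_sdiff.1 hMv.1).1
  have hv2U := (Finset.mem_sdiff.1 hMv.1).2
  have hwv1 : w ≠ v1 := a3.ne.symm
  obtain ⟨U3, H3, Q3, o, c3, hb3, hg⟩ := step0 c hN
  by_cases hv3 : v1 ∈ U3
  · have := hg v1 hv3 hv1 (by rw [hNv]; exact hw)
    exact ⟨U3, H3, Q3, M0, c3, by omega⟩
  have hw3 : w ∉ U3 := fun h => hv3 (by rw [← hNw]; exact o.Ncl w h)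
  -- M1
  have hM1 : IsPM G (W \ U) (fun z => if z ∈ U3 then M0 z else N z) := by
    intro z hz
    by_cases h3 : z ∈ U3
    · have h := c.out z hz
      have hzU := (Finset.mem_sdiff.1 hz).2
      have := o.Mcl z h3 hzU
      simp only [h3, this, if_true]
      exact h
    · have h := hN z (Finset.mem_sdiff.1 hz).1
      have : N z ∉ U3 := fun h' => h3 (by rw [← h.2.1]; exact o.Ncl _ h')
      simp only [h3, this, if_false, Finset.mem_sdiff]
      exact ⟨⟨h.1, fun h' => this (o.sub h')⟩, h.2⟩
  have hv12 := hMv.2.2.ne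
  obtain ⟨g, hg'⟩ := hxy
  have exv1 : x ≠ v1 := a1.ne
  have exv2 : x ≠ v2 := fun e => hv2U (e ▸ hx)
  have eyv1 : y ≠ v1 := fun e => hv1 (e ▸ hy)
  have eyv2 : y ≠ v2 := a2.ne.symm
  have hN2 : IsPM G W (fun z => if z = x then v1 else if z = v1 then x else if z = y then v2 else if z = v2 then y
      else if z ∈ U then g z else M0 z) := by
    intro z hz
    by_cases e1 : z = x
    · subst e1; simp [exv1.symm, hv1W, a1]
    by_cases e2 : z = v1
    · subst e2; simp [exv1.symm, c.sub hx, a1.symm]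
    by_cases e3 : z = y
    · subst e3; simp [hne.symm, eyv1, hv2W, a2.symm, exv2.symm, hv12.symm, eyv2.symm]
    by_cases e4 : z = v2
    · subst e4; simp [exv2.symm, hv12.symm, eyv2.symm, hne.symm, eyv1, c.sub hy, a2]
    by_cases e5 : z ∈ U
    · have h := hg' z (by simp [e5, e1, e3])
      have h1 := h.1
      simp at h1
      have i1 : g z ≠ v1 := fun e => hv1 (e ▸ h1.1)
      have i2 : g z ≠ v2 := fun e => hv2U (e ▸ h1.1)
      simp [e1, e2, e3, e4, e5, h1, i1, i2, h.2.1, c.sub h1.1]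
      exact c.le h.2.2
    · have h := c.out z (by simp [hz, e5])
      have h1 := h.1
      simp at h1
      have i1 : M0 z ≠ v1 := fun e => e4 (by rw [← h.2.1, e, hv2])
      have i2 : M0 z ≠ v2 := fun e => e2 (by rw [← h.2.1, e, hMv.2.1])
      have i3 : M0 z ≠ x := fun e => h1.2 (e ▸ hx)
      have i4 : M0 z ≠ y := fun e => h1.2 (e ▸ hy)
      simp [e1, e2, e3, e4, e5, h1, i1, i2, i3, i4, h.2.1, h.2.2]
  obtain ⟨U4, H4, Q4, o4, c4, hb4, hg4⟩ := step0 (M0 := fun z => if z ∈ U3 then M0 z else N z) ⟨c.sub, c.four, hM1, c.le, c.elem, c.cl⟩ hN2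
  have b1 : v1 ∈ U4 := by
    have := o4.Ncl x (o4.sub hx)
    simpa using this
  have b2 : w ∈ U4 := by
    have := o4.Mcl v1 b1 hv1
    simpa [hv3, hNv] using this
  have b3 := hg4 w b2 hw (by
    have e1 : w ≠ x := fun e => hw (e ▸ hx)
    have e2 : w ≠ y := fun e => hw (e ▸ hy)
    have := (c.out w (by simp [hw, hwW])).1
    simp at this
    simp [e1, e2, hwv1, hw2, hw, this.2])
  exact ⟨U4, H4, Q4, _, c4, by omega⟩

theorem good_beta {G : SimpleGraph V} {W U : Finset V} {H : SimpleGraph V} {Q Q' : Finset V} {N M0 : V → V} {s : ℕ}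
    (c : Conf G W U H Q M0) (hb : 2 * s + 8 + 2 * ec H ≤ 3 * U.card + 2 * Q.card) (hN : IsPM G W N)
    {x y v1 v2 : V} (hx : x ∈ U) (hv1e : N x = v1) (hv1 : v1 ∉ U) (hv2e : M0 v1 = v2) (hye : N v2 = y) (hyU : y ∈ U)
    (hQ' : Cl (H ⊔ edge x y) U Q') (hc : Q.card + 1 ≤ Q'.card) : Good G W (s + 1) := by
  have hxW := c.sub hx
  have hxv := hN x hxW
  rw [hv1e] at hxv
  have hMv := c.out v1 (by simp [hxv.1, hv1])
  rw [hv2e] at hMv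
  have hv2W := (Finset.mem_sdiff.1 hMv.1).1
  have hv2 := (Finset.mem_sdiff.1 hMv.1).2
  have hv2y := hN v2 hv2W
  rw [hye] at hv2y
  have hv12 := hMv.2.2.ne
  have exv1 : x ≠ v1 := fun e => hv1 (e ▸ hx)
  have exv2 : x ≠ v2 := fun e => hv2 (e ▸ hx)
  have eyv1 : y ≠ v1 := fun e => hv1 (e ▸ hyU)
  have eyv2 : y ≠ v2 := fun e => hv2 (e ▸ hyU)
  have exy : x ≠ y := by
    rintro rfl
    rw [hv1e] at hv2y; exact hv12 hv2y.2.1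
  set N' : V → V := fun z => if z = x then y else if z = y then x else N z with hN'def
  have hN'x : N' x = y := by simp [hN'def]
  have hN'y : N' y = x := by simp [hN'def, exy.symm]
  have hN'o : ∀ z, z ≠ x → z ≠ y → N' z = N z := fun z h1 h2 => by simp [hN'def, h1, h2]
  have hN'pm : IsPM (G ⊔ edge x y) (W \ {v1, v2}) N' := by
    intro z hz
    simp at hz
    by_cases h1 : z = x
    · subst h1; rw [hN'x, hN'y]; refine ⟨by simp [c.sub hyU, eyv1, eyv2], rfl, ?_⟩
      rw [adj_add exy]; simp
    by_cases h2 : z = y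
    · subst h2; rw [hN'y, hN'x]; refine ⟨by simp [hxW, exv1, exv2], rfl, ?_⟩
      rw [adj_add exy]; simp
    have h3 := hN z hz.1
    have i1 : N z ≠ x := fun e => hz.2.1 (by rw [← h3.2.1, e, hv1e])
    have i2 : N z ≠ y := fun e => hz.2.2 (by rw [← h3.2.1, e, hv2y.2.1])
    have i3 : N z ≠ v1 := fun e => h1 (by rw [← h3.2.1, e, hxv.2.1])
    have i4 : N z ≠ v2 := fun e => h2 (by rw [← h3.2.1, e, hye])
    rw [hN'o z h1 h2, hN'o _ i1 i2]
    exact ⟨by simp [h3.1, i3, i4], h3.2.1, le_sup_left (a := G) h3.2.2⟩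
  have hUY' : U ⊆ W \ {v1, v2} := by
    intro z hz
    simp [c.sub hz]
    exact ⟨fun e => hv1 (e ▸ hz), fun e => hv2 (e ▸ hz)⟩
  have hYU' : (W \ {v1, v2}) \ U = (W \ U) \ {v1, M0 v1} := by
    rw [hv2e]; ext z; simp; tauto
  have c' : Conf (G ⊔ edge x y) (W \ {v1, v2}) U (H ⊔ edge x y) Q' M0 := by
    refine ⟨hUY', c.four, ?_, sup_le_sup_right c.le _, c.elem.add hx hyU, hQ'⟩
    rw [hYU']
    exact (c.out.sdiff_edge (by simp [hxv.1, hv1])).mono le_sup_left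
  obtain ⟨U3, H3, Q3, o, c3, hb3, -⟩ := step0 c' hN'pm
  have hxyE := o.edges x (o.sub hx) (by
    rw [hN'x, adj_add exy]; simp)
  rw [hN'x] at hxyE
  have hv1U3 : v1 ∉ U3 := fun h => by have := o.subY h; simp at this
  have hv2U3 : v2 ∉ U3 := fun h => by have := o.subY h; simp at this
  have L := lift_out o.elem c3.four hv1U3 hv2U3 hv12 hxyE.1 hxyE.2
  have hdisj : Disjoint U3 {v1, v2} := by simp [hv1U3, hv2U3]
  have hcards : (U3 ∪ {v1, v2}).card = U3.card + 2 := by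
    rw [Finset.card_union_of_disjoint hdisj, Finset.card_pair hv12]
  have e1 := ec_lift (v1 := v1) (v2 := v2) hxyE.1
  have e2 := ec_add H x y
  have h4 := c3.four
  refine ⟨U3 ∪ {v1, v2}, lift H3 x y v1 v2, Q3, M0, ⟨?_, by omega, ?_, ?_, L.elem, ⟨o.cl.1.trans Finset.subset_union_left, ?_⟩⟩, by omega⟩
  · intro z hz
    simp at hz
    rcases hz with rfl | rfl | h
    · exact hxv.1
    · exact hv2W
    · exact (Finset.mem_sdiff.1 (o.subY h)).1
  · have := c3.out
    have e : W \ (U3 ∪ {v1, v2}) = (W \ {v1, v2}) \ U3 := by ext z; simp; tauto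
    rw [e]
    refine this.mono' fun a ha b hb hab => ?_
    rw [adj_add exy] at hab
    have hx3 := o.sub hx
    have hy3 := o.sub hyU
    simp at ha hb
    rcases hab with h | ⟨rfl, rfl⟩ | ⟨rfl, rfl⟩ <;> tauto
  · intro a b hab
    rw [lift_adj_iff exv1 hv12 eyv2.symm] at hab
    rcases hab with h | (⟨rfl, rfl⟩ | ⟨rfl, rfl⟩) | (⟨rfl, rfl⟩ | ⟨rfl, rfl⟩) | (⟨rfl, rfl⟩ | ⟨rfl, rfl⟩)
    · have := o.le h.1
      rw [adj_add exy] at this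
      tauto
    · exact hxv.2.2
    · exact hxv.2.2.symm
    · exact hMv.2.2
    · exact hMv.2.2.symm
    · exact hv2y.2.2
    · exact hv2y.2.2.symm
  · intro a ha b hb hab
    exact L.pp a (o.cl.1 ha) b (o.cl.1 hb) (o.cl.2 a ha b hb hab)
end Chain

section Cert
variable {V : Type*} [Fintype V] [DecidableEq V]

def pmB (E : ℕ → ℕ → Bool) : ℕ → List ℕ → Bool
  | 0, L => L.isEmpty
  | _+1, [] => true
  | n+1, i :: L => L.any fun j => E i j && pmB E n (L.erase j)

def Ok (φ : ℕ → V) (I : List ℕ) : Prop := ∀ i ∈ I, ∀ j ∈ I, φ i = φ j → i = j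

abbrev im (φ : ℕ → V) (I : List ℕ) : Finset V := I.toFinset.image φ

theorem Ok.sub {φ : ℕ → V} {I J : List ℕ} (h : Ok φ I) (hJ : J ⊆ I) : Ok φ J :=
  fun i hi j hj e => h i (hJ hi) j (hJ hj) e

theorem im_erase {φ : ℕ → V} {I : List ℕ} (h : Ok φ I) (hn : I.Nodup) {u v} (hu : u ∈ I) (hv : v ∈ I) :
    im φ I \ {φ u, φ v} = im φ ((I.erase u).erase v) := by
  ext z
  simp only [im, Finset.mem_sdiff, Finset.mem_image, List.mem_toFinset, (hn.erase u).mem_erase_iff, hn.mem_erase_iff,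
    Finset.mem_insert, Finset.mem_singleton, not_or]
  constructor
  · rintro ⟨⟨a, ha, rfl⟩, h1, h2⟩
    exact ⟨a, ⟨fun e => h2 (by rw [e]), fun e => h1 (by rw [e]), ha⟩, rfl⟩
  · rintro ⟨a, ⟨h1, h2, ha⟩, rfl⟩
    exact ⟨⟨a, ha, rfl⟩, fun e => h2 (h _ ha _ hu e), fun e => h1 (h _ ha _ hv e)⟩

theorem pmB_sound {φ : ℕ → V} {E : ℕ → ℕ → Bool} {H : SimpleGraph V} (n : ℕ) : ∀ L : List ℕ, L.Nodup → Ok φ L →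
    (∀ i ∈ L, ∀ j ∈ L, E i j = true → H.Adj (φ i) (φ j)) → pmB E n L = true → HasPM H (im φ L) := by
  induction n with
  | zero => intro L _ _ _ h; simp [pmB] at h; subst h; simpa [im] using HasPM.empty H
  | succ n ih =>
    intro L hn hφ hE h
    cases L with
    | nil => simpa [im] using HasPM.empty H
    | cons i L =>
      simp only [pmB, List.any_eq_true, Bool.and_eq_true] at h
      obtain ⟨j, hj, h1, h2⟩ := h
      have hs : L.erase j ⊆ i :: L := fun a ha => List.mem_cons_of_mem _ (List.mem_of_mem_erase ha)
      have hnL := (List.nodup_cons.1 hn)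
      have := ih (L.erase j) (hnL.2.erase j) (hφ.sub hs) (fun a ha b hb => hE a (hs ha) b (hs hb)) h2
      have e := im_erase hφ hn (u := i) (v := j) (by simp) (by simp [hj])
      rw [List.erase_cons_head] at e
      rw [← e] at this
      have hadj := hE i (by simp) j (by simp [hj]) h1
      obtain ⟨f, hf, -⟩ := this.exists_edge (by simp) (by simp; right; exact ⟨j, hj, rfl⟩) hadj
      exact ⟨f, hf⟩

def connB (E : ℕ → ℕ → Bool) (I : List ℕ) : List ℕ → List ℕ → Bool
  | _, [] => true
  | seen, i :: r => (seen.any fun j => E i j && pmB E I.length ((I.erase i).erase j)) && connB E I (i :: seen) r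

theorem connB_sound {φ : ℕ → V} {E : ℕ → ℕ → Bool} {H : SimpleGraph V} {I : List ℕ} (hn : I.Nodup) (hφ : Ok φ I)
    (hE : ∀ i ∈ I, ∀ j ∈ I, E i j = true → H.Adj (φ i) (φ j)) {X : Finset V}
    (hX : ¬ ∃ x ∈ X, ∃ y ∈ im φ I \ X, H.Adj x y ∧ HasPM H (im φ I \ {x, y})) {p : Prop} (r : List ℕ) :
    ∀ seen, seen ⊆ I → r ⊆ I → (∀ i ∈ seen, (φ i ∈ X ↔ p)) → connB E I seen r = true → ∀ i ∈ r, (φ i ∈ X ↔ p) := by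
  induction r with
  | nil => simp
  | cons i r ih =>
    intro seen hs hr hp h
    simp only [connB, Bool.and_eq_true, List.any_eq_true] at h
    obtain ⟨⟨j, hj, h1, h2⟩, h3⟩ := h
    have hi : i ∈ I := hr (by simp)
    have hjI := hs hj
    have a := hE i hi j hjI h1
    have hpm : HasPM H (im φ I \ {φ i, φ j}) := by
      rw [im_erase hφ hn hi hjI]
      have ss : (I.erase i).erase j ⊆ I := fun _ h => List.mem_of_mem_erase (List.mem_of_mem_erase h)
      exact pmB_sound _ _ ((hn.erase _).erase _) (hφ.sub ss) (fun a ha b hb => hE a (ss ha) b (ss hb)) h2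
    have key : φ i ∈ X ↔ p := by
      rw [← hp j hj]
      by_contra hc
      apply hX
      by_cases hix : φ i ∈ X
      · exact ⟨φ i, hix, φ j, by simp; exact ⟨⟨j, hjI, rfl⟩, by tauto⟩, a, hpm⟩
      · exact ⟨φ j, by tauto, φ i, by simp; exact ⟨⟨i, hi, rfl⟩, by tauto⟩, a.symm, by rwa [Finset.pair_comm]⟩
    intro k hk
    rcases List.mem_cons.1 hk with rfl | hk
    · exact key
    · exact ih (i :: seen) (by simp [hi, hs]) (fun _ h => hr (by simp [h])) (by
        intro k hk; rcases List.mem_cons.1 hk with rfl | hk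
        · exact key
        · exact hp k hk) h3 k hk

def elemB (E : ℕ → ℕ → Bool) (I : List ℕ) : Bool :=
  pmB E I.length I && connB E I (I.take 1) I.tail

theorem elemB_sound {φ : ℕ → V} {E : ℕ → ℕ → Bool} {H : SimpleGraph V} {I : List ℕ} (hn : I.Nodup) (hφ : Ok φ I)
    (hE : ∀ i ∈ I, ∀ j ∈ I, E i j = true → H.Adj (φ i) (φ j)) (hs : ∀ x y, H.Adj x y → x ∈ im φ I)
    (h : elemB E I = true) : Elem H (im φ I) := by
  simp only [elemB, Bool.and_eq_true] at h
  refine ⟨hs, pmB_sound _ _ hn hφ hE h.1, fun X hX hne hnU => ?_⟩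
  by_contra hc
  cases I with
  | nil =>
    have : X = ∅ := by simpa [im] using hX
    simp [this] at hne
  | cons i r =>
    have := connB_sound hn hφ hE hc (p := φ i ∈ X) r [i] (by simp) (by simp) (by simp) (by simpa using h.2)
    by_cases hi : φ i ∈ X
    · apply hnU
      apply Finset.Subset.antisymm hX
      intro z hz
      simp at hz
      rcases hz with rfl | ⟨a, ha, rfl⟩
      · exact hi
      · exact (this a ha).2 hi
    · obtain ⟨z, hz⟩ := hne
      have h2 := hX hz
      simp at h2
      rcases h2 with rfl | ⟨a, ha, rfl⟩
      · exact hi hz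
      · exact hi ((this a ha).1 hz)

def clB (E : ℕ → ℕ → Bool) (I Q : List ℕ) : Bool :=
  Q.all fun u => I.contains u && Q.all fun v => u == v || pmB E I.length ((I.erase u).erase v)

theorem clB_sound {φ : ℕ → V} {E : ℕ → ℕ → Bool} {H : SimpleGraph V} {I Q : List ℕ} (hn : I.Nodup) (hφ : Ok φ I)
    (hE : ∀ i ∈ I, ∀ j ∈ I, E i j = true → H.Adj (φ i) (φ j))
    (h : clB E I Q = true) : Cl H (im φ I) (im φ Q) := by
  simp only [clB, List.all_eq_true, Bool.and_eq_true, Bool.or_eq_true, List.contains_iff_mem, beq_iff_eq] at h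
  have hQ : Q ⊆ I := fun u hu => (h u hu).1
  refine ⟨Finset.image_subset_image (fun a ha => by simp at ha ⊢; exact hQ ha), ?_⟩
  intro u hu v hv hne
  simp at hu hv
  obtain ⟨u, hu, rfl⟩ := hu
  obtain ⟨v, hv, rfl⟩ := hv
  rw [im_erase hφ hn (hQ hu) (hQ hv)]
  have ss : (I.erase u).erase v ⊆ I := fun _ h => List.mem_of_mem_erase (List.mem_of_mem_erase h)
  rcases (h u hu).2 v hv with rfl | h2
  · exact absurd rfl hne
  · exact pmB_sound _ _ ((hn.erase _).erase _) (hφ.sub ss) (fun a ha b hb => hE a (ss ha) b (ss hb)) h2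

theorem im_card {φ : ℕ → V} {I : List ℕ} (h : Ok φ I) (hn : I.Nodup) : (im φ I).card = I.length := by
  rw [Finset.card_image_of_injOn, List.toFinset_card_of_nodup hn]
  intro a ha b hb e
  simp at ha hb
  exact h a ha b hb e

def elB (L : List (ℕ × ℕ)) (i j : ℕ) : Bool := L.contains (i, j) || L.contains (j, i)

def gr (φ : ℕ → V) (L : List (ℕ × ℕ)) : SimpleGraph V where
  Adj a b := a ≠ b ∧ ∃ e ∈ L, (a = φ e.1 ∧ b = φ e.2) ∨ (a = φ e.2 ∧ b = φ e.1)
  symm := ⟨fun a b ⟨h, e, he, h2⟩ => ⟨h.symm, e, he, by tauto⟩⟩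
  loopless := ⟨fun a h => h.1 rfl⟩

theorem ec_gr (φ : ℕ → V) (L : List (ℕ × ℕ)) : ec (gr φ L) ≤ L.length := by
  unfold ec
  have : (gr φ L).edgeSet ⊆ ((L.map fun e => s(φ e.1, φ e.2)).toFinset : Set (Sym2 V)) := by
    intro e
    induction e using Sym2.ind with
    | _ a b =>
      rintro ⟨_, e, he, h⟩
      simp only [List.coe_toFinset, List.mem_map, Set.mem_setOf_eq]
      refine ⟨e, he, ?_⟩
      rcases h with ⟨rfl, rfl⟩ | ⟨rfl, rfl⟩
      · rfl
      · exact Sym2.eq_swap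
  calc _ ≤ _ := Set.ncard_le_ncard this (Finset.finite_toSet _)
    _ ≤ _ := by
      rw [Set.ncard_coe_finset]
      exact (List.toFinset_card_le _).trans (by simp)

def certB (L : List (ℕ × ℕ)) (I Q : List ℕ) : Bool :=
  (L.all fun e => I.contains e.1 && I.contains e.2 && e.1 != e.2) && elemB (elB L) I && clB (elB L) I Q

theorem gr_elB {φ : ℕ → V} {L : List (ℕ × ℕ)} {I : List ℕ} (hφ : Ok φ I) 
    (h : (L.all fun e => I.contains e.1 && I.contains e.2 && e.1 != e.2) = true) :
    ∀ i ∈ I, ∀ j ∈ I, elB L i j = true → (gr φ L).Adj (φ i) (φ j) := by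
  simp only [List.all_eq_true, Bool.and_eq_true, List.contains_iff_mem, bne_iff_ne] at h
  intro i hi j hj he
  simp [elB] at he
  rcases he with he | he
  · exact ⟨fun e => (h _ he).2 (hφ _ hi _ hj e), _, he, by simp⟩
  · exact ⟨fun e => (h _ he).2 (hφ _ hj _ hi e.symm), _, he, by simp⟩

theorem conf_cert {G : SimpleGraph V} {W : Finset V} {φ : ℕ → V} {M0 : V → V} (I : List ℕ) (L : List (ℕ × ℕ)) (Q : List ℕ)
    (hφ : Ok φ I) (hW : ∀ i ∈ I, φ i ∈ W) (hout : IsPM G (W \ im φ I) M0) (hL : ∀ e ∈ L, G.Adj (φ e.1) (φ e.2))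
    (hn : I.Nodup) (h4 : 4 ≤ I.length) (hc : certB L I Q = true) : Conf G W (im φ I) (gr φ L) (im φ Q) M0 := by
  simp only [certB, Bool.and_eq_true] at hc
  obtain ⟨⟨h1, h2⟩, h3⟩ := hc
  have hE := gr_elB hφ h1
  simp only [List.all_eq_true, Bool.and_eq_true, List.contains_iff_mem] at h1
  refine ⟨?_, by rwa [im_card hφ hn], hout, ?_, ?_, clB_sound hn hφ hE h3⟩
  · intro z hz; simp at hz; obtain ⟨a, ha, rfl⟩ := hz; exact hW a ha
  · rintro a b ⟨_, e, he, ⟨rfl, rfl⟩ | ⟨rfl, rfl⟩⟩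
    · exact hL e he
    · exact (hL e he).symm
  · refine elemB_sound hn hφ hE ?_ h2
    rintro a b ⟨_, e, he, ⟨rfl, rfl⟩ | ⟨rfl, rfl⟩⟩
    · simp; exact ⟨_, (h1 e he).1.1, rfl⟩
    · simp; exact ⟨_, (h1 e he).1.2, rfl⟩

theorem good_cert {G : SimpleGraph V} {W : Finset V} {φ : ℕ → V} (s : ℕ) (I : List ℕ) (L : List (ℕ × ℕ)) (Q : List ℕ)
    (hφ : Ok φ I) (hW : ∀ i ∈ I, φ i ∈ W) (hout : HasPM G (W \ im φ I)) (hL : ∀ e ∈ L, G.Adj (φ e.1) (φ e.2))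
    (hc : (certB L I Q && decide (Q.Nodup ∧ I.Nodup ∧ 4 ≤ I.length ∧ 2 * s + 8 + 2 * L.length ≤ 3 * I.length + 2 * Q.length)) = true) :
    Good G W s := by
  simp only [Bool.and_eq_true, decide_eq_true_eq] at hc
  obtain ⟨hc, hQ, hn, h4, hb⟩ := hc
  obtain ⟨M0, hout⟩ := hout
  have c := conf_cert I L Q hφ hW hout hL hn h4 hc
  refine ⟨_, _, _, M0, c, ?_⟩
  have h1 := ec_gr φ L
  have h2 := im_card hφ hn
  have h3 : (im φ Q).card = Q.length := im_card (hφ.sub (by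
    simp only [certB, Bool.and_eq_true, clB, List.all_eq_true, List.contains_iff_mem] at hc
    exact fun u hu => (hc.2 u hu).1)) hQ
  rw [h2, h3]; omega

/-- put an adjacent pair back outside -/
theorem out_add {G : SimpleGraph V} {W : Finset V} {φ : ℕ → V} {I : List ℕ} (J : List ℕ) (i j : ℕ) (h : HasPM G (W \ im φ I))
    (hφ : Ok φ I) (hW : ∀ i ∈ I, φ i ∈ W) (ha : G.Adj (φ i) (φ j))
    (hp : I.Perm (i :: j :: J) ∧ I.Nodup) : HasPM G (W \ im φ J) := by
  have hm := fun z => hp.1.mem_iff (a := z)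
  have hn := hp.1.nodup_iff.1 hp.2
  simp at hn hm
  have hi : i ∈ I := by rw [hm]; simp
  have hj : j ∈ I := by rw [hm]; simp
  have := h.add_pair ha (by simp; intro _; exact ⟨i, hi, rfl⟩) (by simp; intro _; exact ⟨j, hj, rfl⟩)
  convert this using 1
  ext z
  simp only [im, Finset.mem_sdiff, Finset.mem_image, List.mem_toFinset, Finset.mem_union, Finset.mem_insert, Finset.mem_singleton]
  constructor
  · rintro ⟨h1, h2⟩
    by_contra h3
    push Not at h3
    obtain ⟨a, ha, rfl⟩ := h3.1 h1
    rw [hm] at ha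
    rcases ha with rfl | rfl | ha
    · exact h3.2.1 rfl
    · exact h3.2.2 rfl
    · exact h2 ⟨a, ha, rfl⟩
  · rintro (⟨h1, h2⟩ | rfl | rfl)
    · exact ⟨h1, fun ⟨a, ha, e⟩ => h2 ⟨a, (hm a).2 (by tauto), e⟩⟩
    · exact ⟨hW _ hi, fun ⟨a, ha, e⟩ => hn.1.2 (by rw [← hφ a ((hm a).2 (by tauto)) _ hi e]; exact ha)⟩
    · exact ⟨hW _ hj, fun ⟨a, ha, e⟩ => hn.2.1 (by rw [← hφ a ((hm a).2 (by tauto)) _ hj e]; exact ha)⟩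

theorem out_perm {G : SimpleGraph V} {W : Finset V} {φ : ℕ → V} {I J : List ℕ} (h : HasPM G (W \ im φ I))
    (hp : I.Perm J) : HasPM G (W \ im φ J) := by
  have : im φ I = im φ J := by
    ext z; simp [hp.mem_iff]
  rwa [← this]

end Cert

section Theta
variable {V : Type*} [Fintype V] [DecidableEq V]

structure BrickOn (G : SimpleGraph V) (W : Finset V) : Prop where
  sub : ∀ x y, G.Adj x y → x ∈ W
  four : 4 ≤ W.card
  bic : ∀ u ∈ W, ∀ v ∈ W, u ≠ v → HasPM G (W \ {u, v})
  conn : ∀ a ∈ W, ∀ b ∈ W, ∀ X ⊆ W \ {a, b}, X.Nonempty → X ≠ W \ {a, b} →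
    ∃ x ∈ X, ∃ y ∈ (W \ {a, b}) \ X, G.Adj x y

theorem BrickOn.toBic {G : SimpleGraph V} {W : Finset V} (h : BrickOn G W) : Bic G W := by
  refine ⟨h.sub, h.bic, fun X hX hne hnW => ?_⟩
  obtain ⟨x, hx⟩ := hne
  obtain ⟨y, hyW, hy⟩ : ∃ y ∈ W, y ∉ X := by
    by_contra hc; push Not at hc; exact hnW (Finset.Subset.antisymm hX hc)
  have h4 := h.four
  have key : ∀ a ∈ W, (∃ x ∈ X, x ≠ a) → (∃ y ∈ W, y ∉ X ∧ y ≠ a) → ∃ x ∈ X, ∃ y ∈ W \ X, G.Adj x y := by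
    rintro a ha ⟨x, hx, hxa⟩ ⟨y, hy, hyX, hya⟩
    obtain ⟨p, hp, q, hq, hpq⟩ := h.conn a ha a ha (X \ {a}) (by
      intro z hz; simp at hz ⊢; exact ⟨hX hz.1, hz.2⟩) ⟨x, by simp [hx, hxa]⟩ (by
      intro e
      have : y ∈ W \ {a, a} := by simp [hy, hya]
      rw [← e] at this; simp at this; exact hyX this.1)
    simp at hp hq
    exact ⟨p, hp.1, q, by simp; tauto, hpq⟩
  by_cases h2 : ∃ x' ∈ X, x' ≠ x
  · exact key x (hX hx) h2 ⟨y, hyW, hy, fun e => hy (e ▸ hx)⟩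
  · push Not at h2
    refine key y hyW ⟨x, hx, fun e => hy (e ▸ hx)⟩ ?_
    by_contra hc
    push Not at hc
    have : W ⊆ {x, y} := by
      intro z hz
      by_cases hzX : z ∈ X
      · simp [h2 z hzX]
      · simp [hc z hz hzX]
    have := Finset.card_le_card this
    have := Finset.card_le_two (a := x) (b := y)
    omega

theorem BrickOn.nb {G : SimpleGraph V} {W : Finset V} (h : BrickOn G W) {x a b} (hx : x ∈ W) (ha : a ∈ W) (hb : b ∈ W)
    (hxa : x ≠ a) (hxb : x ≠ b) : ∃ y, G.Adj x y ∧ y ∈ W ∧ y ≠ a ∧ y ≠ b := by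
  obtain ⟨p, hp, q, hq, hpq⟩ := h.conn a ha b hb {x} (by simp [hx, hxa, hxb]) (by simp) (by
    intro e
    have h1 := Finset.card_sdiff_add_card_eq_card (s := {a, b}) (t := W) (by
      intro z hz; simp at hz; rcases hz with rfl | rfl <;> assumption)
    rw [← e] at h1
    have := Finset.card_le_two (a := a) (b := b)
    have := h.four
    simp at h1; omega)
  simp at hp hq
  subst hp
  exact ⟨q, hpq, hq.1.1, hq.1.2.1, hq.1.2.2⟩

/-- two vertices `u v`, cut `a b` -/
theorem BrickOn.nb2 {G : SimpleGraph V} {W : Finset V} (h : BrickOn G W) (h5 : 5 ≤ W.card) {u v a b} (hu : u ∈ W) (hv : v ∈ W) (ha : a ∈ W) (hb : b ∈ W)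
    (hua : u ≠ a) (hub : u ≠ b) (hva : v ≠ a) (hvb : v ≠ b) : ∃ y, (G.Adj u y ∨ G.Adj v y) ∧ y ∈ W ∧ y ≠ a ∧ y ≠ b ∧ y ≠ u ∧ y ≠ v := by
  obtain ⟨p, hp, q, hq, hpq⟩ := h.conn a ha b hb {u, v} (by
      intro z hz; simp at hz; rcases hz with rfl | rfl <;> simp [*]) (by simp) (by
    intro e
    have h1 := Finset.card_sdiff_add_card_eq_card (s := {a, b}) (t := W) (by
      intro z hz; simp at hz; rcases hz with rfl | rfl <;> assumption)
    rw [← e] at h1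
    have := Finset.card_le_two (a := a) (b := b)
    have := Finset.card_le_two (a := u) (b := v)
    omega)
  simp at hp hq
  refine ⟨q, by rcases hp with rfl | rfl <;> tauto, by tauto⟩

structure Loc (G : SimpleGraph V) (W : Finset V) (φ : ℕ → V) (I : List ℕ) (L : List (ℕ × ℕ)) : Prop where
  ok : Ok φ I
  mem : ∀ i ∈ I, φ i ∈ W
  out : HasPM G (W \ im φ I)
  emb : ∀ i j, elB L i j = true → G.Adj (φ i) (φ j)

namespace Loc
variable {G : SimpleGraph V} {W : Finset V} {φ : ℕ → V} {I : List ℕ} {L : List (ℕ × ℕ)}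

theorem list (h : Loc G W φ I L) {L' : List (ℕ × ℕ)} (hc : (L'.all fun e => elB L e.1 e.2) = true) :
    ∀ e ∈ L', G.Adj (φ e.1) (φ e.2) := by
  simp only [List.all_eq_true] at hc
  exact fun e he => h.emb _ _ (hc e he)

theorem sub (h : Loc G W φ I L) (L' : List (ℕ × ℕ)) (hc : (L'.all fun e => elB L e.1 e.2) = true) : Loc G W φ I L' := by
  refine ⟨h.ok, h.mem, h.out, fun i j hij => ?_⟩
  simp [elB] at hij
  rcases hij with e | e
  · exact h.list hc _ e
  · exact (h.list hc _ e).symm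

theorem cons (h : Loc G W φ I L) {a b : ℕ} (hab : G.Adj (φ a) (φ b)) : Loc G W φ I ((a, b) :: L) := by
  refine ⟨h.ok, h.mem, h.out, fun i j hij => ?_⟩
  simp [elB] at hij
  rcases hij with (⟨rfl, rfl⟩ | e) | (⟨rfl, rfl⟩ | e)
  · exact hab
  · exact h.emb _ _ (by simp [elB, e])
  · exact hab.symm
  · exact h.emb _ _ (by simp [elB, e])

theorem drop (h : Loc G W φ I L) (i j : ℕ) (J : List ℕ) (hp : (decide (I.Perm (i :: j :: J) ∧ I.Nodup) && elB L i j) = true) :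
    Loc G W φ J L := by
  simp only [Bool.and_eq_true, decide_eq_true_eq] at hp
  have hs : J ⊆ I := fun a ha => hp.1.1.mem_iff.2 (by simp [ha])
  exact ⟨h.ok.sub hs, fun i hi => h.mem i (hs hi), out_add J i j h.out h.ok h.mem (h.emb _ _ hp.2) hp.1, h.emb⟩

theorem relabel (h : Loc G W φ I L) (π : ℕ → ℕ) (J : List ℕ) (L' : List (ℕ × ℕ))
    (hc : (decide ((J.map π).Perm I ∧ (J.map π).Nodup) && L'.all fun e => elB L (π e.1) (π e.2)) = true) :
    Loc G W (fun i => φ (π i)) J L' := by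
  simp only [Bool.and_eq_true, decide_eq_true_eq, List.all_eq_true] at hc
  obtain ⟨⟨h1, h2⟩, h3⟩ := hc
  have hm : ∀ i ∈ J, π i ∈ I := fun i hi => h1.mem_iff.1 (List.mem_map_of_mem hi)
  refine ⟨fun i hi j hj e => List.inj_on_of_nodup_map h2 hi hj (h.ok _ (hm i hi) _ (hm j hj) e), fun i hi => h.mem _ (hm i hi), ?_, ?_⟩
  · have := out_perm h.out h1.symm
    convert this using 2
    ext z; simp [im]
  · intro i j hij
    simp [elB] at hij
    rcases hij with e | e
    · exact h.emb _ _ (h3 _ e)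
    · exact (h.emb _ _ (h3 _ e)).symm

theorem good (h : Loc G W φ I L) (s : ℕ) (J : List ℕ) (L' : List (ℕ × ℕ)) (Q : List ℕ)
    (hp : (decide (I.Perm J) && (L'.all fun e => elB L e.1 e.2) && 
      (certB L' J Q && decide (Q.Nodup ∧ J.Nodup ∧ 4 ≤ J.length ∧ 2 * s + 8 + 2 * L'.length ≤ 3 * J.length + 2 * Q.length))) = true) :
    Good G W s := by
  rw [Bool.and_eq_true, Bool.and_eq_true] at hp
  simp only [decide_eq_true_eq] at hp
  have hs : ∀ i, i ∈ J → i ∈ I := fun i hi => hp.1.1.mem_iff.2 hi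
  exact good_cert s J L' Q (h.ok.sub hs) (fun i hi => h.mem i (hs i hi)) (out_perm h.out hp.1.1) (h.list hp.1.2) hp.2

theorem ne (h : Loc G W φ I L) {i j} (hi : i ∈ I) (hj : j ∈ I) (hij : i ≠ j) : φ i ≠ φ j := fun e => hij (h.ok i hi j hj e)

/-- extend by a matched outside pair -/
theorem ext (h : Loc G W φ I L) {M0 : V → V} (hM : IsPM G (W \ im φ I) M0) {v : V} (hv : v ∈ W) (hvI : v ∉ im φ I) {a b : ℕ} (ha : a ∉ I) (hb : b ∉ I)
    (hab : a ≠ b) (hL : (L.all fun e => I.contains e.1 && I.contains e.2) = true) :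
    Loc G W (Function.update (Function.update φ a v) b (M0 v)) (a :: b :: I) ((a, b) :: L) := by
  have hm := hM v (by simp only [Finset.mem_sdiff]; exact ⟨hv, hvI⟩)
  have hm1 := hm.1
  simp only [Finset.mem_sdiff] at hm1
  have hneq := hm.2.2.ne
  set ψ := Function.update (Function.update φ a v) b (M0 v) with hψ
  have ea : ψ a = v := by simp [hψ, hab]
  have eb : ψ b = M0 v := by simp [hψ]
  have eI : ∀ i ∈ I, ψ i = φ i := by
    intro i hi
    have : i ≠ a := fun e => ha (e ▸ hi)
    have : i ≠ b := fun e => hb (e ▸ hi)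
    simp [hψ, *]
  have himg : im ψ I = im φ I := by
    ext z; simp only [im, Finset.mem_image, List.mem_toFinset]
    constructor
    · rintro ⟨i, hi, rfl⟩; exact ⟨i, hi, (eI i hi).symm⟩
    · rintro ⟨i, hi, rfl⟩; exact ⟨i, hi, eI i hi⟩
  have hn1 : ∀ i ∈ I, φ i ≠ v := fun i hi e => hvI (by simp only [im, Finset.mem_image, List.mem_toFinset]; exact ⟨i, hi, e⟩)
  have hn2 : ∀ i ∈ I, φ i ≠ M0 v := fun i hi e => hm1.2 (by simp only [im, Finset.mem_image, List.mem_toFinset]; exact ⟨i, hi, e⟩)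
  refine ⟨?_, ?_, ?_, ?_⟩
  · intro i hi j hj
    simp only [List.mem_cons] at hi hj
    rcases hi with rfl | rfl | hi <;> rcases hj with rfl | rfl | hj
    · simp
    · rw [ea, eb]; exact fun e => absurd e hneq
    · rw [ea, eI j hj]; exact fun e => absurd e.symm (hn1 j hj)
    · rw [ea, eb]; exact fun e => absurd e.symm hneq
    · simp
    · rw [eb, eI j hj]; exact fun e => absurd e.symm (hn2 j hj)
    · rw [ea, eI i hi]; exact fun e => absurd e (hn1 i hi)
    · rw [eb, eI i hi]; exact fun e => absurd e (hn2 i hi)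
    · rw [eI i hi, eI j hj]; exact h.ok i hi j hj
  · intro i hi
    simp only [List.mem_cons] at hi
    rcases hi with rfl | rfl | hi
    · rw [ea]; exact hv
    · rw [eb]; exact hm1.1
    · rw [eI i hi]; exact h.mem i hi
  · refine ⟨M0, ?_⟩
    have := hM.sdiff_edge (x := v) (by simp only [Finset.mem_sdiff]; exact ⟨hv, hvI⟩)
    convert this using 1
    have : im ψ (a :: b :: I) = {v, M0 v} ∪ im φ I := by
      rw [← himg]; ext z; simp only [im, List.toFinset_cons, Finset.image_insert, ea, eb]; simp
    rw [this]; ext z; simp only [Finset.mem_sdiff, Finset.mem_union]; tauto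
  · simp only [List.all_eq_true, Bool.and_eq_true, List.contains_iff_mem] at hL
    intro i j hij
    simp [elB] at hij
    rcases hij with (⟨rfl, rfl⟩ | e) | (⟨rfl, rfl⟩ | e)
    · rw [ea, eb]; exact hm.2.2
    · rw [eI _ (hL _ e).1, eI _ (hL _ e).2]; exact h.emb _ _ (by simp [elB, e])
    · rw [ea, eb]; exact hm.2.2.symm
    · rw [eI _ (hL _ e).1, eI _ (hL _ e).2]; exact h.emb _ _ (by simp [elB, e])

end Loc

abbrev I8 : List ℕ := [0, 1, 2, 3, 4, 5, 6, 7]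
abbrev C8 : List (ℕ × ℕ) := [(0, 1), (1, 2), (2, 3), (3, 4), (4, 5), (5, 6), (6, 7), (7, 0)]
abbrev I10 : List ℕ := [8, 9, 0, 1, 2, 3, 4, 5, 6, 7]
abbrev Th : List (ℕ × ℕ) := [(3, 9), (0, 8), (8, 9), (0, 1), (1, 2), (2, 3), (3, 4), (4, 5), (5, 6), (6, 7), (7, 0)]

theorem mem_im {φ : ℕ → V} {I : List ℕ} {z : V} : z ∈ im φ I ↔ ∃ i ∈ I, φ i = z := by simp [im]

variable {G : SimpleGraph V} {W : Finset V} {φ : ℕ → V}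

theorem theta1 (hG : BrickOn G W) (h : Loc G W φ I10 Th) {y} (hy : G.Adj (φ 1) y) (h0 : y ≠ φ 0) (h2 : y ≠ φ 2) (h3 : y ≠ φ 3) :
    Good G W 3 ∨ y = φ 6 := by
  by_cases hyI : y ∈ im φ I10
  · rw [mem_im] at hyI
    obtain ⟨i, hi, rfl⟩ := hyI
    have h1 : i ≠ 1 := by rintro rfl; exact hy.ne rfl
    have h' := h.cons hy
    simp only [I10, List.mem_cons, List.not_mem_nil, or_false] at hi
    rcases hi with rfl | rfl | rfl | rfl | rfl | rfl | rfl | rfl | rfl | rfl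
    · left; exact h'.good 3 [0, 1, 2, 3, 4, 5, 6, 7, 8, 9] ((1, 8) :: Th) [0, 1, 2, 9] (by decide +kernel)
    · left; exact h'.good 3 [0, 8, 9, 1, 2, 3, 4, 5, 6, 7] [(0, 8), (8, 9), (9, 1), (1, 2), (2, 3), (3, 4), (4, 5), (5, 6), (6, 7), (7, 0)] [0, 8] (by decide +kernel)
    · exact absurd rfl h0
    · exact absurd rfl h1
    · exact absurd rfl h2
    · exact absurd rfl h3
    · left; exact h'.good 3 [0, 8, 9, 3, 2, 1, 4, 5, 6, 7] [(0, 8), (8, 9), (9, 3), (3, 2), (2, 1), (1, 4), (4, 5), (5, 6), (6, 7), (7, 0)] [0, 8] (by decide +kernel)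
    · left; exact h'.good 3 [0, 1, 2, 3, 4, 5, 6, 7, 8, 9] ((1, 5) :: Th) [0, 1, 2, 4] (by decide +kernel)
    · right; rfl
    · left; exact h'.good 3 [0, 1, 2, 3, 4, 5, 6, 7, 8, 9] ((1, 7) :: Th) [0, 1, 2, 4] (by decide +kernel)
  · left
    have hd := h.drop 1 2 [0, 8, 9, 3, 4, 5, 6, 7] (by decide +kernel)
    have a12 := h.emb 1 2 (by decide)
    have n1 : ∀ i ∈ I10, i ≠ 1 → φ i ≠ φ 1 := fun i hi => h.ne hi (by decide)
    have n2 : ∀ i ∈ I10, i ≠ 2 → φ i ≠ φ 2 := fun i hi => h.ne hi (by decide)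
    have m1 : φ 1 ∉ im φ [0, 8, 9, 3, 4, 5, 6, 7] := by
      rw [mem_im]; rintro ⟨i, hi, e⟩
      exact n1 i (by clear e; revert i; decide) (by clear e; revert i; decide) e
    have m2 : φ 2 ∉ im φ [0, 8, 9, 3, 4, 5, 6, 7] := by
      rw [mem_im]; rintro ⟨i, hi, e⟩
      exact n2 i (by clear e; revert i; decide) (by clear e; revert i; decide) e
    have ho : HasPM G ((W \ im φ [0, 8, 9, 3, 4, 5, 6, 7]) \ {φ 1, φ 2}) := by
      convert h.out using 1
      ext z; simp [im]; tauto
    obtain ⟨M0, hM, hM1, -⟩ := ho.exists_edge (by simp only [Finset.mem_sdiff]; exact ⟨h.mem 1 (by decide), m1⟩)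
      (by simp only [Finset.mem_sdiff]; exact ⟨h.mem 2 (by decide), m2⟩) a12
    have c := conf_cert (M0 := M0) [0, 8, 9, 3, 4, 5, 6, 7] [(0, 8), (8, 9), (9, 3), (3, 4), (4, 5), (5, 6), (6, 7), (7, 0)] [0, 3]
      hd.ok hd.mem hM (hd.list (by decide)) (by decide) (by decide) (by decide +kernel)
    refine good_XP (s := 2) hG.toBic c ?_ (x := φ 0) (y := φ 3) (v1 := φ 1) (v2 := φ 2) (w := y) ?_ ?_ ?_ ?_ m1 hM1 (h.emb _ _ (by decide)) (h.emb _ _ (by decide)) hy ?_ h2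
    · have e1 := ec_gr φ [(0, 8), (8, 9), (9, 3), (3, 4), (4, 5), (5, 6), (6, 7), (7, 0)]
      have e2 := im_card hd.ok (by decide)
      have e3 := im_card (I := [0, 3]) (hd.ok.sub (by decide)) (by decide)
      simp only [List.length_cons, List.length_nil] at e1 e2 e3
      omega
    · rw [mem_im]; exact ⟨0, by decide, rfl⟩
    · rw [mem_im]; exact ⟨3, by decide, rfl⟩
    · exact c.cl.2 _ (by rw [mem_im]; exact ⟨0, by decide, rfl⟩) _ (by rw [mem_im]; exact ⟨3, by decide, rfl⟩) (h.ne (by decide) (by decide) (by decide))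
    · exact h.ne (by decide) (by decide) (by decide)
    · intro hc
      apply hyI
      rw [mem_im] at hc ⊢
      obtain ⟨i, hi, e⟩ := hc
      exact ⟨i, by clear e; revert i; decide, e⟩

def refl10 (i : ℕ) : ℕ := [3, 2, 1, 0, 7, 6, 5, 4, 9, 8].getD i 0

theorem theta2 (hG : BrickOn G W) (h : Loc G W φ I10 Th) (hy : G.Adj (φ 1) (φ 6)) : Good G W 3 := by
  have h' := h.relabel refl10 I10 Th (by decide +kernel)
  obtain ⟨z, hz, hzW, hz1, hz2⟩ := hG.nb (h.mem 2 (by decide)) (h.mem 1 (by decide)) (h.mem 3 (by decide)) (h.ne (by decide) (by decide) (by decide))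
    (h.ne (by decide) (by decide) (by decide))
  by_cases h0 : z = φ 0
  · subst h0
    exact ((h.cons hy).cons hz).good 3 [0, 8, 9, 3, 2, 1, 4, 5, 6, 7] ([(1, 6), (0, 2), (3, 9), (0, 8), (8, 9), (1, 2), (2, 3), (3, 4), (4, 5), (5, 6), (6, 7), (7, 0)]) [0, 1, 3, 7] (by decide +kernel)
  · rcases theta1 hG h' (y := z) hz hz2 hz1 h0 with h1 | rfl
    · exact h1
    · exact ((h.cons hy).cons hz).good 3 [0, 7, 6, 1, 2, 5, 4, 3, 9, 8] [(0, 7), (7, 6), (6, 1), (1, 2), (2, 5), (5, 4), (4, 3), (3, 9), (9, 8), (8, 0)] [0, 7] (by decide +kernel)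

theorem theta3 (hG : BrickOn G W) (h : Loc G W φ I10 Th) : Good G W 3 := by
  have h' := h.relabel refl10 I10 Th (by decide +kernel)
  have h5 : 5 ≤ W.card := by
    have e2 := im_card h.ok (by decide)
    have : im φ I10 ⊆ W := by intro z hz; rw [mem_im] at hz; obtain ⟨i, hi, rfl⟩ := hz; exact h.mem i hi
    have := Finset.card_le_card this
    simp only [List.length_cons, List.length_nil] at e2; omega
  obtain ⟨y, hy, hyW, y0, y3, y1, y2⟩ := hG.nb2 h5 (h.mem 1 (by decide)) (h.mem 2 (by decide)) (h.mem 0 (by decide)) (h.mem 3 (by decide))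
     (h.ne (by decide) (by decide) (by decide)) (h.ne (by decide) (by decide) (by decide)) (h.ne (by decide) (by decide) (by decide)) (h.ne (by decide) (by decide) (by decide))
  rcases hy with hy | hy
  · rcases theta1 hG h hy y0 y2 y3 with h1 | rfl
    · exact h1
    · exact theta2 hG h hy
  · rcases theta1 hG h' (y := y) hy y3 y1 y0 with h1 | rfl
    · exact h1
    · exact theta2 hG h' hy

end Theta

section Cyc
variable {V : Type*} [Fintype V] [DecidableEq V] {G : SimpleGraph V} {W : Finset V} {φ : ℕ → V}

def pi (l : List ℕ) (i : ℕ) : ℕ := l.getD i 0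

theorem Loc.card (h : Loc G W φ I L) (hn : I.Nodup) : I.length ≤ W.card := by
  rw [← im_card h.ok hn]
  apply Finset.card_le_card
  intro z hz; rw [mem_im] at hz; obtain ⟨i, hi, rfl⟩ := hz; exact h.mem i hi

theorem Loc.leave (hG : BrickOn G W) (h : Loc G W φ I L) (hc : I.length < W.card) (h0 : I ≠ []) :
    ∃ i ∈ I, ∃ v ∈ W, v ∉ im φ I ∧ G.Adj (φ i) v := by
  obtain ⟨x, hx, y, hy, hxy⟩ := hG.toBic.conn (im φ I) (by
    intro z hz; rw [mem_im] at hz; obtain ⟨i, hi, rfl⟩ := hz; exact h.mem i hi) (by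
    obtain ⟨i, hi⟩ := List.exists_mem_of_ne_nil I h0
    exact ⟨φ i, by rw [mem_im]; exact ⟨i, hi, rfl⟩⟩) (by
    rintro rfl
    have : (im φ I).card ≤ I.length := Finset.card_image_le.trans (List.toFinset_card_le _)
    omega)
  rw [mem_im] at hx
  obtain ⟨i, hi, rfl⟩ := hx
  simp only [Finset.mem_sdiff] at hy
  exact ⟨i, hi, y, hy.1, hy.2, hxy⟩

theorem clB_add {L : List (ℕ × ℕ)} {I Q : List ℕ} (h : Ok φ I) (hL : (L.all fun e => I.contains e.1 && I.contains e.2 && e.1 != e.2) = true)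
    (hn : I.Nodup) {a b : ℕ} (ha : a ∈ I) (hb : b ∈ I) (hab : a ≠ b)
    (hc : clB (elB ((a, b) :: L)) I Q = true) : Cl (gr φ L ⊔ edge (φ a) (φ b)) (im φ I) (im φ Q) := by
  refine clB_sound hn h ?_ hc
  intro i hi j hj e
  have hg := gr_elB h hL i hi j hj
  have hne : φ a ≠ φ b := fun e => hab (h _ ha _ hb e)
  rw [adj_add hne]
  simp [elB] at e hg
  rcases e with (⟨rfl, rfl⟩ | e) | (⟨rfl, rfl⟩ | e) <;> tauto

theorem c8_good (hG : BrickOn G W) (hW : 9 ≤ W.card) (h0 : Loc G W φ I8 C8) : Good G W 3 := by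
  obtain ⟨i, hi, v1, hv1W, hv1, ha⟩ := h0.leave hG (by simp; omega) (by simp)
  have key : ∀ φ : ℕ → V, Loc G W φ I8 C8 → v1 ∉ im φ I8 → G.Adj (φ 0) v1 → Good G W 3 := by
    clear ha hv1 h0 hi
    intro φ h hv1 ha
    obtain ⟨N, hN, hN0, hN1⟩ := hG.toBic.exN ha
    obtain ⟨M0, hM⟩ := h.out
    have c := conf_cert (M0 := M0) I8 C8 [0, 1] h.ok h.mem hM (h.list (by decide)) (by decide) (by decide) (by decide +kernel)
    have e1 := ec_gr φ C8
    have e2 := im_card h.ok (by decide)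
    have e3 := im_card (I := [0, 1]) (h.ok.sub (by decide)) (by decide)
    simp only [List.length_cons, List.length_nil] at e1 e2 e3
    have m0 : φ 0 ∈ im φ I8 := by rw [mem_im]; exact ⟨0, by decide, rfl⟩
    have hb : 2 * 2 + 8 + 2 * ec (gr φ C8) ≤ 3 * (im φ I8).card + 2 * (im φ [0, 1]).card := by omega
    by_cases hy : N (M0 v1) ∈ im φ I8
    · obtain ⟨j, hj, hjy⟩ := mem_im.1 hy
      have hm := hM v1 (by simp only [Finset.mem_sdiff]; exact ⟨hv1W, hv1⟩)
      have hm2W := (Finset.mem_sdiff.1 hm.1).1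
      have aj := (hN (M0 v1) hm2W).2.2
      rw [← hjy] at aj
      have hj0 : j ≠ 0 := by
        rintro rfl
        have := (hN (M0 v1) hm2W).2.1
        rw [← hjy, hN0] at this
        exact hm.2.2.ne this
      have h' := h.ext (a := 8) (b := 9) hM hv1W hv1 (by decide) (by decide) (by decide) (by decide)
      have h'' := h'.cons (a := 0) (b := 8) (by simpa [Function.update] using ha)
      have beta : ∀ Q, Q.Nodup → Q.length = 3 → Q ⊆ I8 → clB (elB ((0, j) :: C8)) I8 Q = true → Good G W 3 := by
        intro Q hQ hl hs hc
        refine good_beta (s := 2) c hb hN (x := φ 0) (y := φ j) m0 hN0 hv1 rfl hjy.symm (hjy ▸ hy) (Q' := im φ Q) ?_ ?_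
        · exact clB_add h.ok (by decide) (by decide) (by decide) hj hj0.symm hc
        · have := im_card (I := Q) (h.ok.sub hs) hQ
          omega
      simp only [I8, List.mem_cons, List.not_mem_nil, or_false] at hj
      rcases hj with rfl | rfl | rfl | rfl | rfl | rfl | rfl | rfl
      · exact absurd rfl hj0
      · exact (h''.cons (a := 9) (b := 1) (by simpa [Function.update] using aj)).good 3 [0, 8, 9, 1, 2, 3, 4, 5, 6, 7] [(0, 8), (8, 9), (9, 1), (1, 2), (2, 3), (3, 4), (4, 5), (5, 6), (6, 7), (7, 0)] [0, 8] (by decide +kernel)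
      · exact beta [0, 1, 3] (by decide) rfl (by decide) (by decide +kernel)
      · exact theta3 hG ((h''.cons (a := 9) (b := 3) (by simpa [Function.update] using aj)).sub Th (by decide +kernel))
      · exact beta [0, 1, 5] (by decide) rfl (by decide) (by decide +kernel)
      · exact theta3 hG ((h''.cons (a := 9) (b := 5) (by simpa [Function.update] using aj)).relabel (pi [0, 7, 6, 5, 4, 3, 2, 1, 8, 9]) I10 Th (by decide +kernel))
      · exact beta [0, 7, 5] (by decide) rfl (by decide) (by decide +kernel)
      · exact (h''.cons (a := 9) (b := 7) (by simpa [Function.update] using aj)).good 3 [0, 8, 9, 7, 6, 5, 4, 3, 2, 1] [(0, 8), (8, 9), (9, 7), (1, 2), (2, 3), (3, 4), (4, 5), (5, 6), (6, 7), (1, 0)] [0, 8] (by decide +kernel)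
    · exact good_alpha (s := 2) c hb hN m0 (by rwa [hN0]) (by rwa [hN0])
  have hck : (decide ((I8.map fun k => (k + i) % 8).Perm I8 ∧ (I8.map fun k => (k + i) % 8).Nodup) && C8.all fun e => elB C8 ((e.1 + i) % 8) ((e.2 + i) % 8)) = true := by
    clear ha; revert i; decide +kernel
  have h1 := h0.relabel (fun k => (k + i) % 8) I8 C8 hck
  have hi8 : (0 + i) % 8 = i := by clear ha h1 hck; revert i; decide
  refine key _ h1 ?_ ?_
  · rw [mem_im] at hv1 ⊢
    rintro ⟨k, hk, e⟩
    refine hv1 ⟨_, ?_, e⟩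
    simp only [Bool.and_eq_true, decide_eq_true_eq] at hck
    exact hck.1.1.mem_iff.1 (List.mem_map_of_mem hk)
  · simpa only [hi8] using ha

/-- union of two perfect matchings -/
theorem orb {M N : V → V} (hM : IsPM G W M) (hN : IsPM G W N) {x} (hx : x ∈ W) :
    ∃ U ⊆ W, x ∈ U ∧ (∀ z ∈ U, M z ∈ U ∧ N z ∈ U) ∧ ∀ s, 2 * s + 4 ≤ U.card → Good G W s := by
  classical
  set U := W.filter (fun z => ∀ Z : Finset V, x ∈ Z → (∀ a ∈ Z, M a ∈ Z ∧ N a ∈ Z) → z ∈ Z) with hU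
  have hUW : U ⊆ W := Finset.filter_subset _ _
  have hxU : x ∈ U := by rw [hU, Finset.mem_filter]; exact ⟨hx, fun Z h _ => h⟩
  have hcl : ∀ z ∈ U, M z ∈ U ∧ N z ∈ U := by
    intro z hz
    rw [hU, Finset.mem_filter] at hz ⊢
    rw [Finset.mem_filter]
    exact ⟨⟨(hM z hz.1).1, fun Z h1 h2 => (h2 _ (hz.2 Z h1 h2)).1⟩, ⟨(hN z hz.1).1, fun Z h1 h2 => (h2 _ (hz.2 Z h1 h2)).2⟩⟩
  have hmin : ∀ Z : Finset V, x ∈ Z → (∀ a ∈ Z, M a ∈ Z ∧ N a ∈ Z) → U ⊆ Z := by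
    intro Z h1 h2 z hz
    rw [hU, Finset.mem_filter] at hz
    exact hz.2 Z h1 h2
  refine ⟨U, hUW, hxU, hcl, fun s hs => ?_⟩
  clear_value U
  let H : SimpleGraph V :=
    { Adj := fun a b => a ∈ U ∧ b ∈ U ∧ (b = M a ∨ b = N a)
      symm := ⟨by
        rintro a b ⟨ha, hb, rfl | rfl⟩
        · exact ⟨hb, ha, Or.inl (hM a (hUW ha)).2.1.symm⟩
        · exact ⟨hb, ha, Or.inr (hN a (hUW ha)).2.1.symm⟩⟩
      loopless := ⟨by
        rintro a ⟨ha, hb, h | h⟩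
        · exact hM.ne (hUW ha) h.symm
        · exact hN.ne (hUW ha) h.symm⟩ }
  have hHM : IsPM H U M := fun z hz => ⟨(hcl z hz).1, (hM z (hUW hz)).2.1, hz, (hcl z hz).1, Or.inl rfl⟩
  have hHN : IsPM H U N := fun z hz => ⟨(hcl z hz).2, (hN z (hUW hz)).2.1, hz, (hcl z hz).2, Or.inr rfl⟩
  have hec : ec H ≤ U.card := by
    have h1 := H.sum_degrees_eq_twice_card_edges
    have h2 : ec H = H.edgeFinset.card := by
      unfold ec; rw [Set.ncard_eq_toFinset_card']; rfl
    have h3 : ∑ v, H.degree v ≤ ∑ v, if v ∈ U then 2 else 0 := by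
      apply Finset.sum_le_sum
      intro v _
      by_cases hv : v ∈ U
      · rw [if_pos hv, ← card_neighborFinset_eq_degree]
        refine (Finset.card_le_card (t := {M v, N v}) ?_).trans Finset.card_le_two
        intro w hw
        rw [mem_neighborFinset] at hw
        simp; exact hw.2.2
      · rw [if_neg hv, Nat.le_zero, ← card_neighborFinset_eq_degree, Finset.card_eq_zero]
        ext w; simp; rintro ⟨h, _⟩; exact hv h
    rw [← Finset.sum_filter] at h3
    simp at h3
    omega
  have hsub : ∀ a b, H.Adj a b → a ∈ U := fun a b h => h.1
  have helem : Elem H U := by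
    refine ⟨hsub, ⟨M, hHM⟩, fun X hX hne hnU => ?_⟩
    by_contra hc
    have hXc : ∀ a ∈ X, M a ∈ X ∧ N a ∈ X := by
      intro a ha
      constructor
      · by_contra h
        exact hc ⟨a, ha, M a, by simp [h, hcl a (hX ha)], (hHM a (hX ha)).2.2, M, hHM.sdiff_edge (hX ha)⟩
      · by_contra h
        exact hc ⟨a, ha, N a, by simp [h, hcl a (hX ha)], (hHN a (hX ha)).2.2, N, hHN.sdiff_edge (hX ha)⟩
    by_cases hxX : x ∈ X
    · exact hnU (Finset.Subset.antisymm hX (hmin X hxX hXc))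
    · have : U ⊆ U \ X := hmin _ (by simp [hxU, hxX]) (by
        intro a ha
        simp at ha ⊢
        refine ⟨⟨(hcl a ha.1).1, fun h => ha.2 ?_⟩, ⟨(hcl a ha.1).2, fun h => ha.2 ?_⟩⟩
        · rw [← (hM a (hUW ha.1)).2.1]; exact (hXc _ h).1
        · rw [← (hN a (hUW ha.1)).2.1]; exact (hXc _ h).2)
      obtain ⟨z, hz⟩ := hne
      have := this (hX hz)
      simp [hz] at this
  refine ⟨U, H, {x, M x}, M, ⟨hUW, by omega, hM.sdiff (fun z hz => hUW hz) (fun z hz => (hcl z hz).1), ?_, helem, ?_, ?_⟩, ?_⟩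
  · rintro a b ⟨ha, _, rfl | rfl⟩
    · exact (hM a (hUW ha)).2.2
    · exact (hN a (hUW ha)).2.2
  · intro z hz; simp at hz; rcases hz with rfl | rfl
    · exact hxU
    · exact (hcl x hxU).1
  · have := hHM.sdiff_edge hxU
    intro u hu v hv hne
    simp at hu hv
    rcases hu with rfl | rfl <;> rcases hv with rfl | rfl
    · exact absurd rfl hne
    · exact ⟨M, this⟩
    · exact ⟨M, by rwa [Finset.pair_comm]⟩
    · exact absurd rfl hne
  · rw [Finset.card_pair (hM.ne hx).symm]
    omega

end Cyc

section C8ex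
variable {V : Type*} [Fintype V] [DecidableEq V] {G : SimpleGraph V} {W : Finset V} {φ : ℕ → V}

abbrev I6 : List ℕ := [0, 1, 2, 3, 4, 5]
abbrev C6 : List (ℕ × ℕ) := [(0, 1), (1, 2), (2, 3), (3, 4), (4, 5), (5, 0)]

theorem mkLoc (M : V → V) (hM : IsPM G W M) (l : List V) (d : V) (I : List ℕ) (L : List (ℕ × ℕ)) (hI : I = List.range l.length)
    (hn : l.Nodup) (hW : ∀ z ∈ l, z ∈ W) (hcl : ∀ z ∈ l, M z ∈ l)
    (hL : ∀ e ∈ L, G.Adj (l.getD e.1 d) (l.getD e.2 d)) : Loc G W (fun i => l.getD i d) I L := by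
  subst hI
  have him : im (fun i => l.getD i d) (List.range l.length) = l.toFinset := by
    ext z
    rw [mem_im, List.mem_toFinset, List.mem_iff_getElem]
    simp only [List.mem_range]
    constructor
    · rintro ⟨i, hi, rfl⟩; exact ⟨i, hi, by simp [hi]⟩
    · rintro ⟨i, hi, rfl⟩; exact ⟨i, hi, by simp [hi]⟩
  refine ⟨?_, ?_, ?_, ?_⟩
  · intro i hi j hj e
    simp at hi hj
    simp [hi, hj] at e
    exact (hn.getElem_inj_iff).1 e
  · intro i hi
    simp at hi
    simp [hi]
    exact hW _ (List.getElem_mem _)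
  · rw [him]
    exact ⟨M, hM.sdiff (by simpa using hW) (by simpa using hcl)⟩
  · intro i j h
    simp [elB] at h
    rcases h with h | h
    · exact hL _ h
    · exact (hL _ h).symm

theorem long {M N : V → V} (hM : IsPM G W M) (hN : IsPM G W N) {x} (hx : x ∈ W) (hne : N x ≠ M x)
    (hno : 10 ≤ W.card → ¬ Good G W 3) (hno8 : ∀ φ : ℕ → V, ¬ Loc G W φ I8 C8) :
    N (M (N x)) = M x ∨ (N (M (N x)) ≠ M x ∧ N (M (N (M (N x)))) = M x) := by
  by_contra hc
  push Not at hc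
  obtain ⟨h3, h5⟩ := hc
  replace h5 := h5 h3
  obtain ⟨U, hUW, hxU, hcl, hgood⟩ := orb hM hN hx
  obtain ⟨a1, e1⟩ : ∃ a, a = N x := ⟨_, rfl⟩
  obtain ⟨a2, e2⟩ : ∃ a, a = M a1 := ⟨_, rfl⟩
  obtain ⟨a3, e3⟩ : ∃ a, a = N a2 := ⟨_, rfl⟩
  obtain ⟨a4, e4⟩ : ∃ a, a = M a3 := ⟨_, rfl⟩
  obtain ⟨a5, e5⟩ : ∃ a, a = N a4 := ⟨_, rfl⟩
  obtain ⟨a6, e6⟩ : ∃ a, a = M a5 := ⟨_, rfl⟩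
  obtain ⟨a7, e7⟩ : ∃ a, a = N a6 := ⟨_, rfl⟩
  obtain ⟨a8, e8⟩ : ∃ a, a = M a7 := ⟨_, rfl⟩
  obtain ⟨a9, e9⟩ : ∃ a, a = M x := ⟨_, rfl⟩
  rw [← e1, ← e2, ← e3, ← e9] at h3
  rw [← e1, ← e2, ← e3, ← e4, ← e5, ← e9] at h5
  rw [← e1, ← e9] at hne
  have u1 : a1 ∈ U := e1 ▸ (hcl _ hxU).2
  have u2 : a2 ∈ U := e2 ▸ (hcl _ u1).1
  have u3 : a3 ∈ U := e3 ▸ (hcl _ u2).2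
  have u4 : a4 ∈ U := e4 ▸ (hcl _ u3).1
  have u5 : a5 ∈ U := e5 ▸ (hcl _ u4).2
  have u6 : a6 ∈ U := e6 ▸ (hcl _ u5).1
  have u7 : a7 ∈ U := e7 ▸ (hcl _ u6).2
  have u8 : a8 ∈ U := e8 ▸ (hcl _ u7).1
  have u9 : a9 ∈ U := e9 ▸ (hcl _ hxU).1
  have m0 := hM x hx
  have n0 := hN x hx
  have m1 := hM _ (hUW u1)
  have n2 := hN _ (hUW u2)
  have m3 := hM _ (hUW u3)
  have n4 := hN _ (hUW u4)
  have m5 := hM _ (hUW u5)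
  have n6 := hN _ (hUW u6)
  have m7 := hM _ (hUW u7)
  rw [← e9] at m0
  rw [← e1] at n0
  rw [← e2] at m1
  rw [← e3] at n2
  rw [← e4] at m3
  rw [← e5] at n4
  rw [← e6] at m5
  rw [← e7] at n6
  rw [← e8] at m7
  have k0 := m0.2.2.ne
  have k1 := n0.2.2.ne
  have k2 := m1.2.2.ne
  have k3 := n2.2.2.ne
  have k4 := m3.2.2.ne
  have k5 := n4.2.2.ne
  have k6 := m5.2.2.ne
  have k7 := n6.2.2.ne
  have k8 := m7.2.2.ne
  have f0 := m0.2.1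
  have f1 := n0.2.1
  have f2 := m1.2.1
  have f3 := n2.2.1
  have f4 := m3.2.1
  have f5 := n4.2.1
  have f6 := m5.2.1
  have f7 := n6.2.1
  have f8 := m7.2.1
  by_cases h7 : a7 = a9
  · refine hno8 _ (mkLoc M hM [x, a1, a2, a3, a4, a5, a6, a7] x I8 C8 rfl ?_ ?_ ?_ ?_)
    · clear * - e1 e2 e3 e4 e5 e6 e7 e8 e9 k0 k1 k2 k3 k4 k5 k6 k7 k8 f0 f1 f2 f3 f4 f5 f6 f7 f8 h7 h5 h3 hne
      simp only [List.nodup_cons, List.mem_cons, List.not_mem_nil, or_false, not_or, List.nodup_nil, and_true, not_false_eq_true]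
      refine ⟨⟨?_, ?_, ?_, ?_, ?_, ?_, ?_⟩, ⟨?_, ?_, ?_, ?_, ?_, ?_⟩, ⟨?_, ?_, ?_, ?_, ?_⟩, ⟨?_, ?_, ?_, ?_⟩, ⟨?_, ?_, ?_⟩, ⟨?_, ?_⟩, ?_⟩ <;> (intro h; grind)
    · simp [hx, hUW u1, hUW u2, hUW u3, hUW u4, hUW u5, hUW u6, hUW u7]
    · simp only [List.mem_cons, List.not_mem_nil, or_false]
      rintro z (rfl | rfl | rfl | rfl | rfl | rfl | rfl | rfl) <;> grind
    · simp
      exact ⟨n0.2.2, m1.2.2, n2.2.2, m3.2.2, n4.2.2, m5.2.2, n6.2.2, by rw [h7]; exact m0.2.2.symm⟩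
  · suffices h10 : 2 * 3 + 4 ≤ U.card from hno (h10.trans (Finset.card_le_card hUW)) (hgood 3 h10)
    have hnd : [x, a1, a2, a3, a4, a5, a6, a7, a8, a9].Nodup := by
      clear * - e1 e2 e3 e4 e5 e6 e7 e8 e9 k0 k1 k2 k3 k4 k5 k6 k7 k8 f0 f1 f2 f3 f4 f5 f6 f7 f8 h7 h5 h3 hne
      simp only [List.nodup_cons, List.mem_cons, List.not_mem_nil, or_false, not_or, List.nodup_nil, and_true, not_false_eq_true]
      refine ⟨⟨?_, ?_, ?_, ?_, ?_, ?_, ?_, ?_, ?_⟩, ⟨?_, ?_, ?_, ?_, ?_, ?_, ?_, ?_⟩, ⟨?_, ?_, ?_, ?_, ?_, ?_, ?_⟩, ⟨?_, ?_, ?_, ?_, ?_, ?_⟩, ⟨?_, ?_, ?_, ?_, ?_⟩, ⟨?_, ?_, ?_, ?_⟩, ⟨?_, ?_, ?_⟩, ⟨?_, ?_⟩, ?_⟩ <;> (intro h; grind)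
    have := List.toFinset_card_of_nodup hnd
    rw [show 2 * 3 + 4 = [x, a1, a2, a3, a4, a5, a6, a7, a8, a9].length from rfl, ← this]
    apply Finset.card_le_card
    intro z hz
    simp at hz
    rcases hz with rfl | rfl | rfl | rfl | rfl | rfl | rfl | rfl | rfl | rfl <;> assumption

/-- a 6-cycle from two matchings -/
theorem mk6 {M N : V → V} (hM : IsPM G W M) (hN : IsPM G W N) {x} (hx : x ∈ W) (hne : N x ≠ M x)
    (h3 : N (M (N x)) ≠ M x) (h5 : N (M (N (M (N x)))) = M x) : ∃ φ, Loc G W φ I6 C6 := by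
  obtain ⟨a1, e1⟩ : ∃ a, a = N x := ⟨_, rfl⟩
  obtain ⟨a2, e2⟩ : ∃ a, a = M a1 := ⟨_, rfl⟩
  obtain ⟨a3, e3⟩ : ∃ a, a = N a2 := ⟨_, rfl⟩
  obtain ⟨a4, e4⟩ : ∃ a, a = M a3 := ⟨_, rfl⟩
  obtain ⟨a5, e5⟩ : ∃ a, a = N a4 := ⟨_, rfl⟩
  rw [← e1, ← e2, ← e3] at h3
  rw [← e1, ← e2, ← e3, ← e4, ← e5] at h5
  rw [← e1] at hne
  have m0 := hM x hx
  have n0 := hN x hx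
  rw [← h5] at m0 h3 hne
  rw [← e1] at n0
  have m1 := hM _ n0.1
  rw [← e2] at m1
  have n2 := hN _ m1.1
  rw [← e3] at n2
  have m3 := hM _ n2.1
  rw [← e4] at m3
  have n4 := hN _ m3.1
  rw [← e5] at n4
  have k0 := m0.2.2.ne
  have k1 := n0.2.2.ne
  have k2 := m1.2.2.ne
  have k3 := n2.2.2.ne
  have k4 := m3.2.2.ne
  have k5 := n4.2.2.ne
  have f0 := m0.2.1
  have f1 := n0.2.1
  have f2 := m1.2.1
  have f3 := n2.2.1
  have f4 := m3.2.1
  have f5 := n4.2.1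
  refine ⟨_, mkLoc M hM [x, a1, a2, a3, a4, a5] x I6 C6 rfl ?_ ?_ ?_ ?_⟩
  · clear * - e1 e2 e3 e4 e5 k0 k1 k2 k3 k4 k5 f0 f1 f2 f3 f4 f5 h5 h3 hne
    simp only [List.nodup_cons, List.mem_cons, List.not_mem_nil, or_false, not_or, List.nodup_nil, and_true, not_false_eq_true]
    refine ⟨⟨?_, ?_, ?_, ?_, ?_⟩, ⟨?_, ?_, ?_, ?_⟩, ⟨?_, ?_, ?_⟩, ⟨?_, ?_⟩, ?_⟩ <;> (intro h; grind)
  · simp [hx, n0.1, m1.1, n2.1, m3.1, n4.1]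
  · simp only [List.mem_cons, List.not_mem_nil, or_false]
    rintro z (rfl | rfl | rfl | rfl | rfl | rfl) <;> grind
  · simp
    exact ⟨n0.2.2, m1.2.2, n2.2.2, m3.2.2, n4.2.2, m0.2.2.symm⟩

theorem ex6 (hG : BrickOn G W) (hW : 5 ≤ W.card) (hl : ∀ M N : V → V, IsPM G W M → IsPM G W N → ∀ x ∈ W, N x ≠ M x →
    N (M (N x)) = M x ∨ (N (M (N x)) ≠ M x ∧ N (M (N (M (N x)))) = M x)) : ∃ φ, Loc G W φ I6 C6 := by
  obtain ⟨x, hx⟩ : W.Nonempty := by rw [← Finset.card_pos]; omega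
  obtain ⟨b, hb, hbx⟩ : ∃ b ∈ W, b ≠ x := Finset.exists_mem_ne (by omega) x
  obtain ⟨y, hxy, -⟩ := hG.nb hx hb hb hbx.symm hbx.symm
  obtain ⟨M, hM, hMx, hMy⟩ := hG.toBic.exN hxy
  have hy := hG.sub _ _ hxy.symm
  obtain ⟨v1, hxv, hv1W, hv1, -⟩ := hG.nb hx hy hy hxy.ne hxy.ne
  obtain ⟨N, hN, hNx, hNv⟩ := hG.toBic.exN hxv
  rcases hl M N hM hN x hx (by rw [hNx, hMx]; exact hv1) with h | ⟨h, h'⟩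
  swap
  · exact mk6 hM hN hx (by rw [hNx, hMx]; exact hv1) h h'
  rw [hNx, hMx] at h
  have hv := hM v1 hv1W
  have hv2 := hN _ hv.1
  rw [h] at hv2
  have n1 : v1 ≠ x := hxv.ne.symm
  have n2 : M v1 ≠ x := fun e => hv1 (by rw [← hv.2.1, e, hMx])
  have n3 : M v1 ≠ y := hv2.2.2.ne
  have main : ∀ x y v1 : V, M x = y → M y = x → x ∈ W → v1 ∈ W → G.Adj x v1 → G.Adj (M v1) y → v1 ≠ y →
      ∀ w, G.Adj v1 w → w ∈ W → w ≠ x → w ≠ y → w ≠ v1 → w ≠ M v1 → ∃ φ, Loc G W φ I6 C6 := by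
    clear * - hl hM hG
    intro x y v1 hMx hMy hx hv1W hxv hvy hne w hw hwW w1 w2 w3 w4
    obtain ⟨N, hN, hNv, hNw⟩ := hG.toBic.exN hw
    rcases hl M N hM hN v1 hv1W (by rw [hNv]; exact w4) with h | ⟨h, h'⟩
    swap
    · exact mk6 hM hN hv1W (by rw [hNv]; exact w4) h h'
    rw [hNv] at h
    have a1 := hM x hx
    have a2 := hM v1 hv1W
    have a3 := hM w hwW
    have a4 := hN _ a3.1
    rw [h] at a4
    rw [hMx] at a1
    have k1 := a1.2.2.ne
    have k2 := a2.2.2.ne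
    have k3 := a3.2.2.ne
    have k4 := hxv.ne
    have k5 := hvy.ne
    have f1 := a1.2.1
    have f2 := a2.2.1
    have f3 := a3.2.1
    refine ⟨_, mkLoc M hM [x, y, M v1, M w, w, v1] x I6 C6 rfl ?_ ?_ ?_ ?_⟩
    · clear * - k1 k2 k3 k4 k5 f1 f2 f3 w1 w2 w3 w4 hMx hMy hne
      simp only [List.nodup_cons, List.mem_cons, List.not_mem_nil, or_false, not_or, List.nodup_nil, and_true, not_false_eq_true]
      refine ⟨⟨?_, ?_, ?_, ?_, ?_⟩, ⟨?_, ?_, ?_, ?_⟩, ⟨?_, ?_, ?_⟩, ⟨?_, ?_⟩, ?_⟩ <;> (intro h; grind)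
    · simp [hx, a1.1, a2.1, a3.1, hwW, hv1W]
    · simp only [List.mem_cons, List.not_mem_nil, or_false]
      rintro z (rfl | rfl | rfl | rfl | rfl | rfl) <;> grind
    · simp
      exact ⟨a1.2.2, hvy.symm, a4.2.2.symm, a3.2.2.symm, hw.symm, hxv.symm⟩
  obtain ⟨w, hw, hwW, w1, w2, w3, w4⟩ := hG.nb2 hW hv1W hv.1 hx hy n1 hv1 n2 n3
  rcases hw with hw | hw
  · exact main x y v1 hMx hMy hx hv1W hxv hv2.2.2 hv1 w hw hwW w1 w2 w3 w4
  · exact main y x (M v1) hMy hMx hy hv.1 hv2.2.2.symm (by rw [hv.2.1]; exact hxv.symm) n2 w hw hwW w2 w1 w4 (by rw [hv.2.1]; exact w3)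

end C8ex

section C8ex2
variable {V : Type*} [Fintype V] [DecidableEq V] {G : SimpleGraph V} {W : Finset V} {φ : ℕ → V}

/-- extend an outside matching by alternate edges of the 6-cycle -/
theorem pm6 (h : Loc G W φ I6 C6) {M0 : V → V} (hM : IsPM G (W \ im φ I6) M0) (p : ℕ → ℕ)
    (hp : (I6.all fun i => I6.contains (p i) && (p (p i) == i) && elB C6 i (p i)) = true) :
    ∃ M, IsPM G W M ∧ (∀ i ∈ I6, M (φ i) = φ (p i)) ∧ ∀ z, z ∉ im φ I6 → M z = M0 z := by
  classical
  simp only [List.all_eq_true, Bool.and_eq_true, List.contains_iff_mem, beq_iff_eq] at hp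
  set M : V → V := fun z => if hz : ∃ i ∈ I6, φ i = z then φ (p hz.choose) else M0 z with hMd
  have e1 : ∀ i ∈ I6, M (φ i) = φ (p i) := by
    intro i hi
    have hz : ∃ k ∈ I6, φ k = φ i := ⟨i, hi, rfl⟩
    have h1 := hz.choose_spec
    have : hz.choose = i := h.ok _ h1.1 _ hi h1.2
    simp only [hMd, dif_pos hz, this]
  have e2 : ∀ z, z ∉ im φ I6 → M z = M0 z := by
    intro z hz
    rw [mem_im] at hz
    simp only [hMd, dif_neg hz]
  refine ⟨M, ?_, e1, e2⟩
  intro z hz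
  by_cases hzI : z ∈ im φ I6
  · obtain ⟨i, hi, rfl⟩ := mem_im.1 hzI
    have hpi := hp i hi
    rw [e1 i hi, e1 _ hpi.1.1, hpi.1.2]
    exact ⟨h.mem _ hpi.1.1, rfl, h.emb _ _ hpi.2⟩
  · have h1 := hM z (by simp only [Finset.mem_sdiff]; exact ⟨hz, hzI⟩)
    have h2 := h1.1
    simp only [Finset.mem_sdiff] at h2
    rw [e2 z hzI, e2 _ h2.2]
    exact ⟨h2.1, h1.2⟩

theorem opp6 (hG : BrickOn G W) (hno : ¬ Good G W 3) (hno8 : ∀ φ : ℕ → V, ¬ Loc G W φ I8 C8)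
    (h : Loc G W φ I6 C6) {M0 : V → V} (hM : IsPM G (W \ im φ I6) M0) {v1} (hv1W : v1 ∈ W) (hv1 : v1 ∉ im φ I6) (ha : G.Adj (φ 0) v1) :
    G.Adj (φ 3) (M0 v1) := by
  obtain ⟨N1, hN, hN0, hN1⟩ := hG.toBic.exN ha
  obtain ⟨Ma, hMa, a1, a2⟩ := pm6 h hM (pi [1, 0, 3, 2, 5, 4]) (by decide)
  obtain ⟨Mb, hMb, b1, b2⟩ := pm6 h hM (pi [5, 2, 1, 4, 3, 0]) (by decide)
  have hm := hM v1 (by simp only [Finset.mem_sdiff]; exact ⟨hv1W, hv1⟩)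
  have hm1 := hm.1
  simp only [Finset.mem_sdiff] at hm1
  have hy := hN _ hm1.1
  have h' := (h.ext (a := 6) (b := 7) hM hv1W hv1 (by decide) (by decide) (by decide) (by decide)).cons (a := 0) (b := 6) (by simpa [Function.update] using ha)
  have hn : ∀ i ∈ I6, φ i ≠ v1 := fun i hi e => hv1 (by rw [mem_im]; exact ⟨i, hi, e⟩)
  have m0 : φ 0 ∈ W := h.mem 0 (by decide)
  have i1 : G.Adj (M0 v1) (φ 1) → False := fun e =>
    hno8 _ ((h'.cons (a := 7) (b := 1) (by simpa [Function.update] using e)).relabel (pi [0, 6, 7, 1, 2, 3, 4, 5]) I8 C8 (by decide +kernel))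
  have i5 : G.Adj (M0 v1) (φ 5) → False := fun e =>
    hno8 _ ((h'.cons (a := 7) (b := 5) (by simpa [Function.update] using e)).relabel (pi [0, 6, 7, 5, 4, 3, 2, 1]) I8 C8 (by decide +kernel))
  have ea0 : Ma (φ 0) = φ 1 := a1 0 (by decide)
  have eb0 : Mb (φ 0) = φ 5 := b1 0 (by decide)
  have l1 := long hMa hN m0 (by rw [hN0, ea0]; exact (hn 1 (by decide)).symm) (fun _ => hno) hno8
  have l2 := long hMb hN m0 (by rw [hN0, eb0]; exact (hn 5 (by decide)).symm) (fun _ => hno) hno8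
  rw [hN0, a2 v1 hv1, ea0] at l1
  rw [hN0, b2 v1 hv1, eb0] at l2
  replace l1 := l1.resolve_left (fun e => i1 (e ▸ hy.2.2))
  replace l2 := l2.resolve_left (fun e => i5 (e ▸ hy.2.2))
  obtain ⟨y, ey⟩ : ∃ y, y = N1 (M0 v1) := ⟨_, rfl⟩
  rw [← ey] at l1 l2 hy
  have hMy := (hMa y hy.1).1
  have hMy' := (hMb y hy.1).1
  have ne := fun i hi j hj hij => h.ne (i := i) (j := j) hi hj hij
  have l1' : N1 (φ 1) = Ma y := by rw [← l1.2]; exact (hN _ hMy).2.1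
  have l2' : N1 (φ 5) = Mb y := by rw [← l2.2]; exact (hN _ hMy').2.1
  by_cases hyI : y ∈ im φ I6
  · obtain ⟨j, hj, rfl⟩ := mem_im.1 hyI
    have adj := hy.2.2
    rw [a1 j hj] at l1'
    rw [b1 j hj] at l2'
    have f1 := (hN (φ 1) (h.mem 1 (by decide))).2.1
    have f5 := (hN (φ 5) (h.mem 5 (by decide))).2.1
    simp only [I6, List.mem_cons, List.not_mem_nil, or_false] at hj
    rcases hj with rfl | rfl | rfl | rfl | rfl | rfl
    · exact absurd (hN0.symm.trans hy.2.1) hm.2.2.ne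
    · exact (i1 adj).elim
    · simp only [pi, List.getD_cons_zero, List.getD_cons_succ] at l1' l2'
      rw [l2', l1'] at f5
      exact absurd f5 (ne _ (by decide) _ (by decide) (by decide))
    · exact adj.symm
    · simp only [pi, List.getD_cons_zero, List.getD_cons_succ] at l1' l2'
      rw [l1', l2'] at f1
      exact absurd f1 (ne _ (by decide) _ (by decide) (by decide))
    · exact (i5 adj).elim
  · rw [a2 y hyI] at l1'
    rw [b2 y hyI, ← l1'] at l2'
    exact absurd (hN.inj (h.mem 5 (by decide)) (h.mem 1 (by decide)) l2') (ne _ (by decide) _ (by decide) (by decide))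

abbrev J8 : List ℕ := [6, 7, 0, 1, 2, 3, 4, 5]
abbrev Th8 : List (ℕ × ℕ) := [(3, 7), (0, 6), (6, 7), (0, 1), (1, 2), (2, 3), (3, 4), (4, 5), (5, 0)]

theorem s1 (hG : BrickOn G W) (hno : ¬ Good G W 3) (hno8 : ∀ φ : ℕ → V, ¬ Loc G W φ I8 C8)
    (h : Loc G W φ J8 Th8) {z} (hz : G.Adj (φ 1) z) (h0 : z ≠ φ 0) (h2 : z ≠ φ 2) (h3 : z ≠ φ 3) : z = φ 5 ∨ z = φ 6 := by
  by_cases hzI : z ∈ im φ J8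
  · obtain ⟨i, hi, rfl⟩ := mem_im.1 hzI
    simp only [J8, List.mem_cons, List.not_mem_nil, or_false] at hi
    have h' := h.cons hz
    rcases hi with rfl | rfl | rfl | rfl | rfl | rfl | rfl | rfl
    · right; rfl
    · exact (hno8 _ (h'.relabel (pi [0, 5, 4, 3, 2, 1, 7, 6]) I8 C8 (by decide +kernel))).elim
    · exact absurd rfl h0
    · exact absurd rfl hz.ne
    · exact absurd rfl h2
    · exact absurd rfl h3
    · exact (hno8 _ (h'.relabel (pi [0, 6, 7, 3, 2, 1, 4, 5]) I8 C8 (by decide +kernel))).elim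
    · left; rfl
  · exfalso
    obtain ⟨M0, hM⟩ := h.out
    have hzW := hG.sub _ _ hz.symm
    have h6 := h.drop 6 7 I6 (by decide +kernel)
    have hr := h6.relabel (pi [1, 2, 3, 4, 5, 0]) I6 C6 (by decide +kernel)
    have hx := h.ext (a := 8) (b := 9) hM hzW hzI (by decide) (by decide) (by decide) (by decide)
    have m6 : ∀ i ∈ I6, φ i ≠ φ 6 := fun i hi => h.ne (by revert i; decide) (by decide) (by revert i; decide)
    have m7 : ∀ i ∈ I6, φ i ≠ φ 7 := fun i hi => h.ne (by revert i; decide) (by decide) (by revert i; decide)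
    have ho : HasPM G (((W \ im φ I6) \ {φ 6, φ 7})) := by
      convert h.out using 1
      ext z; simp [im]; tauto
    have him : im (fun i => φ (pi [1, 2, 3, 4, 5, 0] i)) I6 = im φ I6 := by
      ext z; simp [im, pi]; tauto
    -- matching with 67
    have hM' : IsPM G (W \ im φ I6) (fun t => if t = φ 6 then φ 7 else if t = φ 7 then φ 6 else M0 t) := by
      intro t ht
      have a67 := h.emb 6 7 (by decide)
      have n67 := a67.ne
      by_cases t6 : t = φ 6
      · subst t6
        simp only [if_true, n67.symm, if_false]
        refine ⟨?_, trivial, a67⟩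
        simp only [Finset.mem_sdiff, mem_im]
        exact ⟨h.mem 7 (by decide), fun ⟨i, hi, e⟩ => m7 i hi e⟩
      by_cases t7 : t = φ 7
      · subst t7
        simp only [if_true, n67.symm, if_false]
        refine ⟨?_, trivial, a67.symm⟩
        simp only [Finset.mem_sdiff, mem_im]
        exact ⟨h.mem 6 (by decide), fun ⟨i, hi, e⟩ => m6 i hi e⟩
      have ht' : t ∈ W \ im φ J8 := by
        simp only [Finset.mem_sdiff, mem_im] at ht ⊢
        refine ⟨ht.1, ?_⟩
        rintro ⟨i, hi, rfl⟩
        simp only [J8, List.mem_cons, List.not_mem_nil, or_false] at hi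
        rcases hi with rfl | rfl | hi
        · exact t6 rfl
        · exact t7 rfl
        · exact ht.2 ⟨i, by simpa [I6] using hi, rfl⟩
      have hm := hM t ht'
      have hm1 := hm.1
      simp only [Finset.mem_sdiff, mem_im, not_exists, not_and] at hm1
      have i6 : M0 t ≠ φ 6 := fun e => hm1.2 6 (by decide) e.symm
      have i7 : M0 t ≠ φ 7 := fun e => hm1.2 7 (by decide) e.symm
      simp only [t6, t7, i6, i7, if_false]
      refine ⟨?_, hm.2⟩
      simp only [Finset.mem_sdiff, mem_im]
      exact ⟨hm1.1, fun ⟨i, hi, e⟩ => hm1.2 i (by clear e; revert i; decide) e⟩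
    have hz6 : z ≠ φ 6 := fun e => hzI (by rw [mem_im]; exact ⟨6, by decide, e.symm⟩)
    have hz7 : z ≠ φ 7 := fun e => hzI (by rw [mem_im]; exact ⟨7, by decide, e.symm⟩)
    have key := opp6 hG hno hno8 hr (by rw [him]; exact hM') hzW (by
      rw [him, mem_im]; rintro ⟨i, hi, e⟩; exact hzI (by rw [mem_im]; exact ⟨i, by clear e; revert i; decide, e⟩)) hz
    simp only [hz6, hz7, if_false] at key
    have key : G.Adj (φ 4) (M0 z) := key
    exact hno (((hx.cons (a := 1) (b := 8) (by simpa [Function.update] using hz)).cons (a := 4) (b := 9) (by simpa [Function.update] using key)).good 3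
      [0, 6, 7, 3, 2, 1, 8, 9, 4, 5] [(0, 6), (6, 7), (7, 3), (3, 2), (2, 1), (1, 8), (8, 9), (9, 4), (4, 5), (5, 0)] [0, 6] (by decide +kernel))

theorem s2 (hG : BrickOn G W) (hno : ¬ Good G W 3) (hno8 : ∀ φ : ℕ → V, ¬ Loc G W φ I8 C8)
    (h : Loc G W φ J8 Th8) (hz : G.Adj (φ 1) (φ 5)) : False := by
  have ne := fun i hi j hj hij => h.ne (i := i) (j := j) hi hj hij
  have h' := h.cons hz
  obtain ⟨y, hy, hyW, y1, y3⟩ := hG.nb (h.mem 2 (by decide)) (h.mem 1 (by decide)) (h.mem 3 (by decide)) (ne _ (by decide) _ (by decide) (by decide)) (ne _ (by decide) _ (by decide) (by decide))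
  by_cases y0 : y = φ 0
  · subst y0
    exact hno8 _ ((h'.cons hy).relabel (pi [0, 2, 1, 5, 4, 3, 7, 6]) I8 C8 (by decide +kernel))
  have hs := h.relabel (pi [3, 2, 1, 0, 5, 4, 7, 6]) J8 Th8 (by decide +kernel)
  rcases s1 hG hno hno8 hs (z := y) hy y3 y1 y0 with rfl | rfl
  swap
  · have hy : G.Adj (φ 2) (φ 7) := hy
    exact hno8 _ ((h'.cons hy).relabel (pi [0, 1, 5, 4, 3, 2, 7, 6]) I8 C8 (by decide +kernel))
  have hy : G.Adj (φ 2) (φ 4) := hy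
  have h'' := h'.cons hy
  have h8 := h.card (by decide)
  simp only [List.length_cons, List.length_nil] at h8
  obtain ⟨t, ht, htW, t0, t3, t6, t7⟩ := hG.nb2 (by omega) (h.mem 6 (by decide)) (h.mem 7 (by decide)) (h.mem 0 (by decide)) (h.mem 3 (by decide))
    (ne _ (by decide) _ (by decide) (by decide)) (ne _ (by decide) _ (by decide) (by decide)) (ne _ (by decide) _ (by decide) (by decide)) (ne _ (by decide) _ (by decide) (by decide))
  rcases ht with ht | ht
  · have hs := h.relabel (pi [0, 6, 7, 3, 4, 5, 1, 2]) J8 Th8 (by decide +kernel)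
    rcases s1 hG hno hno8 hs (z := t) ht t0 t7 t3 with rfl | rfl
    · have ht : G.Adj (φ 6) (φ 5) := ht
      exact hno8 _ ((h''.cons ht).relabel (pi [0, 1, 2, 4, 3, 7, 6, 5]) I8 C8 (by decide +kernel))
    · have ht : G.Adj (φ 6) (φ 1) := ht
      exact hno8 _ ((h''.cons ht).relabel (pi [0, 1, 6, 7, 3, 2, 4, 5]) I8 C8 (by decide +kernel))
  · have hs := h.relabel (pi [3, 7, 6, 0, 5, 4, 2, 1]) J8 Th8 (by decide +kernel)
    rcases s1 hG hno hno8 hs (z := t) ht t3 t6 t0 with rfl | rfl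
    · have ht : G.Adj (φ 7) (φ 4) := ht
      exact hno8 _ ((h''.cons ht).relabel (pi [0, 5, 1, 2, 3, 4, 7, 6]) I8 C8 (by decide +kernel))
    · have ht : G.Adj (φ 7) (φ 2) := ht
      exact hno8 _ ((h''.cons ht).relabel (pi [0, 1, 5, 4, 3, 2, 7, 6]) I8 C8 (by decide +kernel))

theorem s3 (hG : BrickOn G W) (hno : ¬ Good G W 3) (hno8 : ∀ φ : ℕ → V, ¬ Loc G W φ I8 C8)
    (h : Loc G W φ J8 Th8) : False := by
  have ne := fun i hi j hj hij => h.ne (i := i) (j := j) hi hj hij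
  have h8 := h.card (by decide)
  simp only [List.length_cons, List.length_nil] at h8
  obtain ⟨t, ht, htW, t0, t3, t6, t7⟩ := hG.nb2 (by omega) (h.mem 1 (by decide)) (h.mem 2 (by decide)) (h.mem 0 (by decide)) (h.mem 3 (by decide))
    (ne _ (by decide) _ (by decide) (by decide)) (ne _ (by decide) _ (by decide) (by decide)) (ne _ (by decide) _ (by decide) (by decide)) (ne _ (by decide) _ (by decide) (by decide))
  have key : ∀ φ : ℕ → V, Loc G W φ J8 Th8 → G.Adj (φ 1) t → t ≠ φ 0 → t ≠ φ 2 → t ≠ φ 3 → False := by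
    intro φ h ht t0 t2 t3
    rcases s1 hG hno hno8 h ht t0 t2 t3 with rfl | rfl
    · exact s2 hG hno hno8 h ht
    · exact s2 hG hno hno8 (h.relabel (pi [0, 1, 2, 3, 7, 6, 5, 4]) J8 Th8 (by decide +kernel)) ht
  rcases ht with ht | ht
  · exact key φ h ht t0 t7 t3
  · exact key _ (h.relabel (pi [3, 2, 1, 0, 5, 4, 7, 6]) J8 Th8 (by decide +kernel)) ht t3 t6 t0

theorem ex8 (hG : BrickOn G W) (hW : 7 ≤ W.card) : Good G W 3 ∨ ∃ φ : ℕ → V, Loc G W φ I8 C8 := by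
  by_contra hc
  push Not at hc
  obtain ⟨hno, hno8⟩ := hc
  obtain ⟨φ, h⟩ := ex6 hG (by omega) (fun M N hM hN x hx hne => long hM hN hx hne (fun _ => hno) hno8)
  obtain ⟨i, hi, v1, hv1W, hv1, ha⟩ := h.leave hG (by simp; omega) (by simp)
  have key : ∀ φ : ℕ → V, Loc G W φ I6 C6 → v1 ∉ im φ I6 → G.Adj (φ 0) v1 → False := by
    intro φ h hv1 ha
    obtain ⟨M0, hM⟩ := h.out
    have := opp6 hG hno hno8 h hM hv1W hv1 ha
    have hx := h.ext (a := 6) (b := 7) hM hv1W hv1 (by decide) (by decide) (by decide) (by decide)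
    exact s3 hG hno hno8 (((hx.cons (a := 0) (b := 6) (by simpa [Function.update] using ha)).cons (a := 3) (b := 7) (by simpa [Function.update] using this)).sub Th8 (by decide +kernel))
  have hck : (decide ((I6.map fun k => (k + i) % 6).Perm I6 ∧ (I6.map fun k => (k + i) % 6).Nodup) && C6.all fun e => elB C6 ((e.1 + i) % 6) ((e.2 + i) % 6)) = true := by
    clear ha; revert i; decide +kernel
  have h1 := h.relabel (fun k => (k + i) % 6) I6 C6 hck
  have hi8 : (0 + i) % 6 = i := by clear ha h1 hck; revert i; decide
  refine key _ h1 ?_ ?_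
  · rw [mem_im] at hv1 ⊢
    rintro ⟨k, hk, e⟩
    refine hv1 ⟨_, ?_, e⟩
    simp only [Bool.and_eq_true, decide_eq_true_eq] at hck
    exact hck.1.1.mem_iff.1 (List.mem_map_of_mem hk)
  · simpa only [hi8] using ha

theorem good3 (hG : BrickOn G W) (hW : 9 ≤ W.card) : Good G W 3 := by
  rcases ex8 hG (by omega) with h | ⟨φ, h⟩
  · exact h
  · exact c8_good hG hW h

end C8ex2

section Tree
variable {V : Type*} [Fintype V] [DecidableEq V] {G : SimpleGraph V} {W : Finset V} {φ : ℕ → V}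

/-- a set of vertices of `W \ D` without edges leaving it inside `W \ D` is even -/
theorem par {B : SimpleGraph V} {Y T : Finset V} (h : HasPM B Y) (hT : T ⊆ Y) (hc : ∀ x ∈ T, ∀ y ∈ Y, B.Adj x y → y ∈ T) : Even T.card := by
  obtain ⟨f, hf⟩ := h
  have : IsPM B T f := fun z hz => ⟨hc z hz _ (hf z (hT hz)).1 (hf z (hT hz)).2.2, (hf z (hT hz)).2⟩
  exact this.even

theorem hall {B : SimpleGraph V} {S T : Finset V} (hb : ∀ u ∈ W, ∀ v ∈ W, u ≠ v → HasPM B (W \ {u, v})) (hS : S ⊆ W) (hT : T ⊆ W)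
    (hd : Disjoint S T) (h2 : 2 ≤ S.card) (hc : S.card ≤ T.card + 1) : ∃ t ∈ T, ∃ w ∈ W \ S, B.Adj t w := by
  by_contra hno
  push Not at hno
  obtain ⟨u, hu, v, hv, huv⟩ := Finset.one_lt_card.1 h2
  obtain ⟨f, hf⟩ := hb u (hS hu) v (hS hv) huv
  have hTm : ∀ t ∈ T, t ∈ W \ {u, v} := by
    intro t ht
    have h1 := Finset.disjoint_left.1 hd hu
    have h2 := Finset.disjoint_left.1 hd hv
    simp
    exact ⟨hT ht, fun e => h1 (e ▸ ht), fun e => h2 (e ▸ ht)⟩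
  have him : T.image f ⊆ S \ {u, v} := by
    intro z hz
    simp at hz
    obtain ⟨t, ht, rfl⟩ := hz
    have := hf t (hTm t ht)
    have h3 := hno t ht (f t)
    simp at this h3
    simp
    exact ⟨by by_contra hh; exact h3 this.1.1 hh this.2.2, this.1.2⟩
  have h1 := Finset.card_le_card him
  rw [Finset.card_image_of_injOn (fun a ha b hb e => hf.inj (hTm a ha) (hTm b hb) e)] at h1
  have h4 := Finset.card_sdiff_add_card_eq_card (s := {u, v}) (t := S) (by intro z; simp; rintro (rfl | rfl) <;> assumption)
  rw [Finset.card_pair huv] at h4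
  omega

theorem onecut (four : 4 ≤ W.card) (bic : ∀ u ∈ W, ∀ v ∈ W, u ≠ v → HasPM G (W \ {u, v})) {a : V} (ha : a ∈ W) {X : Finset V}
    (hX : X ⊆ W \ {a}) (hne : X.Nonempty) (hnX : X ≠ W \ {a}) : ∃ x ∈ X, ∃ y ∈ (W \ {a}) \ X, G.Adj x y := by
  obtain ⟨w, hw, hwX⟩ : ∃ w ∈ W \ {a}, w ∉ X := by
    by_contra hc; push Not at hc; exact hnX (Finset.Subset.antisymm hX hc)
  by_contra hno
  push Not at hno
  have hsum : (X \ {a}).card + ((W \ {a}) \ X).card + 1 = W.card := by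
    have h1 := Finset.card_sdiff_add_card_eq_card hX
    have h2 := Finset.card_sdiff_add_card_eq_card (Finset.singleton_subset_iff.2 ha)
    have h3 : X \ {a} = X := Finset.sdiff_singleton_eq_erase a X ▸ Finset.erase_eq_of_notMem (fun h => by simpa using hX h)
    rw [h3]; simp at h2; omega
  have h3 : X \ {a} = X := Finset.sdiff_singleton_eq_erase a X ▸ Finset.erase_eq_of_notMem (fun h => by simpa using hX h)
  rw [h3] at hsum
  have hpar : ∀ T ⊆ W \ {a}, (∀ x ∈ T, ∀ y ∈ W \ {a}, y ∉ T → ¬ G.Adj x y) → T.Nonempty → ¬ Even T.card := by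
    rintro T hT hc ⟨u, hu⟩ hev
    have huW := hT hu
    simp at huW
    have := par (bic u huW.1 a ha huW.2) (T := T \ {u}) (by
      intro z hz; simp at hz ⊢; have := hT hz.1; simp at this; tauto) (by
      intro x hx y hy hxy
      simp at hx hy ⊢
      refine ⟨?_, hy.2.1⟩
      by_contra hyT
      exact hc x hx.1 y (by simp; tauto) hyT hxy)
    have h1 := Finset.card_sdiff_add_card_eq_card (Finset.singleton_subset_iff.2 hu)
    simp at h1
    rw [← h1] at hev
    exact absurd hev (by rw [Nat.even_add_one]; simpa using this)
  have e1 := hpar X hX (fun x hx y hy hyX => hno x hx y (by simp at hy ⊢; tauto)) hne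
  have e2 := hpar ((W \ {a}) \ X) Finset.sdiff_subset (fun x hx y hy hyX hxy => by
    simp at hx hy hyX
    exact hno y (hyX hy.1 hy.2) x (by simp; tauto) hxy.symm) ⟨w, by simp only [Finset.mem_sdiff] at hw ⊢; exact ⟨hw, hwX⟩⟩
  have hW : Even W.card := by
    obtain ⟨u, hu, v, hv, huv⟩ := Finset.one_lt_card.1 (show 1 < W.card by omega)
    have := (bic u hu v hv huv).even
    have h4 := Finset.card_sdiff_add_card_eq_card (s := {u, v}) (t := W) (by intro z; simp; rintro (rfl | rfl) <;> assumption)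
    rw [Finset.card_pair huv] at h4
    rw [← h4]; exact this.add (by decide)
  rw [Nat.not_even_iff_odd] at e1 e2
  have := e1.add_odd e2
  rw [← hsum] at hW
  rw [Nat.even_add_one] at hW
  exact hW this

theorem mkBrick (sub : ∀ x y, G.Adj x y → x ∈ W) (four : 4 ≤ W.card) (bic : ∀ u ∈ W, ∀ v ∈ W, u ≠ v → HasPM G (W \ {u, v}))
    (conn : ∀ a ∈ W, ∀ b ∈ W, a ≠ b → ∀ X ⊆ W \ {a, b}, X.Nonempty → X ≠ W \ {a, b} → ∃ x ∈ X, ∃ y ∈ (W \ {a, b}) \ X, G.Adj x y) :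
    BrickOn G W := by
  refine ⟨sub, four, bic, fun a ha b hb X hX hne hnX => ?_⟩
  by_cases hab : a = b
  swap
  · exact conn a ha b hb hab X hX hne hnX
  subst hab
  simp only [Finset.pair_eq_singleton] at *
  exact onecut four bic ha hX hne hnX

def mskL (I : List ℕ) (m : ℕ) : List ℕ := I.filter fun i => m.testBit i

def obl (I : List ℕ) (h : ℕ) : List (ℕ × ℕ) :=
  (mskL I h).flatMap fun t => (I.filter fun w => !(h.testBit (w + 8)) && w != t && !(((mskL I (h / 256)).length == 2) && h.testBit w)).map fun w => (t, w)

def oblB (I : List ℕ) (h : ℕ) : Bool :=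
  (I.all fun i => !(h.testBit i && h.testBit (i + 8))) && ((mskL I (h / 256)).length == 2 && !(mskL I h).isEmpty && (I.any fun i => !(h.testBit i || h.testBit (i + 8)))
   || (decide (3 ≤ (mskL I (h / 256)).length ∧ (mskL I (h / 256)).length ≤ (mskL I h).length + 1)))

theorem mem_mskL {I : List ℕ} {m i} : i ∈ mskL I m ↔ i ∈ I ∧ m.testBit i = true := by simp [mskL]

theorem tb8 (h i : ℕ) : (h / 256).testBit i = h.testBit (i + 8) := by
  rw [show 256 = 2 ^ 8 by norm_num, Nat.testBit_div_two_pow]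

theorem im_mem {I J : List ℕ} (hφ : Ok φ I) (hJ : J ⊆ I) {i} (hi : i ∈ I) : φ i ∈ im φ J ↔ i ∈ J := by
  rw [mem_im]
  exact ⟨fun ⟨j, hj, e⟩ => hφ _ (hJ hj) _ hi e ▸ hj, fun h => ⟨i, h, rfl⟩⟩

theorem obl_sound (hG : BrickOn G W) {I : List ℕ} (hφ : Ok φ I) (hn : I.Nodup) (hW : im φ I = W) (h : ℕ) (hb : oblB I h = true) :
    ∃ c ∈ obl I h, G.Adj (φ c.1) (φ c.2) := by
  have hsub : ∀ m, mskL I m ⊆ I := fun m i hi => (mem_mskL.1 hi).1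
  have hsubW : ∀ m, im φ (mskL I m) ⊆ W := by
    intro m; rw [← hW]; intro z hz; rw [mem_im] at hz ⊢; obtain ⟨i, hi, rfl⟩ := hz; exact ⟨i, hsub m hi, rfl⟩
  have hcard : ∀ m, (im φ (mskL I m)).card = (mskL I m).length := fun m => im_card (hφ.sub (hsub m)) (hn.filter _)
  simp only [oblB, Bool.and_eq_true, Bool.or_eq_true, List.all_eq_true, decide_eq_true_eq, List.any_eq_true, beq_iff_eq] at hb
  obtain ⟨h0, hb⟩ := hb
  have hdj : Disjoint (im φ (mskL I (h / 256))) (im φ (mskL I h)) := by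
    rw [Finset.disjoint_left]
    intro z hz hz'
    obtain ⟨i, hi, rfl⟩ := mem_im.1 hz
    rw [im_mem hφ (hsub _) (hsub _ hi), mem_mskL] at hz'
    rw [mem_mskL, tb8] at hi
    have := h0 i hi.1
    simp [hi.2, hz'.2] at this
  have fin : ∀ t ∈ mskL I h, ∀ w ∈ I, G.Adj (φ t) (φ w) → h.testBit (w + 8) = false → ((mskL I (h / 256)).length = 2 → h.testBit w = false) →
      ∃ c ∈ obl I h, G.Adj (φ c.1) (φ c.2) := by
    intro t ht w hw ha h1 h2
    refine ⟨(t, w), ?_, ha⟩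
    simp only [obl, List.mem_flatMap, List.mem_map, List.mem_filter]
    refine ⟨t, ht, w, ⟨hw, ?_⟩, rfl⟩
    have : w ≠ t := by rintro rfl; exact ha.ne rfl
    simp [h1, this]
    by_cases h3 : (mskL I (h / 256)).length = 2
    · exact Or.inr (h2 h3)
    · exact Or.inl h3
  by_cases hS : (mskL I (h / 256)).length = 2
  · have hex : (¬ (mskL I h).isEmpty = true) ∧ ∃ i ∈ I, ¬ (h.testBit i = true ∨ h.testBit (i + 8) = true) := by
      rcases hb with ⟨⟨-, h1⟩, i, hi, h2⟩ | ⟨h1, h2⟩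
      · exact ⟨by simpa using h1, i, hi, by simpa using h2⟩
      · omega
    obtain ⟨hne, k, hk, hkn⟩ := hex
    obtain ⟨a, b, hab, hSe⟩ := Finset.card_eq_two.1 ((hcard (h / 256)).trans hS)
    have hm : ∀ z, z ∈ im φ (mskL I (h / 256)) ↔ z = a ∨ z = b := by intro z; rw [hSe]; simp
    have haW : a ∈ W := hsubW (h / 256) ((hm a).2 (by simp))
    have hbW : b ∈ W := hsubW (h / 256) ((hm b).2 (by simp))
    obtain ⟨x, hx, y, hy, hxy⟩ := hG.conn a haW b hbW (im φ (mskL I h)) (by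
      intro z hz
      rw [Finset.mem_sdiff]
      refine ⟨hsubW _ hz, ?_⟩
      rw [← hSe]; exact fun h' => Finset.disjoint_left.1 hdj h' hz) (by
      obtain ⟨i, hi⟩ := List.exists_mem_of_ne_nil _ (by simpa using hne)
      exact ⟨φ i, mem_im.2 ⟨i, hi, rfl⟩⟩) (by
      intro e
      have : φ k ∈ im φ (mskL I h) := by
        rw [e, ← hSe, Finset.mem_sdiff, im_mem hφ (hsub _) hk, mem_mskL, tb8, ← hW, mem_im]
        exact ⟨⟨k, hk, rfl⟩, by tauto⟩
      rw [im_mem hφ (hsub _) hk, mem_mskL] at this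
      tauto)
    obtain ⟨t, ht, rfl⟩ := mem_im.1 hx
    rw [← hSe, ← hW, Finset.mem_sdiff, Finset.mem_sdiff] at hy
    obtain ⟨w, hw, rfl⟩ := mem_im.1 hy.1.1
    rw [im_mem hφ (hsub _) hw, im_mem hφ (hsub _) hw, mem_mskL, mem_mskL, tb8] at hy
    exact fin t ht w hw hxy (by simpa [hw] using hy.1.2) (fun _ => by simpa [hw] using hy.2)
  · obtain ⟨x, hx, y, hy, hxy⟩ := hall hG.bic (hsubW (h / 256)) (hsubW h) hdj (by rw [hcard]; omega) (by rw [hcard, hcard]; omega)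
    obtain ⟨t, ht, rfl⟩ := mem_im.1 hx
    rw [← hW, Finset.mem_sdiff] at hy
    obtain ⟨w, hw, rfl⟩ := mem_im.1 hy.1
    rw [im_mem hφ (hsub _) hw, mem_mskL, tb8] at hy
    exact fin t ht w hw hxy (by simpa [hw] using hy.2) (fun h => absurd h hS)

end Tree

section Tree2
variable {V : Type*} [Fintype V] [DecidableEq V] {G : SimpleGraph V} {W : Finset V} {φ : ℕ → V}

def BicOn (H : SimpleGraph V) (W : Finset V) : Prop :=
  (∀ x y, H.Adj x y → x ∈ W) ∧ ∀ u ∈ W, ∀ v ∈ W, u ≠ v → HasPM H (W \ {u, v})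

def kids (E F : List (ℕ × ℕ)) : List (ℕ × ℕ) → List (List (ℕ × ℕ) × List (ℕ × ℕ))
  | [] => []
  | c :: cs => if elB F c.1 c.2 then kids E F cs else (c :: E, F) :: kids E (c :: F) cs

def run (leaf : ℕ → List (ℕ × ℕ) → Bool) (I : List ℕ) : List ℕ → List (List (ℕ × ℕ) × List (ℕ × ℕ)) → Bool
  | _, [] => true
  | [], _ :: _ => false
  | h :: hs, s :: st => if h < 65536 then oblB I h && run leaf I hs (kids s.1 s.2 (obl I h) ++ st)
      else leaf (h - 65536) s.1 && run leaf I hs st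

theorem kids_sound {P : Prop} {I : List ℕ} {E : List (ℕ × ℕ)} (hE : Loc G W φ I E) (C : List (ℕ × ℕ)) : ∀ F,
    (∀ e ∈ F, ¬ G.Adj (φ e.1) (φ e.2)) → (∃ c ∈ C, G.Adj (φ c.1) (φ c.2)) →
    (∀ s ∈ kids E F C, Loc G W φ I s.1 → (∀ e ∈ s.2, ¬ G.Adj (φ e.1) (φ e.2)) → P) → P := by
  induction C with
  | nil => simp
  | cons c cs ih =>
    rintro F hF ⟨d, hd, had⟩ hP
    by_cases hc : elB F c.1 c.2 = true
    · simp only [kids, hc, if_true] at hP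
      refine ih F hF ⟨d, ?_, had⟩ hP
      rcases List.mem_cons.1 hd with rfl | h
      · simp [elB] at hc
        rcases hc with h | h
        · exact absurd had (hF _ h)
        · exact absurd had.symm (hF _ h)
      · exact h
    · simp only [kids, hc] at hP
      by_cases hca : G.Adj (φ c.1) (φ c.2)
      · exact hP (c :: E, F) (by simp) (hE.cons (a := c.1) (b := c.2) hca) hF
      · refine ih (c :: F) (by simpa using ⟨hca, fun a b h => hF (a, b) h⟩) ⟨d, ?_, had⟩ (fun s hs => hP s (by simp [hs]))
        rcases List.mem_cons.1 hd with rfl | h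
        · exact absurd had hca
        · exact h

theorem run_sound (hG : BrickOn G W) {P : Prop} {I : List ℕ} (hφ : Ok φ I) (hn : I.Nodup) (hW : im φ I = W) {leaf}
    (hl : ∀ h E, leaf h E = true → Loc G W φ I E → P) (hs : List ℕ) : ∀ st, run leaf I hs st = true → ∀ s ∈ st,
    Loc G W φ I s.1 → (∀ e ∈ s.2, ¬ G.Adj (φ e.1) (φ e.2)) → P := by
  induction hs with
  | nil => intro st h s hs; cases st <;> simp_all [run]
  | cons h hs ih =>
    intro st hr s hst h1 h2
    cases st with
    | nil => simp at hst
    | cons s0 st =>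
      rw [run] at hr
      split_ifs at hr
      · rw [Bool.and_eq_true] at hr
        have := ih _ hr.2
        rcases List.mem_cons.1 hst with rfl | hst
        · exact kids_sound h1 _ _ h2 (obl_sound hG hφ hn hW h hr.1) (fun s hs => this s (by simp [hs]))
        · exact this s (by simp [hst]) h1 h2
      · rw [Bool.and_eq_true] at hr
        rcases List.mem_cons.1 hst with rfl | hst
        · exact hl _ _ hr.1 h1
        · exact ih _ hr.2 s hst h1 h2

theorem Loc.full {I : List ℕ} {L : List (ℕ × ℕ)} (h : Loc G W φ I L) (hn : I.Nodup) (hc : W.card ≤ I.length) : im φ I = W := by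
  apply Finset.eq_of_subset_of_card_le
  · intro z hz; obtain ⟨i, hi, rfl⟩ := mem_im.1 hz; exact h.mem i hi
  · rwa [im_card h.ok hn]

abbrev valB (L : List (ℕ × ℕ)) (I : List ℕ) : Bool := L.all fun e => I.contains e.1 && I.contains e.2 && e.1 != e.2

theorem gr_sub {I : List ℕ} {L : List (ℕ × ℕ)} (hv : valB L I = true) : ∀ x y, (gr φ L).Adj x y → x ∈ im φ I := by
  simp only [List.all_eq_true, Bool.and_eq_true, List.contains_iff_mem, valB] at hv
  rintro x y ⟨-, e, he, ⟨rfl, rfl⟩ | ⟨rfl, rfl⟩⟩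
  · exact mem_im.2 ⟨_, (hv e he).1.1, rfl⟩
  · exact mem_im.2 ⟨_, (hv e he).1.2, rfl⟩

theorem gr_le {I : List ℕ} {L : List (ℕ × ℕ)} (h : Loc G W φ I L) : gr φ L ≤ G := by
  rintro x y ⟨-, e, he, ⟨rfl, rfl⟩ | ⟨rfl, rfl⟩⟩
  · exact h.emb _ _ (by simp [elB, he])
  · exact (h.emb _ _ (by simp [elB, he])).symm

theorem gr_bic {I : List ℕ} {L : List (ℕ × ℕ)} (hφ : Ok φ I) (hn : I.Nodup) (hv : valB L I = true) (hc : clB (elB L) I I = true) : BicOn (gr φ L) (im φ I) :=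
  ⟨gr_sub hv, (clB_sound hn hφ (gr_elB hφ hv) hc).2⟩

theorem gr_inv {I : List ℕ} {L : List (ℕ × ℕ)} (hφ : Ok φ I) (hv : valB L I = true) {i j} (hi : i ∈ I) (hj : j ∈ I) (h : (gr φ L).Adj (φ i) (φ j)) :
    elB L i j = true := by
  simp only [List.all_eq_true, Bool.and_eq_true, List.contains_iff_mem, valB] at hv
  obtain ⟨-, e, he, ⟨h1, h2⟩ | ⟨h1, h2⟩⟩ := h
  · rw [hφ _ hi _ (hv e he).1.1 h1, hφ _ hj _ (hv e he).1.2 h2]; simp [elB, he]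
  · rw [hφ _ hi _ (hv e he).1.2 h1, hφ _ hj _ (hv e he).1.1 h2]; simp [elB, he]

def conn2 (E : ℕ → ℕ → Bool) : ℕ → List ℕ → List ℕ → Bool
  | _, _, [] => true
  | 0, _, _ :: _ => false
  | f + 1, s, r => (r.find? fun i => s.any (E i)).any fun i => conn2 E f (i :: s) (r.erase i)

theorem conn2_sound {E : ℕ → ℕ → Bool} (f : ℕ) {p : ℕ → Prop} : ∀ s r, conn2 E f s r = true → 
    (∀ i ∈ s, p i) → (∀ i, ∀ j, (i ∈ s ∨ i ∈ r) → j ∈ r → E j i = true → p i → p j) → ∀ i ∈ r, p i := by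
  induction f with
  | zero => intro s r h; cases r <;> simp_all [conn2]
  | succ f ih =>
    intro s r h hs hp
    cases r with
    | nil => simp
    | cons k r =>
      rw [conn2] at h
      swap; · simp
      rw [Option.any_eq_true] at h
      obtain ⟨i, hi, h⟩ := h
      have hm := List.mem_of_find?_eq_some hi
      have ha := List.find?_some hi
      simp only [List.any_eq_true] at ha
      obtain ⟨j, hj, ha⟩ := ha
      have hpi := hp j i (Or.inl hj) hm ha (hs j hj)
      have := ih _ _ h (by simpa using ⟨hpi, hs⟩) (by
        intro a b ha hb
        refine hp a b ?_ (List.mem_of_mem_erase hb)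
        rcases ha with ha | ha
        · rcases List.mem_cons.1 ha with rfl | ha
          · exact Or.inr hm
          · exact Or.inl ha
        · exact Or.inr (List.mem_of_mem_erase ha))
      intro b hb
      by_cases hbi : b = i
      · rw [hbi]; exact hpi
      · exact this b ((List.mem_erase_of_ne hbi).2 hb)

def brickB (L : List (ℕ × ℕ)) (I : List ℕ) : Bool :=
  valB L I && clB (elB L) I I && I.all fun a => I.all fun b => a == b || conn2 (elB L) I.length (((I.erase a).erase b).take 1) ((I.erase a).erase b).tail

theorem brickB_sound {I : List ℕ} {L : List (ℕ × ℕ)} (hφ : Ok φ I) (hn : I.Nodup) (h4 : 4 ≤ I.length) (h : brickB L I = true) :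
    BrickOn (gr φ L) (im φ I) := by
  simp only [brickB, Bool.and_eq_true] at h
  obtain ⟨⟨hv, hc⟩, hk⟩ := h
  have hb := gr_bic hφ hn hv hc
  refine mkBrick hb.1 (by rwa [im_card hφ hn]) hb.2 ?_
  intro a ha b hb' hab X hX hne hnX
  obtain ⟨a, ha0, rfl⟩ := mem_im.1 ha
  obtain ⟨b, hb0, rfl⟩ := mem_im.1 hb'
  simp only [List.all_eq_true, Bool.or_eq_true, beq_iff_eq] at hk
  have hk := (hk a ha0 b hb0).resolve_left (fun e => hab (by rw [e]))
  rw [im_erase hφ hn ha0 hb0] at hX hnX ⊢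
  have hJ : (I.erase a).erase b ⊆ I := fun _ h => List.mem_of_mem_erase (List.mem_of_mem_erase h)
  generalize (I.erase a).erase b = J at *
  have hJo := hφ.sub hJ
  by_contra hno
  push Not at hno
  cases J with
  | nil =>
    have : X = ∅ := by simpa [im] using hX
    simp [this] at hne
  | cons j r =>
    have step : ∀ i ∈ j :: r, ∀ k ∈ j :: r, elB L i k = true → φ k ∈ X → φ i ∈ X := by
      intro i hi k hk hik hkX
      by_contra hiX
      exact hno _ hkX (φ i) (by rw [Finset.mem_sdiff]; exact ⟨mem_im.2 ⟨i, hi, rfl⟩, hiX⟩) (gr_elB hφ hv _ (hJ hi) _ (hJ hk) hik).symm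
    have sym : ∀ i k, elB L i k = true → elB L k i = true := by intro i k h; rw [elB, Bool.or_comm]; exact h
    have key := conn2_sound I.length (p := fun i => φ i ∈ X ↔ φ j ∈ X) [j] r (by simpa using hk) (by simp) (by
      intro i k hi hk hik hiX
      have hi' : i ∈ j :: r := by simpa using hi
      rw [← hiX]
      exact ⟨step i hi' k (by simp [hk]) (sym _ _ hik), step k (by simp [hk]) i hi' hik⟩)
    have key' : ∀ i ∈ j :: r, (φ i ∈ X ↔ φ j ∈ X) := by
      intro i hi; rcases List.mem_cons.1 hi with rfl | hi
      · rfl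
      · exact key i hi
    by_cases hj : φ j ∈ X
    · refine hnX (Finset.Subset.antisymm hX ?_)
      intro z hz
      obtain ⟨i, hi, rfl⟩ := mem_im.1 hz
      exact (key' i hi).2 hj
    · obtain ⟨z, hz⟩ := hne
      obtain ⟨i, hi, rfl⟩ := mem_im.1 (hX hz)
      exact hj ((key' i hi).1 hz)

def dig (c i : ℕ) : ℕ := (c / 8 ^ i) % 8

def permB (c : ℕ) (I : List ℕ) (E L : List (ℕ × ℕ)) : Bool :=
  decide ((I.map (dig c)).Perm I ∧ (I.map (dig c)).Nodup) && L.all fun e => elB E (dig c e.1) (dig c e.2)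

abbrev W5 : List (ℕ × ℕ) := [(0, 1), (1, 2), (2, 3), (3, 4), (4, 0), (5, 0), (5, 1), (5, 2), (5, 3), (5, 4)]
abbrev Pr : List (ℕ × ℕ) := [(0, 1), (1, 2), (2, 0), (3, 4), (4, 5), (5, 3), (0, 3), (1, 4), (2, 5)]
abbrev W7 : List (ℕ × ℕ) := [(0, 1), (1, 2), (2, 3), (3, 4), (4, 5), (5, 6), (6, 0), (7, 0), (7, 1), (7, 2), (7, 3), (7, 4), (7, 5), (7, 6)]

def leaf6 (h : ℕ) (E : List (ℕ × ℕ)) : Bool := permB (h / 2) I6 E (if h % 2 = 0 then W5 else Pr)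

def rmv (m : ℕ) : ℕ → List (ℕ × ℕ) → List (ℕ × ℕ)
  | _, [] => []
  | i, e :: E => if m.testBit i then rmv m (i + 1) E else e :: rmv m (i + 1) E

def trv (E : ℕ → ℕ → Bool) (I : List ℕ) : List ℕ → List ℕ → List ℕ
  | Q, [] => Q
  | Q, i :: r => if Q.all fun q => pmB E I.length ((I.erase q).erase i) then trv E I (i :: Q) r else trv E I Q r

def leaf8 (h : ℕ) (E : List (ℕ × ℕ)) : Bool :=
  if h % 4 = 0 then
    let L := rmv (h / 4) 0 E
    let Q := trv (elB L) I8 [] I8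
    (decide (I8.Perm I8) && (L.all fun e => elB E e.1 e.2) && 
      (certB L I8 Q && decide (Q.Nodup ∧ I8.Nodup ∧ 4 ≤ I8.length ∧ 2 * 3 + 8 + 2 * L.length ≤ 3 * I8.length + 2 * Q.length)))
  else if h % 4 = 1 then
    let L := rmv (h / 4) 0 E
    valB L I8 && clB (elB L) I8 I8 && (L.all fun e => elB E e.1 e.2) && E.any fun e => I8.contains e.1 && I8.contains e.2 && !elB L e.1 e.2
  else if h % 4 = 2 then
    valB E I8 && clB (elB E) I8 I8 && oblB I8 (h / 4) && (obl I8 (h / 4)).all fun e => I8.contains e.1 && I8.contains e.2 && !elB E e.1 e.2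
  else permB (h / 4) I8 E W7

theorem leaf6_sound (h : ℕ) (E : List (ℕ × ℕ)) (hh : leaf6 h E = true) (hL : Loc G W φ I6 E) : (∃ ψ, Loc G W ψ I6 W5) ∨ ∃ ψ, Loc G W ψ I6 Pr := by
  rw [leaf6] at hh
  have := hL.relabel _ _ _ hh
  split_ifs at this
  · exact Or.inl ⟨_, this⟩
  · exact Or.inr ⟨_, this⟩

theorem leaf8_sound (hG : BrickOn G W) (h8 : W.card = 8) (hmin : ∀ H ≤ G, BicOn H W → H = G) (h : ℕ) (E : List (ℕ × ℕ)) (hh : leaf8 h E = true)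
    (hL : Loc G W φ I8 E) : Good G W 3 ∨ ∃ ψ, Loc G W ψ I8 W7 := by
  have hn : I8.Nodup := by decide
  have hW := hL.full hn (by simp [h8])
  rw [leaf8] at hh
  split_ifs at hh
  · exact Or.inl (hL.good 3 _ _ _ hh)
  · exfalso
    simp only [Bool.and_eq_true, List.any_eq_true] at hh
    obtain ⟨⟨⟨h1, h2⟩, h3⟩, e, he, h4⟩ := hh
    have hL' := hL.sub _ h3
    have := hmin _ (gr_le hL') (hW ▸ gr_bic hL.ok hn h1 h2)
    have ha := hL.emb e.1 e.2 (by simp [elB, he])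
    rw [← this] at ha
    simp only [List.contains_iff_mem] at h4
    have := gr_inv hL.ok h1 h4.1.1 h4.1.2 ha
    simp [this] at h4
  · exfalso
    rw [Bool.and_eq_true, Bool.and_eq_true, Bool.and_eq_true] at hh
    obtain ⟨⟨⟨h1, h2⟩, h3⟩, h4⟩ := hh
    simp only [Bool.and_eq_true, List.all_eq_true] at h4
    have := hmin _ (gr_le hL) (hW ▸ gr_bic hL.ok hn h1 h2)
    obtain ⟨c, hc, ha⟩ := obl_sound hG hL.ok hn hW _ h3
    rw [← this] at ha
    have h4 := h4 c hc
    simp only [List.contains_iff_mem] at h4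
    have := gr_inv hL.ok h1 h4.1.1 h4.1.2 ha
    simp [this] at h4
  · exact Or.inr ⟨_, hL.relabel _ _ _ hh⟩

end Tree2

section Small
variable {V : Type*} [Fintype V] [DecidableEq V] {G : SimpleGraph V} {W : Finset V} {φ : ℕ → V}

def hh6 : List ℕ := [1282, 2564, 4366, 10247, 158401, 176544, 354961, 10247, 222913, 353953, 242064, 2310, 300305, 357649, 8705, 4366, 347793, 349585, 307472, 4620, 222913, 
  280257, 10757, 222913, 5128, 5386, 2564, 341409, 347793, 10757, 411185, 2564, 300305, 345777, 10757, 413201, 8705, 300305, 2564, 371984, 284177, 5128, 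
  10247, 2564, 111010, 347793, 411185, 347793, 9219, 2564, 307473, 283281, 429328]
def hh82 : List ℕ := [1282, 16702, 20512, 40991, 10256, 65793, 65793, 65793, 65544, 65793, 10256, 65793, 65793, 65793, 65544, 65793, 65600, 43088, 65600, 65600, 65600, 
  65544, 65536, 10256, 40991, 65793, 65793, 65664, 65600, 65544, 40991, 65793, 16671555, 66049, 65600, 65544, 40991, 65793, 66049, 66049, 65600, 65544, 
  65536, 43088, 65568, 65568, 65568, 10256, 65600, 40991, 65793, 66049, 66049, 66049, 65544, 40991, 65793, 66049, 66049, 66049, 65544, 65536, 43088, 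
  65568, 65568, 65568, 10256, 65568, 65568, 40991, 65793, 66049, 66049, 66049, 66049, 34823, 65793, 139458, 66049, 34823, 65568, 65568, 65568, 36879, 
  10256, 65793, 65793, 65793, 65793, 65793, 65552, 65552, 34823, 65568, 65568, 65568, 10256, 65568, 20512, 40991, 65664, 65793, 65664, 65793, 65552, 
  40991, 65664, 66049, 66049, 65600, 65552, 40991, 65664, 66049, 66049, 66049, 65552, 65568, 36879, 65664, 65568, 65568, 65568, 40991, 65600, 20512, 
  65793, 66049, 66049, 66049, 65568, 20512, 65664, 66049, 25060131, 66561, 65568, 20512, 65664, 65600, 66561, 66561, 65568, 36879, 65552, 65552, 65552, 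
  66561, 20512, 65536, 65536, 65536, 34823, 65664, 66049, 139458, 34823, 65664, 65568, 65568, 43088, 65600, 20512, 65793, 65568, 65568, 65568, 65568, 
  20512, 65664, 65568, 65568, 65568, 65568, 20512, 40991, 10256, 74778, 65600, 65664, 65544, 98305, 65568, 65600, 43088, 74778, 65600, 65664, 65544, 
  65536, 65552, 10256, 65600, 65568, 40991, 65664, 65600, 66561, 66561, 65544, 65536, 43088, 65568, 65568, 65568, 2310, 65568, 65568, 40991, 65664, 
  66561, 66561, 66561, 10256, 65664, 66561, 65568, 2310, 65568, 65552, 36879, 65664, 65568, 65568, 65552, 20896, 40991, 65536, 65536, 65536, 43088, 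
  65600, 65600, 65600, 65544, 65536, 40991, 65536, 65536, 65536, 43088, 65664, 66049, 66561, 65544, 65536, 2310, 65568, 65536, 40991, 65544, 65544, 
  66561, 66561, 65536, 4366, 65536, 65536, 2310, 65568, 65568, 8478, 65536, 65536, 10256, 65536, 65536, 65536, 2310, 65552, 65552, 4366, 65536, 65536, 
  2310, 65600, 66561, 5128, 16702, 20512, 40991, 65793, 65793, 65664, 65568, 65600, 40991, 65793, 65793, 65664, 65568, 65600, 40991, 65793, 65793, 65664, 
  65793, 65600, 65552, 36879, 65793, 65552, 65664, 65552, 21802, 40991, 65664, 65793, 65664, 65568, 65600, 65552, 65560, 5386, 65552, 65552, 65544, 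
  21802, 40991, 65600, 65600, 65600, 65568, 65600, 65552, 5386, 65552, 65552, 5386, 8478, 65544, 65664, 65544, 65600, 65536, 65552, 65536, 65536, 21544, 
  65536, 21802, 65544, 65536, 65536, 65536, 65536, 65536, 10256, 16702, 5128, 40991, 65793, 65793, 65664, 65544, 65568, 65568, 65536, 65544, 65568, 
  65536, 40991, 65552, 65552, 65552, 65536, 65552, 8478, 65568, 65600, 65536, 65552, 9240, 65568, 65536, 65536, 65544, 40991, 65552, 65552, 65552, 65536, 
  43088, 65536, 65536, 65536, 5128, 17794, 10256, 20512, 65793, 65664, 65568, 65552, 65600, 20512, 65600, 65600, 65793, 65552, 20512, 65793, 65793, 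
  65552, 65552, 65544, 21802, 65536, 65536, 65536, 17794, 10256, 65536, 17464, 65552, 65544, 65793, 65552, 17464, 65552, 65544, 65600, 65552, 65536, 
  65536, 65536, 65536, 21544, 65544, 21802, 10256, 65600, 65600, 65600, 65793, 65544, 65536, 65536, 10256, 20512, 40991, 5128, 8282951, 65552, 65544, 
  98305, 65600, 65536, 65552, 21544, 65600, 65544, 65600, 5128, 65552, 65536, 36879, 5128, 98305, 65544, 98305, 65600, 65536, 33795, 65568, 5128, 40991, 
  102498, 65664, 65544, 65568, 65536, 40991, 65664, 65664, 65568, 5128, 17464, 65664, 65568, 98305, 21544, 65672, 65552, 65600, 33795, 20512, 65536, 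
  65536, 34823, 139458, 65664, 34823, 81921, 65664, 65536, 17464, 20512, 65552, 98305, 81921, 5128, 65568, 21544, 65553, 5128, 73729, 81921, 43088, 5128, 
  20512, 98305, 65664, 65544, 98305, 65536, 20512, 81921, 21544, 65808, 65545, 81921, 20512, 98305, 65664, 98305, 33795, 65600, 65600]
def hh84 : List ℕ := [21928, 2564, 65536, 65536, 20512, 40991, 65536, 1282, 67585, 65552, 65536, 5128, 16702, 65536, 2564, 40991, 65793, 65544, 65568, 65536, 65536]
def F8 : List (ℕ × ℕ) := [(0, 2), (1, 3), (2, 4), (3, 5), (4, 6), (5, 7), (6, 0), (7, 1)]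

theorem run6 : run leaf6 I6 hh6 [(C6, [])] = true := by decide +kernel
theorem run82 : run leaf8 I8 hh82 [((0, 2) :: C8, [])] = true := by decide +kernel
theorem run84 : run leaf8 I8 hh84 [((0, 4) :: C8, F8)] = true := by decide +kernel

theorem small6 (hG : BrickOn G W) (h6 : W.card = 6) : (∃ ψ, Loc G W ψ I6 W5) ∨ ∃ ψ, Loc G W ψ I6 Pr := by
  obtain ⟨φ, hφ⟩ := ex6 hG (by omega) (fun M N hM hN x hx hne => long hM hN hx hne (fun h => by omega) (fun ψ h => by
    have := h.card (by decide); simp [h6] at this))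
  have hn : I6.Nodup := by decide
  exact run_sound hG hφ.ok hn (hφ.full hn (by simp [h6])) (fun h E h1 h2 => leaf6_sound h E h1 h2) hh6 _ run6 _ (List.mem_singleton_self _) hφ (by simp)

theorem small8 (hG : BrickOn G W) (h8 : W.card = 8) (hmin : ∀ H ≤ G, BicOn H W → H = G) : Good G W 3 ∨ ∃ ψ, Loc G W ψ I8 W7 := by
  rcases ex8 hG (by omega) with h | ⟨φ, hφ⟩
  · exact Or.inl h
  have hn : I8.Nodup := by decide
  have hsh : ∀ k < 8, Loc G W (fun i => φ ((i + k) % 8)) I8 C8 := by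
    intro k hk
    refine hφ.relabel (fun i => (i + k) % 8) _ _ ?_
    interval_cases k <;> decide
  by_cases hd : ∃ k < 8, G.Adj (φ k) (φ ((k + 2) % 8))
  · obtain ⟨k, hk, ha⟩ := hd
    have h1 := (hsh k hk).cons (a := 0) (b := 2) (by
      rw [show (0 + k) % 8 = k by omega, show (2 + k) % 8 = (k + 2) % 8 by omega]; exact ha)
    exact run_sound hG h1.ok hn (h1.full hn (by simp [h8])) (fun h E h1 h2 => leaf8_sound hG h8 hmin h E h1 h2) hh82 _ run82 _ (List.mem_singleton_self _) h1 (by simp)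
  · push Not at hd
    have hW := hφ.full hn (by simp [h8])
    obtain ⟨c, hc, ha⟩ := obl_sound hG hφ.ok hn hW (85 * 256 + 170) (by decide)
    have : ∃ k < 8, G.Adj (φ k) (φ ((k + 4) % 8)) := by
      have : ∀ c ∈ obl I8 (85 * 256 + 170), (c.1 < 8 ∧ c.2 = (c.1 + 2) % 8) ∨ (c.2 < 8 ∧ c.1 = (c.2 + 2) % 8) ∨ (c.1 < 8 ∧ c.2 = (c.1 + 4) % 8) := by decide
      rcases this c hc with ⟨h1, h2⟩ | ⟨h1, h2⟩ | ⟨h1, h2⟩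
      · rw [h2] at ha; exact absurd ha (hd _ h1)
      · rw [h2] at ha; exact absurd ha.symm (hd _ h1)
      · rw [h2] at ha; exact ⟨_, h1, ha⟩
    obtain ⟨k, hk, ha⟩ := this
    have h1 := (hsh k hk).cons (a := 0) (b := 4) (by
      rw [show (0 + k) % 8 = k by omega, show (4 + k) % 8 = (k + 4) % 8 by omega]; exact ha)
    refine run_sound hG h1.ok hn (h1.full hn (by simp [h8])) (fun h E h1 h2 => leaf8_sound hG h8 hmin h E h1 h2) hh84 _ run84 _ (List.mem_singleton_self _) h1 ?_
    have : ∀ e ∈ F8, e.1 < 8 ∧ e.2 = (e.1 + 2) % 8 := by decide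
    intro e he
    have h2 := hd ((e.1 + k) % 8) (by omega)
    rw [(this e he).2]
    rwa [show ((e.1 + 2) % 8 + k) % 8 = ((e.1 + k) % 8 + 2) % 8 by omega]

end Small

section Splice
variable {V : Type*} [Fintype V] [DecidableEq V] {G : SimpleGraph V} {W : Finset V}

theorem BrickOn.dich (h : BrickOn G W) {a b : V} (ha : a ∈ W) (hb : b ∈ W) (p : V → Prop)
    (hp : ∀ x ∈ W \ {a, b}, ∀ y ∈ W \ {a, b}, G.Adj x y → (p x ↔ p y)) : ∀ x ∈ W \ {a, b}, ∀ y ∈ W \ {a, b}, p x → p y := by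
  classical
  intro x hx y hy hpx
  by_contra hpy
  obtain ⟨u, hu, v, hv, huv⟩ := h.conn a ha b hb ((W \ {a, b}).filter p) (Finset.filter_subset _ _) ⟨x, by simp only [Finset.mem_filter]; exact ⟨hx, hpx⟩⟩ (by
    intro e; rw [← e] at hy; exact hpy (Finset.mem_filter.1 hy).2)
  rw [Finset.mem_filter] at hu
  rw [Finset.mem_sdiff, Finset.mem_filter] at hv
  exact hv.2 ⟨hv.1, (hp u hu.1 v hv.1 huv).1 hu.2⟩

theorem mkBrick' (hB : BicOn G W) (four : 4 ≤ W.card)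
    (conn : ∀ a ∈ W, ∀ b ∈ W, a ≠ b → ∀ p : V → Prop, (∀ x ∈ W \ {a, b}, ∀ y ∈ W \ {a, b}, G.Adj x y → (p x ↔ p y)) → 
      ∀ x ∈ W \ {a, b}, ∀ y ∈ W \ {a, b}, p x → p y) : BrickOn G W := by
  refine mkBrick hB.1 four hB.2 ?_
  rintro a ha b hb hab X hX ⟨x, hx⟩ hnX
  by_contra hno
  push Not at hno
  refine hnX (Finset.Subset.antisymm hX fun y hy => conn a ha b hb hab (fun z => z ∈ X) ?_ x (hX hx) y hy hx)
  intro u hu v hv huv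
  constructor
  · intro h
    by_contra h'
    exact hno u h v (Finset.mem_sdiff.2 ⟨hv, h'⟩) huv
  · intro h
    by_contra h'
    exact hno v h u (Finset.mem_sdiff.2 ⟨hu, h'⟩) huv.symm

structure Half (U S : SimpleGraph V) (X Y : Finset V) (b : V) : Prop where
  br : BrickOn S (insert b X)
  bY : b ∈ Y
  ins : ∀ x ∈ X, ∀ y ∈ X, S.Adj x y → U.Adj x y
  cr : ∀ x ∈ X, S.Adj x b → ∃ y ∈ Y, U.Adj x y

set_option maxHeartbeats 1000000 in
theorem splice {U S1 S2 : SimpleGraph V} {X Y : Finset V} {a b : V} (hd : Disjoint X Y) (hs : ∀ x y, U.Adj x y → x ∈ X ∪ Y)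
    (h1 : Half U S1 X Y b) (h2 : Half U S2 Y X a) (h3 : ∀ c ∈ X, ∀ d ∈ Y, ∃ x ∈ X, ∃ y ∈ Y, x ≠ c ∧ y ≠ d ∧ U.Adj x y) : BrickOn U (X ∪ Y) := by
  have hXY : ∀ z, z ∈ X → z ∈ Y → False := fun z h h' => Finset.disjoint_left.1 hd h h'
  have inner : ∀ {S : SimpleGraph V} {X Y : Finset V} {b : V}, (∀ z, z ∈ X → z ∈ Y → False) → Half U S X Y b → ∀ u ∈ X, HasPM U (X \ {u}) := by
    intro S X Y b hXY h u hu
    have hub : u ≠ b := fun e => hXY u hu (e ▸ h.bY)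
    have e : insert b X \ {u, b} = X \ {u} := by
      ext z; simp only [Finset.mem_sdiff, Finset.mem_insert, Finset.mem_singleton]
      have : z ∈ X → z ≠ b := fun h1 e => hXY z h1 (e ▸ h.bY)
      tauto
    have := h.br.bic u (by simp [hu]) b (by simp) hub
    rw [e] at this
    obtain ⟨f, hf⟩ := this
    exact ⟨f, fun z hz => ⟨(hf z hz).1, (hf z hz).2.1, h.ins _ (by have := Finset.mem_sdiff.1 hz; exact this.1) _ (Finset.mem_sdiff.1 (hf z hz).1).1 (hf z hz).2.2⟩⟩
  have same : ∀ {S S' : SimpleGraph V} {X Y : Finset V} {a b : V}, (∀ z, z ∈ X → z ∈ Y → False) → Half U S X Y b → Half U S' Y X a → ∀ u ∈ X, ∀ v ∈ X, u ≠ v → HasPM U ((X ∪ Y) \ {u, v}) := by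
    intro S S' X Y a b hXY h h' u hu v hv huv
    have nb : ∀ z ∈ X, z ≠ b := fun z hz e => hXY z hz (e ▸ h.bY)
    obtain ⟨f, hf⟩ := h.br.bic u (by simp [hu]) v (by simp [hv]) huv
    have hb := hf b (by simp [(nb u hu).symm, (nb v hv).symm])
    have hfb := hb.1
    simp only [Finset.mem_sdiff, Finset.mem_insert, Finset.mem_singleton, not_or] at hfb
    have hfX : f b ∈ X := hfb.1.resolve_left hb.2.2.ne'
    obtain ⟨y, hy, hxy⟩ := h.cr _ hfX hb.2.2.symm
    have k1 : HasPM U (X \ {u, v, f b}) := by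
      refine ⟨f, fun z hz => ?_⟩
      simp only [Finset.mem_sdiff, Finset.mem_insert, Finset.mem_singleton, not_or] at hz
      have hm := hf z (by simp [hz])
      have hzz := hm.1
      simp only [Finset.mem_sdiff, Finset.mem_insert, Finset.mem_singleton, not_or] at hzz
      have e1 : f z ≠ b := by intro e; exact hz.2.2.2 (by rw [← e, hm.2.1])
      have e2 : f z ≠ f b := by intro e; have := congrArg f e; rw [hm.2.1, hb.2.1] at this; exact nb z hz.1 this
      refine ⟨by simp; tauto, hm.2.1, h.ins _ hz.1 _ (hzz.1.resolve_left e1) hm.2.2⟩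
    have k2 := inner (fun z h h' => hXY z h' h) h' y hy
    have k3 : HasPM U {f b, y} := HasPM.pair hxy
    have := (k1.union k2 ?_).union k3 ?_
    · convert this using 1
      ext z
      simp only [Finset.mem_sdiff, Finset.mem_union, Finset.mem_insert, Finset.mem_singleton]
      have := hXY z
      by_cases e : z = y
      · subst e; have : z ≠ u := fun e => hXY z (e ▸ hu) hy
        have : z ≠ v := fun e => hXY z (e ▸ hv) hy
        tauto
      · by_cases e2 : z = f b
        · subst e2; tauto
        · have : z ∈ Y → z ≠ u ∧ z ≠ v := fun h => ⟨fun e => hXY z (e ▸ hu) h, fun e => hXY z (e ▸ hv) h⟩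
          tauto
    · rw [Finset.disjoint_left]; intro z hz hz'
      exact hXY z (Finset.mem_sdiff.1 hz).1 (Finset.mem_sdiff.1 hz').1
    · rw [Finset.disjoint_left]; intro z hz hz'
      simp only [Finset.mem_sdiff, Finset.mem_union, Finset.mem_insert, Finset.mem_singleton] at hz hz'
      rcases hz' with rfl | rfl
      · rcases hz with hz | hz
        · tauto
        · exact hXY _ hfX hz.1
      · rcases hz with hz | hz
        · exact hXY _ hz.1 hy
        · tauto
  have nbX : ∀ z ∈ X, z ≠ b := fun z hz e => hXY z hz (e ▸ h1.bY)
  have nbY : ∀ z ∈ Y, z ≠ a := fun z hz e => hXY z (e ▸ h2.bY) hz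
  have hb : BicOn U (X ∪ Y) := by
    refine ⟨hs, fun u hu v hv huv => ?_⟩
    have mix : ∀ u ∈ X, ∀ v ∈ Y, HasPM U ((X ∪ Y) \ {u, v}) := by
      intro u hu v hv
      have := (inner hXY h1 u hu).union (inner (fun z h h' => hXY z h' h) h2 v hv) (by
        rw [Finset.disjoint_left]; intro z hz hz'
        exact hXY z (Finset.mem_sdiff.1 hz).1 (Finset.mem_sdiff.1 hz').1)
      convert this using 1
      ext z
      simp only [Finset.mem_sdiff, Finset.mem_union, Finset.mem_insert, Finset.mem_singleton]
      have := hXY z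
      have : z ∈ X → z ≠ v := fun h e => hXY v (e ▸ h) hv
      have : z ∈ Y → z ≠ u := fun h e => hXY u hu (e ▸ h)
      tauto
    rcases Finset.mem_union.1 hu with hu | hu <;> rcases Finset.mem_union.1 hv with hv | hv
    · exact same hXY h1 h2 u hu v hv huv
    · exact mix u hu v hv
    · rw [Finset.pair_comm]; exact mix v hv u hu
    · rw [Finset.union_comm]; exact same (fun z h h' => hXY z h' h) h2 h1 u hu v hv huv
  refine mkBrick' hb ?_ ?_
  · have := h1.br.four
    refine this.trans (Finset.card_le_card ?_)
    intro z hz; simp at hz ⊢; rcases hz with rfl | h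
    · exact Or.inr h1.bY
    · exact Or.inl h
  have conS : ∀ {S S' : SimpleGraph V} {X Y : Finset V} {a b : V}, (∀ z, z ∈ X → z ∈ Y → False) → Half U S X Y b → Half U S' Y X a → ∀ u ∈ X, ∀ v ∈ X, 
      ∀ p : V → Prop, (∀ x ∈ (X ∪ Y) \ {u, v}, ∀ y ∈ (X ∪ Y) \ {u, v}, U.Adj x y → (p x ↔ p y)) → ∀ x ∈ (X ∪ Y) \ {u, v}, (p x ↔ p b) := by
    intro S S' X Y a b hXY h h' u hu v hv p hp
    have nb : ∀ z ∈ X, z ≠ b := fun z hz e => hXY z hz (e ▸ h.bY)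
    have mY : ∀ y ∈ Y, y ∈ (X ∪ Y) \ {u, v} := by
      intro y hy
      have : y ≠ u := fun e => hXY y (e ▸ hu) hy
      have : y ≠ v := fun e => hXY y (e ▸ hv) hy
      simp [*]
    have mY' : ∀ y ∈ Y, y ∈ insert a Y \ {a, a} := by
      intro y hy
      have : y ≠ a := fun e => hXY y (e ▸ h'.bY) hy
      simp [*]
    have hY : ∀ y ∈ Y, ∀ z ∈ Y, p y → p z := fun y hy z hz =>
      h'.br.dich (a := a) (b := a) (by simp) (by simp) p (fun x hx y hy hxy => by
        simp at hx hy
        have hx' : x ∈ Y := hx.1.resolve_left hx.2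
        have hy' : y ∈ Y := hy.1.resolve_left hy.2
        exact hp x (mY x hx') y (mY y hy') (h'.ins x hx' y hy' hxy)) y (mY' y hy) z (mY' z hz)
    have hX := h.br.dich (a := u) (b := v) (by simp [hu]) (by simp [hv]) p (by
      have key : ∀ x ∈ X, x ≠ u → x ≠ v → S.Adj x b → (p x ↔ p b) := by
        intro x hx h1 h2 hxb
        obtain ⟨y, hy, hxy⟩ := h.cr x hx hxb
        rw [hp x (by simp [*]) y (mY y hy) hxy]
        exact ⟨hY y hy b h.bY, hY b h.bY y hy⟩
      intro x hx y hy hxy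
      simp at hx hy
      rcases hx.1 with rfl | hx1 <;> rcases hy.1 with rfl | hy1
      · rfl
      · exact (key y hy1 hy.2.1 hy.2.2 hxy.symm).symm
      · exact key x hx1 hx.2.1 hx.2.2 hxy
      · exact hp x (by simp [*]) y (by simp [*]) (h.ins x hx1 y hy1 hxy))
    intro x hx
    have hbm : b ∈ insert b X \ {u, v} := by simp [(nb u hu).symm, (nb v hv).symm]
    rcases Finset.mem_union.1 (Finset.mem_sdiff.1 hx).1 with hx1 | hx1
    · have hxm : x ∈ insert b X \ {u, v} := by simp at hx ⊢; tauto
      exact ⟨hX x hxm b hbm, hX b hbm x hxm⟩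
    · exact ⟨hY x hx1 b h.bY, hY b h.bY x hx1⟩
  have conM : ∀ c ∈ X, ∀ d ∈ Y, 
      ∀ p : V → Prop, (∀ x ∈ (X ∪ Y) \ {c, d}, ∀ y ∈ (X ∪ Y) \ {c, d}, U.Adj x y → (p x ↔ p y)) → ∃ q : Prop, ∀ x ∈ (X ∪ Y) \ {c, d}, (p x ↔ q) := by
    intro c hc d hd p hp
    have mX : ∀ x ∈ X, x ≠ c → x ∈ (X ∪ Y) \ {c, d} := by
      intro x hx hxc
      have : x ≠ d := fun e => hXY x hx (e ▸ hd)
      simp [*]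
    have mY : ∀ x ∈ Y, x ≠ d → x ∈ (X ∪ Y) \ {c, d} := by
      intro x hx hxc
      have : x ≠ c := fun e => hXY x (e ▸ hc) hx
      simp [*]
    have hX : ∀ x ∈ X, x ≠ c → ∀ y ∈ X, y ≠ c → p x → p y := by
      have := h1.br.dich (a := c) (b := b) (by simp [hc]) (by simp) p (fun x hx y hy hxy => by
        simp at hx hy
        have hx' : x ∈ X := hx.1.resolve_left hx.2.2
        have hy' : y ∈ X := hy.1.resolve_left hy.2.2
        exact hp x (mX x hx' hx.2.1) y (mX y hy' hy.2.1) (h1.ins x hx' y hy' hxy))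
      intro x hx hxc y hy hyc
      exact this x (by simp [hx, hxc, nbX x hx]) y (by simp [hy, hyc, nbX y hy])
    have hY : ∀ x ∈ Y, x ≠ d → ∀ y ∈ Y, y ≠ d → p x → p y := by
      have := h2.br.dich (a := d) (b := a) (by simp [hd]) (by simp) p (fun x hx y hy hxy => by
        simp at hx hy
        have hx' : x ∈ Y := hx.1.resolve_left hx.2.2
        have hy' : y ∈ Y := hy.1.resolve_left hy.2.2
        exact hp x (mY x hx' hx.2.1) y (mY y hy' hy.2.1) (h2.ins x hx' y hy' hxy))
      intro x hx hxc y hy hyc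
      exact this x (by simp [hx, hxc, nbY x hx]) y (by simp [hy, hyc, nbY y hy])
    obtain ⟨x, hx, y, hy, hxc, hyd, hxy⟩ := h3 c hc d hd
    have e := hp x (mX x hx hxc) y (mY y hy hyd) hxy
    refine ⟨p x, fun z hz => ?_⟩
    simp only [Finset.mem_sdiff, Finset.mem_union, Finset.mem_insert, Finset.mem_singleton, not_or] at hz
    rcases hz.1 with h | h
    · exact ⟨hX z h hz.2.1 x hx hxc, hX x hx hxc z h hz.2.1⟩
    · rw [e]
      exact ⟨hY z h hz.2.2 y hy hyd, hY y hy hyd z h hz.2.2⟩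
  intro c hc d hd hcd p hp
  have : ∃ q : Prop, ∀ x ∈ (X ∪ Y) \ {c, d}, (p x ↔ q) := by
    rcases Finset.mem_union.1 hc with hc | hc <;> rcases Finset.mem_union.1 hd with hd | hd
    · exact ⟨_, conS hXY h1 h2 c hc d hd p hp⟩
    · exact conM c hc d hd p hp
    · rw [Finset.pair_comm] at hp ⊢; exact conM d hd c hc p hp
    · rw [Finset.union_comm] at hp ⊢; exact ⟨_, conS (fun z h h' => hXY z h' h) h2 h1 c hc d hd p hp⟩
  obtain ⟨q, hq⟩ := this
  intro x hx y hy hpx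
  exact (hq y hy).2 ((hq x hx).1 hpx)

end Splice

section CutS
variable {V : Type*} [Fintype V] [DecidableEq V] {G B : SimpleGraph V} {W P : Finset V} {a b p q : V}

structure Cut (B : SimpleGraph V) (W : Finset V) (a b : V) (P : Finset V) : Prop where
  ma : a ∈ W
  mb : b ∈ W
  ne : a ≠ b
  sub : ∀ x ∈ P, x ∈ W ∧ x ≠ a ∧ x ≠ b
  cl : ∀ x ∈ P, ∀ y, B.Adj x y → y ∈ P ∨ y = a ∨ y = b

theorem Cut.symm (h : Cut B W a b P) : Cut B W b a P :=
  ⟨h.mb, h.ma, h.ne.symm, fun x hx => ⟨(h.sub x hx).1, (h.sub x hx).2.2, (h.sub x hx).2.1⟩, fun x hx y hy => (h.cl x hx y hy).imp id Or.symm⟩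

theorem Cut.compl (hB : BicOn B W) (h : Cut B W a b P) : Cut B W a b ((W \ {a, b}) \ P) := by
  refine ⟨h.ma, h.mb, h.ne, fun x hx => ?_, fun x hx y hy => ?_⟩
  · simp at hx; tauto
  · simp at hx ⊢
    have := hB.1 y x hy.symm
    by_contra hc
    have h1 : y ∈ P := by tauto
    have := h.cl y h1 x hy.symm
    tauto

theorem Cut.even (hB : BicOn B W) (h : Cut B W a b P) : Even P.card :=
  par (hB.2 a h.ma b h.mb h.ne) (fun z hz => by have := h.sub z hz; simp; tauto) (fun x hx y hy hxy => by
    have := h.cl x hx y hxy; simp at hy; tauto)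

def half (B : SimpleGraph V) (R : Finset V) (a b p : V) : SimpleGraph V where
  Adj x y := x ∈ R ∧ y ∈ R ∧ x ≠ y ∧ (B.Adj x y ∨ s(x, y) = s(a, b) ∨ s(x, y) = s(p, b))
  symm := ⟨fun x y ⟨h1, h2, h3, h4⟩ => ⟨h2, h1, h3.symm, by rw [Sym2.eq_swap, B.adj_comm]; exact h4⟩⟩
  loopless := ⟨fun x h => h.2.2.1 rfl⟩

theorem Cut.bic (hB : BicOn B W) (h : Cut B W a b P) {u v : V} (hu : u ∈ insert b (insert a P)) (hv : v ∈ insert b (insert a P)) (huv : u ≠ v) :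
    HasPM (half B (insert b (insert a P)) a b p) (insert b (insert a P) \ {u, v}) := by
  have hR : ∀ z ∈ insert b (insert a P), z ∈ W := by
    intro z hz; simp at hz; rcases hz with rfl | rfl | hz
    · exact h.mb
    · exact h.ma
    · exact (h.sub z hz).1
  obtain ⟨f, hf⟩ := hB.2 u (hR u hu) v (hR v hv) huv
  have hQe := (h.compl hB).even hB
  have hQc := (h.compl hB).cl
  set Q := (W \ {a, b}) \ P with hQ
  have mQ : ∀ z, z ∈ Q ↔ z ∈ W ∧ z ≠ a ∧ z ≠ b ∧ z ∉ P := by intro z; simp [hQ]; tauto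
  have mD : ∀ z, z ∈ W \ {u, v} ↔ z ∈ W ∧ z ≠ u ∧ z ≠ v := by intro z; simp
  have hQD : ∀ z ∈ Q, z ∈ W \ {u, v} := by
    intro z hz
    rw [mQ] at hz
    simp at hu hv
    rw [mD]
    refine ⟨hz.1, ?_, ?_⟩ <;> rintro rfl <;> tauto
  have hP := h.sub
  have hPc := h.cl
  have one : ∀ c d, c ∈ W \ {u, v} → f c ∈ Q → ((c = a ∧ d = b) ∨ (c = b ∧ d = a)) → (d ∈ W \ {u, v} → f d ∉ Q) → False := by
    intro c d hc hfc hcd hd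
    have hcQ : c ∉ Q := by rw [mQ]; rcases hcd with ⟨rfl, -⟩ | ⟨rfl, -⟩ <;> tauto
    have : IsPM B (Q \ {f c}) f := by
      intro z hz
      rw [Finset.mem_sdiff, Finset.mem_singleton] at hz
      have hz1 := hf z (hQD z hz.1)
      refine ⟨?_, hz1.2⟩
      rw [Finset.mem_sdiff, Finset.mem_singleton]
      have e1 : f z ≠ c := by rintro rfl; exact hz.2 hz1.2.1.symm
      have e2 : f z ≠ d := by
        intro e; refine hd (e ▸ hz1.1) ?_
        rw [← e, hz1.2.1]; exact hz.1
      have e3 : f z ≠ f c := fun e => hcQ (hf.inj (hQD z hz.1) hc e ▸ hz.1)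
      refine ⟨?_, e3⟩
      have := hQc z hz.1 _ hz1.2.2
      rcases hcd with ⟨rfl, rfl⟩ | ⟨rfl, rfl⟩ <;> tauto
    have h1 := this.even
    have h2 := Finset.card_sdiff_add_card_eq_card (Finset.singleton_subset_iff.2 hfc)
    simp at h2
    rw [← h2, Nat.even_add_one] at hQe
    exact hQe h1
  have hmono : ∀ Y ⊆ insert b (insert a P), HasPM B Y → HasPM (half B (insert b (insert a P)) a b p) Y := fun Y hY h =>
    h.mono' fun x hx y hy hxy => ⟨hY hx, hY hy, hxy.ne, Or.inl hxy⟩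
  by_cases hα : a ∈ W \ {u, v} ∧ f a ∈ Q
  · by_cases hβ : b ∈ W \ {u, v} ∧ f b ∈ Q
    · have k1 : HasPM B (P \ {u, v}) := by
        refine ⟨f, fun z hz => ?_⟩
        rw [Finset.mem_sdiff] at hz
        have hz1 := hf z (by rw [Finset.mem_sdiff]; exact ⟨(hP z hz.1).1, hz.2⟩)
        refine ⟨?_, hz1.2⟩
        have h2 := hz1.1
        rw [Finset.mem_sdiff] at h2 ⊢
        refine ⟨?_, h2.2⟩
        rcases hPc z hz.1 _ hz1.2.2 with h3 | h3 | h3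
        · exact h3
        · rw [← h3, hz1.2.1, mQ] at hα; tauto
        · rw [← h3, hz1.2.1, mQ] at hβ; tauto
      have hne := h.ne
      have k2 := (hmono _ (fun z hz => by simp at hz ⊢; tauto) k1).union (HasPM.pair (x := a) (y := b) (show (half B (insert b (insert a P)) a b p).Adj a b from 
        ⟨by simp, by simp, hne, by simp⟩)) (by
        rw [Finset.disjoint_left]; intro z hz hz'
        simp at hz hz'
        have := hP z hz.1
        tauto)
      convert k2 using 1
      have h1 := hα.1
      have h2 := hβ.1
      rw [mD] at h1 h2
      ext z
      simp only [Finset.mem_sdiff, Finset.mem_insert, Finset.mem_singleton, Finset.mem_union]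
      by_cases e1 : z = a
      · subst e1; tauto
      · by_cases e2 : z = b
        · subst e2; tauto
        · tauto
    · exact (one a b hα.1 hα.2 (Or.inl ⟨rfl, rfl⟩) (fun h1 h2 => hβ ⟨h1, h2⟩)).elim
  · by_cases hβ : b ∈ W \ {u, v} ∧ f b ∈ Q
    · exact (one b a hβ.1 hβ.2 (Or.inr ⟨rfl, rfl⟩) (fun h1 h2 => hα ⟨h1, h2⟩)).elim
    · refine hmono _ Finset.sdiff_subset ⟨f, fun z hz => ?_⟩
      rw [Finset.mem_sdiff] at hz
      have hzD : z ∈ W \ {u, v} := by rw [Finset.mem_sdiff]; exact ⟨hR z hz.1, hz.2⟩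
      have hz1 := hf z hzD
      refine ⟨?_, hz1.2⟩
      have h2 := hz1.1
      have hfW := (Finset.mem_sdiff.1 h2).1
      rw [Finset.mem_sdiff]
      refine ⟨?_, (Finset.mem_sdiff.1 h2).2⟩
      have hz0 := hz.1
      simp only [Finset.mem_insert] at hz0 ⊢
      rcases hz0 with rfl | rfl | hz0
      · have : f z ∉ Q := fun h => hβ ⟨hzD, h⟩
        rw [mQ] at this; tauto
      · have : f z ∉ Q := fun h => hα ⟨hzD, h⟩
        rw [mQ] at this; tauto
      · have := hPc z hz0 _ hz1.2.2; tauto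

end CutS

section Ex
variable {V : Type*} [Fintype V] [DecidableEq V] {G B : SimpleGraph V} {W P : Finset V} {a b p q : V}

theorem half_four (hB : BicOn B W) (h : Cut B W a b P) (hp : p ∈ P) : 4 ≤ (insert b (insert a P)).card := by
  have h1 := h.even hB
  have h2 : 0 < P.card := Finset.card_pos.2 ⟨p, hp⟩
  have ha : a ∉ P := fun h' => (h.sub a h').2.1 rfl
  have hb : b ∉ insert a P := by
    have := h.ne
    simp; exact ⟨h.ne.symm, fun h' => (h.sub b h').2.2 rfl⟩
  rw [Finset.card_insert_of_notMem hb, Finset.card_insert_of_notMem ha]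
  obtain ⟨k, hk⟩ := h1
  omega

set_option maxHeartbeats 1000000 in
theorem side (hG : BrickOn G W) (hB : BicOn B W) (hBG : ∀ x y, B.Adj x y ↔ G.Adj x y ∧ s(x, y) ≠ s(p, q)) (h : Cut B W a b P) (hp : p ∈ P)
    (hqW : q ∈ W) (hqP : q ∉ P) (hqa : q ≠ a) (hqb : q ≠ b) (hnb : ¬ BrickOn (half B (insert b (insert a P)) a b p) (insert b (insert a P))) :
    ∃ c ∈ P, ∃ Y ⊆ P, c ∉ Y ∧ p ∈ Y ∧ Cut B W c b Y := by
  classical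
  by_contra hno
  push Not at hno
  apply hnb
  refine mkBrick' ⟨fun x y h => h.1, fun u hu v hv huv => h.bic hB hu hv huv⟩ (half_four hB h hp) ?_
  intro c hc d hd hcd f hf x hx y hy hfx
  by_contra hfy
  set R := insert b (insert a P) with hR
  have mR : ∀ z, z ∈ R ↔ z = b ∨ z = a ∨ z ∈ P := by intro z; simp [hR]
  have mRD : ∀ z, z ∈ R \ {c, d} ↔ z ∈ R ∧ z ≠ c ∧ z ≠ d := by intro z; simp
  have hRW : ∀ z ∈ R, z ∈ W := by
    intro z hz; rw [mR] at hz; rcases hz with rfl | rfl | hz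
    · exact h.mb
    · exact h.ma
    · exact (h.sub z hz).1
  have hqR : q ∉ R := by rw [mR]; tauto
  have hpR : p ∈ R := by rw [mR]; tauto
  have hpab := h.sub p hp
  have key : ∀ g : V → Prop, (∀ x ∈ R \ {c, d}, ∀ y ∈ R \ {c, d}, (half B R a b p).Adj x y → (g x ↔ g y)) → (a ∈ R \ {c, d} → ¬ g a) →
      (b ∈ R \ {c, d} → ¬ g b) → (∃ x ∈ R \ {c, d}, g x) → ∃ T, (p ∈ R \ {c, d} ∧ g p) ∧ p ∈ T ∧ Cut B W c d T ∧ T ⊆ P := by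
    rintro g hg ha hb ⟨x, hx, hgx⟩
    have hTP : (R \ {c, d}).filter g ⊆ P := by
      intro z hz
      rw [Finset.mem_filter] at hz
      have := (mRD z).1 hz.1
      rcases (mR z).1 this.1 with rfl | rfl | h'
      · exact absurd hz.2 (hb hz.1)
      · exact absurd hz.2 (ha hz.1)
      · exact h'
    have hcut : Cut B W c d ((R \ {c, d}).filter g) := by
      refine ⟨hRW c hc, hRW d hd, hcd, fun z hz => ?_, fun z hz w hzw => ?_⟩
      · have := (mRD z).1 (Finset.mem_filter.1 hz).1
        exact ⟨hRW z this.1, this.2⟩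
      · by_contra hw
        push Not at hw
        have hz' := Finset.mem_filter.1 hz
        have hwR : w ∈ R := by rw [mR]; have := h.cl z (hTP hz) w hzw; clear * - this; tauto
        have hwD : w ∈ R \ {c, d} := (mRD w).2 ⟨hwR, hw.2⟩
        exact hw.1 (Finset.mem_filter.2 ⟨hwD, (hg z hz'.1 w hwD ⟨((mRD z).1 hz'.1).1, hwR, hzw.ne, Or.inl hzw⟩).1 hz'.2⟩)
    suffices hpT : p ∈ (R \ {c, d}).filter g from ⟨_, Finset.mem_filter.1 hpT, hpT, hcut, hTP⟩
    by_contra hpT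
    have hqT : q ∉ (R \ {c, d}).filter g := fun h' => hqP (hTP h')
    obtain ⟨s, hs, t, ht, hst⟩ := hG.conn c (hRW c hc) d (hRW d hd) ((R \ {c, d}).filter g) (fun z hz => by
      have := hcut.sub z hz; simp only [Finset.mem_sdiff, Finset.mem_insert, Finset.mem_singleton]; tauto) ⟨x, Finset.mem_filter.2 ⟨hx, hgx⟩⟩ (fun e => by
      rw [e] at hqT
      apply hqT
      simp only [Finset.mem_sdiff, Finset.mem_insert, Finset.mem_singleton, not_or]
      exact ⟨hqW, fun e => hqR (e ▸ hc), fun e => hqR (e ▸ hd)⟩)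
    have hBs : B.Adj s t := by
      rw [hBG]; refine ⟨hst, ?_⟩
      rw [Ne, Sym2.eq_iff]
      rintro (⟨rfl, -⟩ | ⟨rfl, -⟩)
      · exact hpT hs
      · exact hqT hs
    have := hcut.cl s hs t hBs
    simp only [Finset.mem_sdiff, Finset.mem_insert, Finset.mem_singleton] at ht
    clear * - this ht; tauto
  have hpb : (half B R a b p).Adj p b := ⟨hpR, by simp [hR], hpab.2.2, by simp⟩
  have hab : (half B R a b p).Adj a b := ⟨by simp [hR], by simp [hR], h.ne, by simp⟩
  have fsw : ∀ w, ∀ x ∈ R \ {c, d}, ∀ y ∈ R \ {c, d}, (half B R a b p).Adj x y → ((f x ↔ ¬ f w) ↔ (f y ↔ ¬ f w)) := by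
    intro w x hx y hy hxy; rw [hf x hx y hy hxy]
  have fex : ∀ w, ∃ x ∈ R \ {c, d}, (f x ↔ ¬ f w) := by
    intro w
    by_cases hw : f w
    · exact ⟨y, hy, by tauto⟩
    · exact ⟨x, hx, by tauto⟩
  by_cases ha : a ∈ R \ {c, d}
  · obtain ⟨T, h0, h1, h2, h3⟩ := key (fun z => (f z ↔ ¬ f a)) (fsw a) (by clear * -; tauto) (fun hb => by have := hf a ha b hb hab; clear * - this; tauto) (fex a)
    have hb : b ∉ R \ {c, d} := by
      intro hb
      have hcab := hf a ha b hb hab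
      have := hf p h0.1 b hb hpb
      clear * - this h0 hcab; tauto
    have haa := (mRD a).1 ha
    have hbR : b ∈ R := by simp [hR]
    rw [mRD] at hb
    have hb' : c = b ∨ d = b := by clear * - hb hbR; tauto
    rcases hb' with rfl | rfl
    · have hdP : d ∈ P := by have := (mR d).1 hd; clear * - this haa hcd; tauto
      exact hno d hdP _ h3 (fun h' => (h2.sub d h').2.2 rfl) h1 h2.symm
    · have hdP : c ∈ P := by have := (mR c).1 hc; clear * - this haa hcd; tauto
      exact hno c hdP _ h3 (fun h' => (h2.sub c h').2.1 rfl) h1 h2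
  · by_cases hb : b ∈ R \ {c, d}
    · obtain ⟨-, h1, -⟩ := key (fun z => (f z ↔ ¬ f b)) (fsw b) (fun h => absurd h ha) (by clear * -; tauto) (fex b)
      have := hf p h1.1 b hb hpb
      clear * - this h1; tauto
    · obtain ⟨-, h1, -⟩ := key f hf (fun h => absurd h ha) (fun h => absurd h hb) ⟨x, hx, hfx⟩
      obtain ⟨-, h2, -⟩ := key (fun z => ¬ f z) (fun x hx y hy hxy => by rw [hf x hx y hy hxy]) (fun h => absurd h ha) (fun h => absurd h hb) ⟨y, hy, hfy⟩
      exact h2.2 h1.2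

theorem exCut (hG : BrickOn G W) (hB : BicOn B W) (hBG : ∀ x y, B.Adj x y ↔ G.Adj x y ∧ s(x, y) ≠ s(p, q)) (hpW : p ∈ W) (hqW : q ∈ W) (hnb : ¬ BrickOn B W) :
    ∃ a b P, Cut B W a b P ∧ p ∈ P ∧ q ∉ P ∧ q ≠ a ∧ q ≠ b := by
  by_contra hno
  push Not at hno
  apply hnb
  refine mkBrick hB.1 hG.four hB.2 ?_
  intro a ha b hb hab X hX hne hnX
  by_contra hcr
  push Not at hcr
  have hcut : Cut B W a b X := by
    refine ⟨ha, hb, hab, fun x hx => by have := hX hx; simp at this; tauto, fun x hx y hxy => ?_⟩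
    by_contra hy
    push Not at hy
    exact hcr x hx y (by simp; exact ⟨⟨hB.1 y x hxy.symm, hy.2⟩, hy.1⟩) hxy
  obtain ⟨x, hx, y, hy, hxy⟩ := hG.conn a ha b hb X hX hne hnX
  have hn : ¬ B.Adj x y := hcr x hx y hy
  rw [hBG] at hn
  have he : s(x, y) = s(p, q) := by by_contra h; exact hn ⟨hxy, h⟩
  simp at hy
  rw [Sym2.eq_iff] at he
  rcases he with ⟨rfl, rfl⟩ | ⟨rfl, rfl⟩
  · exact hy.1.2.2 (hno a b X hcut hx hy.2 hy.1.2.1)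
  · have hxs := hcut.sub x hx
    exact hxs.2.2 (hno a b _ (hcut.compl hB) (by simp; tauto) (by simp; tauto) hxs.2.1)

set_option maxHeartbeats 1000000 in
theorem exGood (hG : BrickOn G W) (hB : BicOn B W) (hBG : ∀ x y, B.Adj x y ↔ G.Adj x y ∧ s(x, y) ≠ s(p, q)) (hpW : p ∈ W) (hqW : q ∈ W) (hnb : ¬ BrickOn B W) :
    ∃ a b P, Cut B W a b P ∧ p ∈ P ∧ q ∈ (W \ {a, b}) \ P ∧ BrickOn (half B (insert b (insert a P)) a b p) (insert b (insert a P)) ∧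
      BrickOn (half B (insert a (insert b ((W \ {a, b}) \ P))) b a q) (insert a (insert b ((W \ {a, b}) \ P))) := by
  classical
  have hex : ∃ n, ∃ a b P, Cut B W a b P ∧ p ∈ P ∧ q ∉ P ∧ q ≠ a ∧ q ≠ b ∧ P.card = n := by
    obtain ⟨a, b, P, h⟩ := exCut hG hB hBG hpW hqW hnb
    exact ⟨_, a, b, P, h.1, h.2.1, h.2.2.1, h.2.2.2.1, h.2.2.2.2, rfl⟩
  obtain ⟨a, b, P, hc, hp, hq, hqa, hqb, hcard⟩ := Nat.find_spec hex
  have hmin : ∀ a b P', Cut B W a b P' → p ∈ P' → q ∉ P' → q ≠ a → q ≠ b → P.card ≤ P'.card := by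
    intro a b P' h1 h2 h3 h4 h5
    rw [hcard]
    exact Nat.find_min' hex ⟨a, b, P', h1, h2, h3, h4, h5, rfl⟩
  have hPb : ∀ a b, Cut B W a b P → q ≠ a → q ≠ b → BrickOn (half B (insert b (insert a P)) a b p) (insert b (insert a P)) := by
    intro a b hc hqa hqb
    by_contra hn
    obtain ⟨c, hcP, Y, hY, hcY, hpY, hcut⟩ := side hG hB hBG hc hp hqW hq hqa hqb hn
    have h1 := hmin c b Y hcut hpY (fun h => hq (hY h)) (fun e => hq (e ▸ hcP)) hqb
    exact absurd (Finset.card_lt_card (Finset.ssubset_iff_subset_ne.2 ⟨hY, fun e => hcY (e ▸ hcP)⟩)) (by omega)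
  have hpab := hc.sub p hp
  have hpW := hpab.1
  have hqQ : q ∈ (W \ {a, b}) \ P := by simp; tauto
  have hBG' : ∀ x y, B.Adj x y ↔ G.Adj x y ∧ s(x, y) ≠ s(q, p) := by intro x y; rw [hBG, Sym2.eq_swap (a := q)]
  by_cases h1 : BrickOn (half B (insert a (insert b ((W \ {a, b}) \ P))) b a q) (insert a (insert b ((W \ {a, b}) \ P)))
  · exact ⟨a, b, P, hc, hp, hqQ, hPb a b hc hqa hqb, h1⟩
  by_cases h2 : BrickOn (half B (insert b (insert a ((W \ {b, a}) \ P))) a b q) (insert b (insert a ((W \ {b, a}) \ P)))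
  · refine ⟨b, a, P, hc.symm, hp, by rwa [Finset.pair_comm], hPb b a hc.symm hqb hqa, h2⟩
  exfalso
  rw [Finset.pair_comm b a] at h2
  have hcQ := hc.compl hB
  obtain ⟨c, hcQm, D1, hD1, hcD1, hq1, hcut1⟩ := side hG hB hBG' hcQ.symm hqQ hpW (by simp [hp]) hpab.2.2 hpab.2.1 h1
  obtain ⟨d, hdQm, D2, hD2, hdD2, hq2, hcut2⟩ := side hG hB hBG' hcQ hqQ hpW (by simp [hp]) hpab.2.1 hpab.2.2 h2
  have sQ := hcQ.sub
  have aQ : a ∉ (W \ {a, b}) \ P := by simp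
  have bQ : b ∉ (W \ {a, b}) \ P := by simp
  have pQ : p ∉ (W \ {a, b}) \ P := by simp [hp]
  generalize (W \ {a, b}) \ P = Q at *
  have aD1 : a ∉ D1 := fun h => aQ (hD1 h)
  have aD2 : a ∉ D2 := fun h => aQ (hD2 h)
  have bD1 : b ∉ D1 := fun h => bQ (hD1 h)
  have bD2 : b ∉ D2 := fun h => bQ (hD2 h)
  have ca : c ≠ a := fun e => aQ (e ▸ hcQm)
  have cb : c ≠ b := fun e => bQ (e ▸ hcQm)
  have da : d ≠ a := fun e => aQ (e ▸ hdQm)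
  have db : d ≠ b := fun e => bQ (e ▸ hdQm)
  have hN : ∀ x ∈ D1 ∩ D2, ∀ y, B.Adj x y → y ∈ D1 ∩ D2 ∨ (y = c ∧ (c ∈ D2 ∨ c = d)) ∨ (y = d ∧ (d ∈ D1 ∨ c = d)) := by
    intro x hx y hxy
    rw [Finset.mem_inter] at hx ⊢
    have hh1 := hcut1.cl x hx.1 y hxy
    have hh2 := hcut2.cl x hx.2 y hxy
    have hab := hc.ne
    clear * - hh1 hh2 hab aD1 aD2 bD1 bD2 ca cb da db
    rcases hh1 with hh1 | rfl | rfl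
    · rcases hh2 with hh2 | rfl | rfl
      · exact Or.inl ⟨hh1, hh2⟩
      · exact Or.inr (Or.inr ⟨rfl, Or.inl hh1⟩)
      · exact absurd hh1 bD1
    · rcases hh2 with hh2 | rfl | rfl
      · exact Or.inr (Or.inl ⟨rfl, Or.inl hh2⟩)
      · exact Or.inr (Or.inl ⟨rfl, Or.inr rfl⟩)
      · exact absurd rfl cb
    · rcases hh2 with hh2 | hh2 | hh2
      · exact absurd hh2 aD2
      · exact absurd hh2.symm da
      · exact absurd hh2 hab
  have oc : ∀ e ∈ Q, e ∉ D1 ∩ D2 → (∀ x ∈ D1 ∩ D2, ∀ y, B.Adj x y → y ∈ D1 ∩ D2 ∨ y = e) → False := by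
    intro e he heD hcl
    have heW := (sQ e he).1
    obtain ⟨x, hx, y, hy, hxy⟩ := onecut (a := e) hG.four hB.2 heW (X := D1 ∩ D2) (fun z hz => by
      simp only [Finset.mem_sdiff, Finset.mem_singleton]
      exact ⟨(sQ z (hD1 (Finset.mem_inter.1 hz).1)).1, fun h => heD (h ▸ hz)⟩) ⟨q, by simp [hq1, hq2]⟩ (fun h => by
      have : p ∈ D1 ∩ D2 := by
        rw [h]; simp only [Finset.mem_sdiff, Finset.mem_singleton]; exact ⟨hpW, fun h => pQ (h ▸ he)⟩
      exact pQ (hD1 (Finset.mem_inter.1 this).1))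
    have := hcl x hx y hxy
    rw [Finset.mem_sdiff, Finset.mem_sdiff, Finset.mem_singleton] at hy
    clear * - this hy; tauto
  have cD : c ∉ D1 ∩ D2 := fun h => hcD1 (Finset.mem_inter.1 h).1
  have dD : d ∉ D1 ∩ D2 := fun h => hdD2 (Finset.mem_inter.1 h).2
  have hcd : c ≠ d := by
    rintro rfl
    exact oc c hcQm cD (fun x hx y hxy => by have := hN x hx y hxy; clear * - this; tauto)
  have hcD2 : c ∈ D2 := by
    by_contra hn
    exact oc d hdQm dD (fun x hx y hxy => by have := hN x hx y hxy; clear * - this hn hcd; tauto)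
  have hdD1 : d ∈ D1 := by
    by_contra hn
    exact oc c hcQm cD (fun x hx y hxy => by have := hN x hx y hxy; clear * - this hn hcd; tauto)
  have e1 := hcut1.even hB
  have e2 : Even (D1 ∩ D2).card := Cut.even hB (a := c) (b := d) ⟨(sQ c hcQm).1, (sQ d hdQm).1, hcd, fun x hx => 
    ⟨(sQ x (hD1 (Finset.mem_inter.1 hx).1)).1, fun h => cD (h ▸ hx), fun h => dD (h ▸ hx)⟩, fun x hx y hxy => by have := hN x hx y hxy; clear * - this; tauto⟩
  have e3 : Even ((D1 \ D2).erase d).card := Cut.even hB (a := a) (b := d) ⟨hc.ma, (sQ d hdQm).1, da.symm, fun x hx => by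
      simp only [Finset.mem_erase, Finset.mem_sdiff] at hx
      exact ⟨(sQ x (hD1 hx.2.1)).1, fun h => aD1 (h ▸ hx.2.1), hx.1⟩, fun x hx y hxy => by
      simp only [Finset.mem_erase, Finset.mem_sdiff] at hx ⊢
      have hh1 := hcut1.cl x hx.2.1 y hxy
      have hh2 : y ∉ D2 := fun h => by
        rcases hcut2.cl y h x hxy.symm with h | h | h
        · exact hx.2.2 h
        · exact hx.1 h
        · exact bD1 (h ▸ hx.2.1)
      have hh3 : y ≠ c := fun h => hh2 (h ▸ hcD2)
      clear * - hh1 hh2 hh3; tauto⟩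
  have k1 := Finset.card_erase_add_one (s := D1 \ D2) (a := d) (by simp [hdD1, hdD2])
  have k2 := Finset.card_sdiff_add_card_inter D1 D2
  obtain ⟨x1, hx1⟩ := e1
  obtain ⟨x2, hx2⟩ := e2
  obtain ⟨x3, hx3⟩ := e3
  omega

end Ex

section Glue
variable {V : Type*} [Fintype V] [DecidableEq V] {G B : SimpleGraph V} {W P : Finset V} {a b p q : V}

theorem s2x {x y a b : V} (h1 : x ≠ b) (h2 : y ≠ b) : s(x, y) ≠ s(a, b) := by
  rw [Ne, Sym2.eq_iff]; clear * - h1 h2; tauto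
theorem s2y {x a b : V} (h1 : x ≠ a) (h2 : x ≠ b) (y : V) : s(x, y) ≠ s(a, b) := by
  rw [Ne, Sym2.eq_iff]; clear * - h1 h2; tauto

theorem ec_del (S : SimpleGraph V) {e f : Sym2 V} (hef : e ≠ f) {α β : ℕ} (hα : α ≤ 1) (hβ : β ≤ 1) (h1 : α = 1 → e ∈ S.edgeSet) (h2 : β = 1 → f ∈ S.edgeSet) :
    ec (S.deleteEdges {e, f}) + α + β ≤ ec S := by
  classical
  unfold ec
  rw [edgeSet_deleteEdges]
  let T : Finset (Sym2 V) := (if α = 1 then {e} else ∅) ∪ (if β = 1 then {f} else ∅)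
  have hT : T.card = α + β := by
    simp only [T]
    clear * - hef hα hβ
    obtain rfl | rfl : α = 0 ∨ α = 1 := by omega
    all_goals obtain rfl | rfl : β = 0 ∨ β = 1 := by omega
    all_goals simp [Finset.card_pair hef, ← Finset.insert_eq]
  have hTS : (T : Set (Sym2 V)) ⊆ S.edgeSet := by
    intro z hz
    simp only [T, Finset.mem_coe, Finset.mem_union] at hz
    rcases hz with hz | hz
    · split_ifs at hz with h
      · simp at hz; exact hz ▸ h1 h
      · simp at hz
    · split_ifs at hz with h
      · simp at hz; exact hz ▸ h2 h
      · simp at hz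
  have h3 : S.edgeSet \ {e, f} ⊆ S.edgeSet \ (T : Set (Sym2 V)) := by
    rintro z ⟨hz, hz'⟩
    refine ⟨hz, fun h => hz' ?_⟩
    simp only [T, Finset.mem_coe, Finset.mem_union] at h
    rcases h with h | h <;> split_ifs at h <;> simp at h <;> simp [h]
  have h4 := Set.ncard_le_ncard h3 (Set.toFinite _)
  have h5 := Set.ncard_sdiff_add_ncard_of_subset hTS (Set.toFinite _)
  rw [Set.ncard_coe_finset, hT] at h5
  omega

set_option maxHeartbeats 1000000 in
theorem glue (hG : BrickOn G W) (hmin : ∀ H ≤ G, BrickOn H W → H = G) (hpq : G.Adj p q) (hB : BicOn B W) (hBG : ∀ x y, B.Adj x y ↔ G.Adj x y ∧ s(x, y) ≠ s(p, q))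
    {Q : Finset V} (hQ : (W \ {a, b}) \ P = Q)
    (hc : Cut B W a b P) (hp : p ∈ P) (hq : q ∈ Q) {S1 S2 : SimpleGraph V} (hS1 : S1 ≤ half B (insert b (insert a P)) a b p)
    (hS2 : S2 ≤ half B (insert a (insert b Q)) b a q) (hb1 : BrickOn S1 (insert b (insert a P))) (hb2 : BrickOn S2 (insert a (insert b Q)))
    {α1 β1 α2 β2 : ℕ} (hα1 : α1 ≤ 1) (hβ1 : β1 ≤ 1) (hα2 : α2 ≤ 1) (hβ2 : β2 ≤ 1) (h1 : α1 = 1 → S1.Adj b a) (h2 : β1 = 1 → S1.Adj b p)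
    (h3 : α2 = 1 → S2.Adj a b) (h4 : β2 = 1 → S2.Adj a q) : ec G + α1 + β1 + α2 + β2 ≤ ec S1 + ec S2 + 1 := by
  have mQ : ∀ z, z ∈ Q ↔ z ∈ W ∧ z ≠ a ∧ z ≠ b ∧ z ∉ P := by intro z; rw [← hQ]; simp; tauto
  have hpp := hc.sub p hp
  have hqq := (mQ q).1 hq
  have hab := hc.ne
  have haP : a ∉ P := fun h => (hc.sub a h).2.1 rfl
  have hbP : b ∉ P := fun h => (hc.sub b h).2.2 rfl
  have haQ : a ∉ Q := fun h => ((mQ a).1 h).2.1 rfl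
  have hbQ : b ∉ Q := fun h => ((mQ b).1 h).2.2.1 rfl
  have hPQ : ∀ z, z ∈ P → z ∉ Q := fun z h h' => ((mQ z).1 h').2.2.2 h
  set U := S1.deleteEdges {s(a, b), s(p, b)} ⊔ S2.deleteEdges {s(a, b), s(q, a)} ⊔ edge p q with hU
  have aU : ∀ x y, U.Adj x y ↔ (S1.Adj x y ∧ s(x, y) ≠ s(a, b) ∧ s(x, y) ≠ s(p, b)) ∨ (S2.Adj x y ∧ s(x, y) ≠ s(a, b) ∧ s(x, y) ≠ s(q, a)) ∨ s(x, y) = s(p, q) := by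
    intro x y
    have he : (edge p q).Adj x y ↔ s(x, y) = s(p, q) := by
      rw [edge_adj, Sym2.eq_iff]
      refine ⟨fun h => h.1, fun h => ⟨h, ?_⟩⟩
      have := hpq.ne
      rcases h with ⟨rfl, rfl⟩ | ⟨rfl, rfl⟩
      · exact this
      · exact this.symm
    rw [hU, sup_adj, sup_adj, he, deleteEdges_adj, deleteEdges_adj]
    simp only [Set.mem_insert_iff, Set.mem_singleton_iff, not_or, or_assoc, Ne]
  have hUG : U ≤ G := by
    intro x y hxy
    rw [aU] at hxy
    rcases hxy with ⟨h, h5, h6⟩ | ⟨h, h5, h6⟩ | h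
    · have := (hS1 h).2.2.2
      exact ((hBG x y).1 (this.resolve_right (by clear * - h5 h6; tauto))).1
    · have := (hS2 h).2.2.2
      rw [Sym2.eq_swap (a := b)] at this
      exact ((hBG x y).1 (this.resolve_right (by clear * - h5 h6; tauto))).1
    · rw [← mem_edgeSet, h]; exact hpq
  have hW : insert a P ∪ insert b Q = W := by
    ext z
    simp only [Finset.mem_union, Finset.mem_insert, mQ]
    constructor
    · rintro ((rfl | h) | (rfl | h))
      · exact hc.ma
      · exact (hc.sub z h).1
      · exact hc.mb
      · exact h.1
    · clear * -; tauto
  have hdis : Disjoint (insert a P) (insert b Q) := by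
    rw [Finset.disjoint_left]
    intro z hz hz'
    simp only [Finset.mem_insert] at hz hz'
    rcases hz with rfl | hz <;> rcases hz' with hz' | hz'
    · exact hab hz'
    · exact haQ hz'
    · exact hbP (hz' ▸ hz)
    · exact hPQ z hz hz'
  have nb : ∀ z ∈ insert a P, z ≠ b := by
    rintro z hz rfl
    rcases Finset.mem_insert.1 hz with h | h
    · exact hab h.symm
    · exact hbP h
  have na : ∀ z ∈ insert b Q, z ≠ a := by
    rintro z hz rfl
    rcases Finset.mem_insert.1 hz with h | h
    · exact hab h
    · exact haQ h
  obtain ⟨z1, hz1, hz1m, hz1b, hz1q⟩ := hb2.nb (x := a) (a := b) (b := q) (by simp) (by simp) (by simp [hq]) hab hqq.2.1.symm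
  obtain ⟨z2, hz2, hz2m, hz2a, hz2p⟩ := hb1.nb (x := b) (a := a) (b := p) (by simp) (by simp) (by simp [hp]) hab.symm hpp.2.2.symm
  have hz1Q : z1 ∈ Q := by have := hz1.ne; simp at hz1m; clear * - this hz1m hz1b; tauto
  have hz2P : z2 ∈ P := by have := hz2.ne; simp at hz2m; clear * - this hz2m hz2a; tauto
  have u1 : U.Adj a z1 := (aU _ _).2 (Or.inr (Or.inl ⟨hz1, by
    rw [Ne, Sym2.eq_iff]; rintro (⟨-, h⟩ | ⟨h, -⟩)
    · exact hz1b h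
    · exact hab h, by
    rw [Ne, Sym2.eq_iff]; rintro (⟨h, -⟩ | ⟨-, h⟩)
    · exact hqq.2.1 h.symm
    · exact hz1q h⟩))
  have u2 : U.Adj z2 b := (aU _ _).2 (Or.inl ⟨hz2.symm, by
    rw [Ne, Sym2.eq_iff]; rintro (⟨h, -⟩ | ⟨-, h⟩)
    · exact hz2a h
    · exact hab h.symm, by
    rw [Ne, Sym2.eq_iff]; rintro (⟨h, -⟩ | ⟨-, h⟩)
    · exact hz2p h
    · exact hpp.2.2 h.symm⟩)
  have u3 : U.Adj p q := (aU _ _).2 (Or.inr (Or.inr rfl))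
  have H1 : Half U S1 (insert a P) (insert b Q) b := by
    refine ⟨hb1, by simp, fun x hx y hy hxy => (aU _ _).2 (Or.inl ⟨hxy, ?_, ?_⟩), fun x hx hxb => ?_⟩
    · exact s2x (nb x hx) (nb y hy)
    · exact s2x (nb x hx) (nb y hy)
    · by_cases e1 : x = a
      · subst e1; exact ⟨z1, by simp [hz1Q], u1⟩
      · by_cases e2 : x = p
        · subst e2; exact ⟨q, by simp [hq], u3⟩
        · refine ⟨b, by simp, (aU _ _).2 (Or.inl ⟨hxb, ?_, ?_⟩)⟩
          · exact s2y e1 (nb x hx) _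
          · exact s2y e2 (nb x hx) _
  have H2 : Half U S2 (insert b Q) (insert a P) a := by
    refine ⟨hb2, by simp, fun x hx y hy hxy => (aU _ _).2 (Or.inr (Or.inl ⟨hxy, ?_, ?_⟩)), fun x hx hxb => ?_⟩
    · rw [Sym2.eq_swap (a := a)]; exact s2x (na x hx) (na y hy)
    · exact s2x (na x hx) (na y hy)
    · by_cases e1 : x = b
      · subst e1; exact ⟨z2, by simp [hz2P], u2.symm⟩
      · by_cases e2 : x = q
        · subst e2; exact ⟨p, by simp [hp], u3.symm⟩
        · refine ⟨a, by simp, (aU _ _).2 (Or.inr (Or.inl ⟨hxb, ?_, ?_⟩))⟩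
          · exact s2y (na x hx) e1 _
          · exact s2y e2 (na x hx) _
  have hbr := splice hdis (fun x y h => by rw [hW]; exact hG.sub x y (hUG h)) H1 H2 (by
    intro c hcc d hd
    have hpa := hpp.2.1
    by_cases f1 : p ≠ c ∧ q ≠ d
    · exact ⟨p, by simp [hp], q, by simp [hq], f1.1, f1.2, u3⟩
    · by_cases f2 : a ≠ c ∧ z1 ≠ d
      · exact ⟨a, by simp, z1, by simp [hz1Q], f2.1, f2.2, u1⟩
      · refine ⟨z2, by simp [hz2P], b, by simp, ?_, ?_, u2⟩
        · rintro rfl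
          have e1 : q = d := by by_contra h; exact f1 ⟨hz2p.symm, h⟩
          exact f2 ⟨hz2a.symm, e1 ▸ hz1q⟩
        · rintro rfl
          have e1 : p = c := by by_contra h; exact f1 ⟨h, hqq.2.2.1⟩
          exact f2 ⟨e1 ▸ hpa.symm, hz1b⟩)
  rw [hW] at hbr
  have hUe := hmin U hUG hbr
  have c1 := ec_del S1 (e := s(a, b)) (f := s(p, b)) (s2y hpp.2.1.symm hab _) hα1 hβ1 (fun h => (h1 h).symm) (fun h => (h2 h).symm)
  have c2 := ec_del S2 (e := s(a, b)) (f := s(q, a)) (by rw [Sym2.eq_swap]; exact s2y hqq.2.2.1.symm hab.symm _) hα2 hβ2 (fun h => h3 h) (fun h => (h4 h).symm)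
  have c3 := ec_add (S1.deleteEdges {s(a, b), s(p, b)} ⊔ S2.deleteEdges {s(a, b), s(q, a)}) p q
  have c4 := ec_sup (S1.deleteEdges {s(a, b), s(p, b)}) (S2.deleteEdges {s(a, b), s(q, a)})
  rw [← hU, hUe] at c3
  omega

end Glue

section VV
variable {V : Type*} [Fintype V] [DecidableEq V] {G : SimpleGraph V} {W : Finset V} {φ : ℕ → V}

abbrev I4 : List ℕ := [0, 1, 2, 3]
abbrev K4 : List (ℕ × ℕ) := [(0, 1), (0, 2), (0, 3), (1, 2), (1, 3), (2, 3)]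
abbrev exL : List (List ℕ × List (ℕ × ℕ)) := [(I4, K4), (I6, W5), (I6, Pr), (I8, W7)]

def addE (L : List (ℕ × ℕ)) (i j : ℕ) : List (ℕ × ℕ) := if elB L i j then L else (i, j) :: L
def candE (E : List (ℕ × ℕ)) : List (List (ℕ × ℕ)) :=
  E :: (E.map fun e => E.erase e) ++ (E.flatMap fun e => E.map fun f => (E.erase e).erase f)
def vB1 (L : List (ℕ × ℕ)) (I : List ℕ) (i j k : ℕ) : Bool :=
  decide (2 * L.length + 14 ≤ 5 * I.length + 2 * (elB L i j).toNat + 2 * (elB L i k).toNat + if I.length = 4 then 2 else 0)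
def vB (L : List (ℕ × ℕ)) (I : List ℕ) (i j k : ℕ) : Bool :=
  (candE (addE L i j) ++ candE (addE (addE L i j) i k)).any fun L' => vB1 L' I i j k &&
    (I.all fun x => Nat.ble 3 (L'.countP fun e => Nat.beq e.1 x || Nat.beq e.2 x)) && brickB L' I && L'.all fun e => elB (addE (addE L i j) i k) e.1 e.2
def vAll (L : List (ℕ × ℕ)) (I : List ℕ) : Bool := I.all fun i => I.all fun j => I.all fun k => i == j || i == k || j == k || vB1 L I i j k || vB L I i j k

theorem exL_ok : (exL.all fun p => decide (p.1.Nodup ∧ 4 ≤ p.1.length) && brickB p.2 p.1 && vAll p.2 p.1) = true := by decide +kernel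

def Exc (G : SimpleGraph V) (W : Finset V) : Prop := ∃ p ∈ exL, W.card = p.1.length ∧ ∃ φ, Loc G W φ p.1 p.2

theorem addE_loc {I L} (h : Loc G W φ I L) {i j : ℕ} (ha : G.Adj (φ i) (φ j)) : Loc G W φ I (addE L i j) := by
  unfold addE; split_ifs
  · exact h
  · exact h.cons ha

theorem exMin (hG : BrickOn G W) : ∃ S ≤ G, BrickOn S W ∧ ∀ H ≤ S, BrickOn H W → H = S := by
  obtain ⟨S, hS, hm⟩ := Set.exists_min_image {S : SimpleGraph V | S ≤ G ∧ BrickOn S W} ec (Set.toFinite _) ⟨G, le_rfl, hG⟩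
  refine ⟨S, hS.1, hS.2, fun H hH hb => ?_⟩
  by_contra hne
  exact absurd (hm H ⟨hH.trans hS.1, hb⟩) (not_le.2 (ec_lt (lt_of_le_of_ne hH hne)))

theorem lemV (hG : BrickOn G W) (hR : ∀ S ≤ G, BrickOn S W → (∀ H ≤ S, BrickOn H W → H = S) → 2 * ec S + 14 ≤ 5 * W.card ∨ Exc S W)
    {x y z : V} (hy : G.Adj x y) (hz : G.Adj x z) (hyz : y ≠ z) :
    ∃ S ≤ G, BrickOn S W ∧ ∃ α β, α ≤ 1 ∧ β ≤ 1 ∧ (α = 1 → S.Adj x y) ∧ (β = 1 → S.Adj x z) ∧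
      2 * ec S + 14 ≤ 5 * W.card + 2 * α + 2 * β + if W.card = 4 then 2 else 0 := by
  obtain ⟨S, hSG, hS, hm⟩ := exMin hG
  rcases hR S hSG hS hm with h | ⟨p, hp, hc, φ, h⟩
  · exact ⟨S, hSG, hS, 0, 0, by simp, by simp, by simp, by simp, by omega⟩
  have hk := List.all_eq_true.1 exL_ok p hp
  obtain ⟨I, L⟩ := p
  simp only [Bool.and_eq_true, decide_eq_true_eq] at hk hc h
  obtain ⟨⟨⟨hn, h4⟩, hb⟩, hv⟩ := hk
  have hW := h.full hn hc.le
  have hxW := hG.sub _ _ hy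
  have hyW := hG.sub _ _ hy.symm
  have hzW := hG.sub _ _ hz.symm
  rw [← hW, mem_im] at hxW hyW hzW
  obtain ⟨i, hi, rfl⟩ := hxW
  obtain ⟨j, hj, rfl⟩ := hyW
  obtain ⟨k, hk, rfl⟩ := hzW
  simp only [vAll, List.all_eq_true] at hv
  have hv := hv i hi j hj k hk
  have e1 : i ≠ j := by rintro rfl; exact hy.ne rfl
  have e2 : i ≠ k := by rintro rfl; exact hz.ne rfl
  have e3 : j ≠ k := by rintro rfl; exact hyz rfl
  have hg : Loc G W φ I L := ⟨h.ok, h.mem, h.out.mono hSG, fun i j hij => hSG (h.emb i j hij)⟩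
  simp only [Bool.or_eq_true, beq_iff_eq, e1, e2, e3, false_or] at hv
  obtain ⟨L', hl, hb', hL⟩ : ∃ L', vB1 L' I i j k = true ∧ brickB L' I = true ∧ Loc G W φ I L' := by
    rcases hv with hv | hv
    · exact ⟨L, hv, hb, hg⟩
    · simp only [vB, List.any_eq_true, Bool.and_eq_true] at hv
      obtain ⟨L', -, ⟨⟨hl, -⟩, hb'⟩, hs⟩ := hv
      exact ⟨L', hl, hb', (addE_loc (addE_loc hg hy) hz).sub L' hs⟩
  simp only [vB1, decide_eq_true_eq] at hl
  have hv : valB L' I = true := by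
    simp only [brickB, Bool.and_eq_true] at hb'; exact hb'.1.1
  refine ⟨gr φ L', gr_le hL, hW ▸ brickB_sound h.ok hn h4 hb', (elB L' i j).toNat, (elB L' i k).toNat, Bool.toNat_le _, Bool.toNat_le _, ?_, ?_, ?_⟩
  · intro e; exact gr_elB h.ok hv i hi j hj (by simpa using e)
  · intro e; exact gr_elB h.ok hv i hi k hk (by simpa using e)
  · have := ec_gr φ L'
    rw [hc]; omega

theorem small4 (hG : BrickOn G W) (h4 : W.card = 4) : Exc G W := by
  refine ⟨(I4, K4), by simp, by simp [h4], ?_⟩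
  obtain ⟨a, b, c, d, hab, hac, had, hbc, hbd, hcd, rfl⟩ := Finset.card_eq_four.1 h4
  have key : ∀ x y u v, ({a, b, c, d} : Finset V) \ {u, v} = {x, y} → x ≠ y → u ≠ v → u ∈ ({a, b, c, d} : Finset V) → v ∈ ({a, b, c, d} : Finset V) → G.Adj x y := by
    intro x y u v he hxy huv hu hv
    obtain ⟨f, hf⟩ := hG.bic u hu v hv huv
    rw [he] at hf
    have := hf x (by simp)
    have h1 := this.2.2.ne
    have h2 := this.1
    simp only [Finset.mem_insert, Finset.mem_singleton] at h2
    rcases h2 with h2 | h2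
    · exact (h1 h2.symm).elim
    · rw [← h2]; exact this.2.2
  have hab' := hab.symm
  have hac' := hac.symm
  have had' := had.symm
  have hbc' := hbc.symm
  have hbd' := hbd.symm
  have hcd' := hcd.symm
  have E1 : G.Adj a b := key a b c d (by ext z; simp; clear key; grind) hab hcd (by simp) (by simp)
  have E2 : G.Adj a c := key a c b d (by ext z; simp; clear key; grind) hac hbd (by simp) (by simp)
  have E3 : G.Adj a d := key a d b c (by ext z; simp; clear key; grind) had hbc (by simp) (by simp)
  have E4 : G.Adj b c := key b c a d (by ext z; simp; clear key; grind) hbc had (by simp) (by simp)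
  have E5 : G.Adj b d := key b d a c (by ext z; simp; clear key; grind) hbd hac (by simp) (by simp)
  have E6 : G.Adj c d := key c d a b (by ext z; simp; clear key; grind) hcd hab (by simp) (by simp)
  refine ⟨fun i => [a, b, c, d].getD i a, ?_, ?_, ?_, ?_⟩
  · intro i hi j hj
    simp at hi hj
    rcases hi with rfl | rfl | rfl | rfl <;> rcases hj with rfl | rfl | rfl | rfl <;> simp [*]
  · intro i hi
    simp at hi
    rcases hi with rfl | rfl | rfl | rfl <;> simp
  · have : ({a, b, c, d} : Finset V) \ im (fun i => [a, b, c, d].getD i a) (I4, K4).1 = ∅ := by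
      ext z; simp; tauto
    rw [this]; exact HasPM.empty _
  · intro i j hij
    simp [elB] at hij
    rcases hij with h | h
    · rcases h with ⟨rfl, rfl⟩ | ⟨rfl, rfl⟩ | ⟨rfl, rfl⟩ | ⟨rfl, rfl⟩ | ⟨rfl, rfl⟩ | ⟨rfl, rfl⟩ <;> simp [*]
    · rcases h with ⟨rfl, rfl⟩ | ⟨rfl, rfl⟩ | ⟨rfl, rfl⟩ | ⟨rfl, rfl⟩ | ⟨rfl, rfl⟩ | ⟨rfl, rfl⟩ <;> simp [*, SimpleGraph.adj_comm]

end VV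

section MainInd
variable {V : Type*} [Fintype V] [DecidableEq V]

theorem BrickOn.evenW {G : SimpleGraph V} {W : Finset V} (hG : BrickOn G W) : Even W.card := by
  have h4 := hG.four
  obtain ⟨u, hu, v, hv, huv⟩ := Finset.one_lt_card.1 (show 1 < W.card by omega)
  have h1 := (hG.bic u hu v hv huv).even
  have h2 := Finset.card_sdiff_add_card_eq_card (s := {u, v}) (t := W) (by intro z; simp; rintro (rfl | rfl) <;> assumption)
  rw [Finset.card_pair huv] at h2
  rw [← h2]; exact h1.add (by decide)

set_option maxHeartbeats 1000000 in
theorem mainR (n : ℕ) : ∀ (G : SimpleGraph V) (W : Finset V), W.card = n → BrickOn G W → (∀ H ≤ G, BrickOn H W → H = G) →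
    2 * ec G + 14 ≤ 5 * W.card ∨ Exc G W := by
  induction n using Nat.strong_induction_on with
  | _ n ih =>
  intro G W hn hG hmin
  have h4 := hG.four
  obtain ⟨m, hm⟩ := hG.evenW
  rcases Nat.lt_or_ge W.card 8 with h8 | h8
  · obtain h | h : W.card = 4 ∨ W.card = 6 := by omega
    · exact Or.inr (small4 hG h)
    · rcases small6 hG h with ⟨ψ, hψ⟩ | ⟨ψ, hψ⟩
      · exact Or.inr ⟨(I6, W5), by simp, by simp [h], ψ, hψ⟩
      · exact Or.inr ⟨(I6, Pr), by simp, by simp [h], ψ, hψ⟩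
  by_cases hx : ∃ p q, G.Adj p q ∧ BicOn (G.deleteEdges {s(p, q)}) W
  · left
    obtain ⟨p, q, hpq, hB⟩ := hx
    have hBG : ∀ x y, (G.deleteEdges {s(p, q)}).Adj x y ↔ G.Adj x y ∧ s(x, y) ≠ s(p, q) := by
      intro x y; rw [deleteEdges_adj]; simp
    set B := G.deleteEdges {s(p, q)} with hBd
    have hnb : ¬ BrickOn B W := by
      intro h
      have := hmin B (deleteEdges_le _) h
      rw [← this] at hpq
      exact ((hBG p q).1 hpq).2 rfl
    obtain ⟨a, b, P, hc, hp, hq, hb1, hb2⟩ := exGood hG hB hBG (hG.sub _ _ hpq) (hG.sub _ _ hpq.symm) hnb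
    have hcd : P.card + ((W \ {a, b}) \ P).card + 2 = W.card := by
      have e1 := Finset.card_sdiff_add_card_eq_card (s := {a, b}) (t := W) (by
        intro z; simp; rintro (rfl | rfl)
        · exact hc.ma
        · exact hc.mb)
      have e2 := Finset.card_sdiff_add_card_eq_card (s := P) (t := W \ {a, b}) (by
        intro z hz; have := hc.sub z hz; simp; clear * - this; tauto)
      rw [Finset.card_pair hc.ne] at e1
      omega
    have hq' : q ∈ W ∧ q ≠ a ∧ q ≠ b := by simp at hq; clear * - hq; tauto
    have haQ : a ∉ (W \ {a, b}) \ P := by simp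
    have hbQ : b ∉ (W \ {a, b}) \ P := by simp
    generalize hQ : (W \ {a, b}) \ P = Q at *
    have hab := hc.ne
    have hp' := hc.sub p hp
    have haP : a ∉ P := fun h => (hc.sub a h).2.1 rfl
    have hbP : b ∉ P := fun h => (hc.sub b h).2.2 rfl
    have c1 : (insert b (insert a P)).card = P.card + 2 := by
      rw [Finset.card_insert_of_notMem (by simp [hab.symm, hbP]), Finset.card_insert_of_notMem haP]
    have c2 : (insert a (insert b Q)).card = Q.card + 2 := by
      rw [Finset.card_insert_of_notMem (by simp [hab, haQ]), Finset.card_insert_of_notMem hbQ]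
    have f1 := hb1.four
    have f2 := hb2.four
    obtain ⟨S1, hS1, hs1, α1, β1, hα1, hβ1, k1, k2, k3⟩ := lemV hb1 (fun S _ hS hm => ih _ (by omega) S _ rfl hS hm) (x := b) (y := a) (z := p)
      ⟨by simp, by simp, hab.symm, Or.inr (Or.inl Sym2.eq_swap)⟩ ⟨by simp, by simp [hp], hp'.2.2.symm, Or.inr (Or.inr Sym2.eq_swap)⟩ hp'.2.1.symm
    obtain ⟨S2, hS2, hs2, α2, β2, hα2, hβ2, k4, k5, k6⟩ := lemV hb2 (fun S _ hS hm => ih _ (by omega) S _ rfl hS hm) (x := a) (y := b) (z := q)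
      ⟨by simp, by simp, hab, Or.inr (Or.inl Sym2.eq_swap)⟩ ⟨by simp, by simp [hq], hq'.2.1.symm, Or.inr (Or.inr Sym2.eq_swap)⟩ hq'.2.2.symm
    have := glue hG hmin hpq hB hBG hQ hc hp hq hS1 hS2 hs1 hs2 hα1 hβ1 hα2 hβ2 k1 k2 k4 k5
    rw [c1] at k3
    rw [c2] at k6
    clear * - this k3 k6 hcd h8
    split_ifs at k3 k6 <;> omega
  · have hmin' : ∀ H ≤ G, BicOn H W → H = G := by
      intro H hH hb
      by_contra hne
      apply hx
      have : ¬ G ≤ H := fun h => hne (le_antisymm hH h)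
      rw [SimpleGraph.le_iff_adj] at this
      push Not at this
      obtain ⟨p, q, hpq, hn⟩ := this
      refine ⟨p, q, hpq, fun x y h => hG.sub x y (deleteEdges_le _ h), fun u hu v hv huv => (hb.2 u hu v hv huv).mono ?_⟩
      intro x y hxy
      rw [deleteEdges_adj]
      refine ⟨hH hxy, fun h => hn ?_⟩
      rw [Set.mem_singleton_iff] at h
      rw [← mem_edgeSet, ← h]; exact hxy
    have key : Good G W 3 → 2 * ec G + 14 ≤ 5 * W.card := by
      intro hg
      obtain ⟨B, hBG, hE, hb, hc⟩ := hg.chain hG.toBic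
      have := hmin' B hBG ⟨fun x y h => hG.sub x y (hBG h), hb⟩
      subst this
      omega
    rcases Nat.lt_or_ge W.card 9 with h9 | h9
    · rcases small8 hG (by omega) hmin' with h | ⟨ψ, hψ⟩
      · exact Or.inl (key h)
      · exact Or.inr ⟨(I8, W7), by simp, by simp; omega, ψ, hψ⟩
    · exact Or.inl (key (good3 hG h9))

end MainInd

section Fin1
variable {V : Type*} [Fintype V] [DecidableEq V]

theorem brick_to {G : SimpleGraph V} (h : IsBrick G) : BrickOn G Finset.univ := by
  refine ⟨fun x y _ => Finset.mem_univ _, by simpa using h.1.1, fun u _ v _ huv => ?_, fun a _ b _ X hX hne hnX => ?_⟩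
  · exact (hasPM_iff G _ _ (by intro z; simp)).1 (h.2 u v huv)
  · by_contra hc
    push Not at hc
    have hcon := h.1.2 {a, b} ((Set.ncard_insert_le a {b}).trans (by simp))
    obtain ⟨x, hx⟩ := hne
    obtain ⟨y, hy, hyX⟩ : ∃ y ∈ Finset.univ \ {a, b}, y ∉ X := by
      by_contra hcc; push Not at hcc; exact hnX (Finset.Subset.antisymm hX hcc)
    have hx' := hX hx
    simp at hx' hy
    have key : ∀ u v : (({a, b} : Set V)ᶜ : Set V), (G.induce ({a, b} : Set V)ᶜ).Walk u v → u.1 ∈ X → v.1 ∈ X := by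
      intro u v w
      induction w with
      | nil => exact id
      | @cons u v w' huv _ ih =>
        intro hu
        apply ih
        by_contra hv
        refine hc u.1 hu v.1 ?_ huv
        have h1 : v.1 ∉ ({a, b} : Set V) := v.2
        simp at h1 ⊢
        exact ⟨h1, hv⟩
    obtain ⟨w⟩ := hcon.preconnected ⟨x, by simpa using hx'⟩ ⟨y, by simpa using hy⟩
    exact hyX (key _ _ w hx)

theorem brick_from {G : SimpleGraph V} (h : BrickOn G Finset.univ) : IsBrick G := by
  classical
  have h4 := h.four
  rw [Finset.card_univ] at h4
  refine ⟨⟨h4, fun S hS => ?_⟩, fun u v huv => (hasPM_iff G _ _ (by intro z; simp)).2 (h.bic u (Finset.mem_univ _) v (Finset.mem_univ _) huv)⟩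
  have hne : ∃ x, x ∉ S := by
    by_contra hc
    push Not at hc
    have : S = Set.univ := Set.eq_univ_of_forall hc
    rw [this, Set.ncard_univ, Nat.card_eq_fintype_card] at hS
    omega
  have cross : ∀ X : Finset V, (∀ x ∈ X, x ∉ S) → X.Nonempty → (∃ y, y ∉ S ∧ y ∉ X) → ∃ x ∈ X, ∃ y, y ∉ S ∧ y ∉ X ∧ G.Adj x y := by
    intro X hX hn ⟨y, hyS, hyX⟩
    rcases S.eq_empty_or_nonempty with rfl | ⟨a, ha⟩
    · obtain ⟨u, hu, v, hv, huv⟩ := h.toBic.conn X (Finset.subset_univ _) hn (fun e => hyX (e ▸ Finset.mem_univ _))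
      exact ⟨u, hu, v, by simp, by simpa using hv, huv⟩
    · obtain ⟨b, rfl⟩ : ∃ b, S = {a, b} := by
        by_cases hb : ∃ b ∈ S, b ≠ a
        · obtain ⟨b, hb, hba⟩ := hb
          refine ⟨b, (Set.eq_of_subset_of_ncard_le ?_ ?_ (Set.toFinite _)).symm⟩
          · rintro z (rfl | rfl) <;> assumption
          · rw [Set.ncard_pair hba.symm]; exact hS
        · push Not at hb
          refine ⟨a, ?_⟩
          ext z; simp
          exact ⟨hb z, fun e => e ▸ ha⟩
      obtain ⟨u, hu, v, hv, huv⟩ := h.conn a (Finset.mem_univ _) b (Finset.mem_univ _) X (fun z hz => by simpa using hX z hz) hn (by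
        rintro rfl; simp at hyX hyS; tauto)
      simp at hv
      exact ⟨u, hu, v, by simpa using hv.1, hv.2, huv⟩
  obtain ⟨x0, hx0⟩ := hne
  rw [connected_iff_exists_forall_reachable]
  refine ⟨⟨x0, hx0⟩, ?_⟩
  by_contra hc
  push Not at hc
  obtain ⟨⟨y, hy⟩, hyr⟩ := hc
  obtain ⟨u, hu, v, hv, hvX, huv⟩ := cross (Finset.univ.filter fun z => ∃ hz : z ∉ S, (G.induce Sᶜ).Reachable ⟨x0, hx0⟩ ⟨z, hz⟩)
    (fun z hz => (Finset.mem_filter.1 hz).2.1) ⟨x0, by simp [hx0]⟩ ⟨y, hy, by simp; exact fun _ => hyr⟩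
  simp only [Finset.mem_filter, Finset.mem_univ, true_and] at hu hvX
  obtain ⟨hu, hr⟩ := hu
  exact hvX ⟨hv, hr.trans (Adj.reachable (show (G.induce Sᶜ).Adj ⟨u, hu⟩ ⟨v, hv⟩ from huv))⟩

theorem isoOf {T : Type} [Fintype T] {H : SimpleGraph T} {φ : ℕ → V} {I L} (hφ : Ok φ I) (hv : valB L I = true) (c : T → ℕ)
    (hc : Function.Injective c) (hI : ∀ t, c t ∈ I) (hcard : Fintype.card T = Fintype.card V) (hadj : ∀ s t, H.Adj s t ↔ elB L (c s) (c t) = true) :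
    Nonempty (gr φ L ≃g H) := by
  have hinj : Function.Injective (fun t => φ (c t)) := fun s t h => hc (hφ _ (hI s) _ (hI t) h)
  have hb := (Fintype.bijective_iff_injective_and_card _).2 ⟨hinj, hcard⟩
  refine ⟨RelIso.symm ⟨Equiv.ofBijective _ hb, ?_⟩⟩
  intro s t
  rw [hadj]
  exact ⟨gr_inv hφ hv (hI s) (hI t), gr_elB hφ hv _ (hI s) _ (hI t)⟩

def wc (m : ℕ) : Option (Fin m) → ℕ
  | none => m
  | some i => i.1

theorem wc_inj (m : ℕ) : Function.Injective (wc m) := by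
  rintro (_ | i) (_ | j) h <;> simp only [wc] at h
  · rfl
  · omega
  · omega
  · rw [Fin.ext h]

def pc (x : Fin 2 × Fin 3) : ℕ := 3 * x.1.1 + x.2.1

theorem adj3 : ∀ s t, (wheel 3).Adj s t ↔ elB K4 (wc 3 s) (wc 3 t) = true := by
  simp only [wheel, fromRel_adj]; decide +kernel
theorem adj5 : ∀ s t, (wheel 5).Adj s t ↔ elB W5 (wc 5 s) (wc 5 t) = true := by
  simp only [wheel, fromRel_adj]; decide +kernel
theorem adj7 : ∀ s t, (wheel 7).Adj s t ↔ elB W7 (wc 7 s) (wc 7 t) = true := by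
  simp only [wheel, fromRel_adj]; decide +kernel
theorem adjp : ∀ s t, prism.Adj s t ↔ elB Pr (pc s) (pc t) = true := by
  simp only [prism, fromRel_adj]; decide +kernel

end Fin1

theorem minimalBrick_edge_bound' {V : Type*} [Fintype V]
    (G : SimpleGraph V) [DecidableRel G.Adj] (n : ℕ)
    (hcard : Fintype.card V = 2 * n) (hG : IsMinimalBrick G) :
    G.edgeFinset.card ≤ 5 * n - 7 ∨
      Nonempty (G ≃g prism) ∨ Nonempty (G ≃g wheel 3) ∨
      Nonempty (G ≃g wheel 5) ∨ Nonempty (G ≃g wheel 7) := by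
  classical
  have hb := brick_to hG.1
  have hmin : ∀ H ≤ G, BrickOn H Finset.univ → H = G := by
    intro H hH hbH
    by_contra hne
    have : ¬ G ≤ H := fun h => hne (le_antisymm hH h)
    rw [SimpleGraph.le_iff_adj] at this
    push Not at this
    obtain ⟨p, q, hpq, hn⟩ := this
    have hle : H ≤ G.deleteEdges {s(p, q)} := by
      intro x y hxy
      rw [deleteEdges_adj]
      refine ⟨hH hxy, fun h => hn ?_⟩
      rw [Set.mem_singleton_iff] at h
      rw [← mem_edgeSet, ← h]; exact hxy
    refine hG.2 s(p, q) hpq (brick_from ⟨fun x y _ => Finset.mem_univ _, hbH.four, fun u hu v hv huv => (hbH.bic u hu v hv huv).mono hle, ?_⟩)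
    intro a ha b hb' X hX hne hnX
    obtain ⟨x, hx, y, hy, hxy⟩ := hbH.conn a ha b hb' X hX hne hnX
    exact ⟨x, hx, y, hy, hle hxy⟩
  rcases mainR _ G Finset.univ rfl hb hmin with h | ⟨p, hp, hc, φ, hL⟩
  · left
    have : G.edgeFinset.card = ec G := by
      rw [ec, Set.ncard_eq_toFinset_card']; rfl
    rw [this]
    rw [Finset.card_univ, hcard] at h
    omega
  · right
    have hk := List.all_eq_true.1 exL_ok p hp
    simp only [Bool.and_eq_true, decide_eq_true_eq] at hk
    have hW := hL.full hk.1.1.1 hc.le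
    have he := hmin _ (gr_le hL) (hW ▸ brickB_sound hL.ok hk.1.1.1 hk.1.1.2 hk.1.2)
    have hv : valB p.2 p.1 = true := by
      have := hk.1.2
      simp only [brickB, Bool.and_eq_true] at this; exact this.1.1
    rw [Finset.card_univ] at hc
    have hok := hL.ok
    clear hk hL hW
    rw [← he]
    simp only [exL, List.mem_cons, List.not_mem_nil, or_false] at hp
    rcases hp with rfl | rfl | rfl | rfl
    · exact Or.inr (Or.inl (isoOf hok hv (wc 3) (wc_inj 3) (by decide) (by rw [hc]; rfl) adj3))
    · exact Or.inr (Or.inr (Or.inl (isoOf hok hv (wc 5) (wc_inj 5) (by decide) (by rw [hc]; rfl) adj5)))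
    · exact Or.inl (isoOf hok hv pc (by decide) (by decide) (by rw [hc]; rfl) adjp)
    · exact Or.inr (Or.inr (Or.inr (isoOf hok hv (wc 7) (wc_inj 7) (by decide) (by rw [hc]; rfl) adj7)))
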